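/- arXiv:1609.09056 — 2 statements merged into one kernel-verified Lean document; each statement's English description precedes it below -/
import Mathlib

section
/- Let d ≥ 1 be an integer and c₀ > 0. There exists a constant C, depending only on d and c₀, such that for all λ, N > 0, every measurable function f : ℝ^d × ℝ^d → [−1,1] supported in [0,N]^d × [0,N]^d, and every measurable function g : ℝ^d → ℝ supported in [−c₀λ, c₀λ]^d with finite U³-norm, one has |∫_{(ℝ^d)^3} f(x,y) f(x+s,y) f(x,y+s) g(s) ds dx dy| ≤ C N^{2d} λ^{d/2} ‖g‖_{U³}. -/
open MeasureTheory

/-- The integrand defining the Gowers `U³` norm of `g : ℝ^d → ℝ`: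
`∏_{ε ∈ {0,1}³} g(x + ε₁h₁ + ε₂h₂ + ε₃h₃)` at `w = (x, h₁, h₂, h₃)`. -/
noncomputable def u3Integrand {d : ℕ} (g : (Fin d → ℝ) → ℝ)
    (w : (Fin d → ℝ) × (Fin d → ℝ) × (Fin d → ℝ) × (Fin d → ℝ)) : ℝ :=
  g w.1 * g (w.1 + w.2.1) * g (w.1 + w.2.2.1) * g (w.1 + w.2.2.2) *
    g (w.1 + w.2.1 + w.2.2.1) * g (w.1 + w.2.1 + w.2.2.2) *
    g (w.1 + w.2.2.1 + w.2.2.2) * g (w.1 + w.2.1 + w.2.2.1 + w.2.2.2)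

/-- The Gowers `U³` norm of `g : ℝ^d → ℝ`. -/
noncomputable def u3Norm {d : ℕ} (g : (Fin d → ℝ) → ℝ) : ℝ :=
  (∫ w : (Fin d → ℝ) × (Fin d → ℝ) × (Fin d → ℝ) × (Fin d → ℝ), u3Integrand g w) ^
    ((1 : ℝ) / 8)

/-- The Cauchy–Schwarz inequality for real integrals. -/
theorem sq_integral_mul_le {α : Type*} [MeasurableSpace α] {μ : Measure α} {a P : α → ℝ}
    (ha : MemLp a 2 μ) (hP : MemLp P 2 μ) :
    (∫ x, a x * P x ∂μ) ^ 2 ≤ (∫ x, a x ^ 2 ∂μ) * ∫ x, P x ^ 2 ∂μ := by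
  have haP : Integrable (fun x => a x * P x) μ := ha.integrable_mul hP
  have key : ∀ t : ℝ, 0 ≤ (∫ x, a x ^ 2 ∂μ) * (t * t) + (-2 * ∫ x, a x * P x ∂μ) * t +
      ∫ x, P x ^ 2 ∂μ := by
    intro t
    have h : (∫ x, (P x - t * a x) ^ 2 ∂μ) = (∫ x, a x ^ 2 ∂μ) * (t * t) +
        (-2 * ∫ x, a x * P x ∂μ) * t + ∫ x, P x ^ 2 ∂μ := by
      have h' : ∀ x, (P x - t * a x) ^ 2 =
          ((t * t) * a x ^ 2 + (-2 * t) * (a x * P x)) + P x ^ 2 := fun x => by ring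
      simp_rw [h']
      have hs : Integrable (fun x => (t * t) * a x ^ 2 + (-2 * t) * (a x * P x)) μ :=
        (ha.integrable_sq.const_mul _).add (haP.const_mul _)
      rw [integral_add hs hP.integrable_sq,
        integral_add (ha.integrable_sq.const_mul _) (haP.const_mul _), integral_const_mul,
        integral_const_mul]
      ring
    rw [← h]
    positivity
  have := discrim_le_zero key
  rw [discrim] at this
  linarith

theorem integrable_of_measurable_of_abs_le {α : Type*} [MeasurableSpace α] {μ : Measure α}
    [IsFiniteMeasure μ] {f : α → ℝ} (hf : Measurable f) {M : ℝ} (hM : ∀ x, |f x| ≤ M) :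
    Integrable f μ :=
  Integrable.of_bound hf.aestronglyMeasurable M (ae_of_all _ hM)

theorem memLp_of_measurable_of_abs_le {α : Type*} [MeasurableSpace α] {μ : Measure α}
    [IsFiniteMeasure μ] {f : α → ℝ} (hf : Measurable f) {M : ℝ} (hM : ∀ x, |f x| ≤ M) :
    MemLp f 2 μ :=
  MemLp.of_bound hf.aestronglyMeasurable M (ae_of_all _ hM)

/-- Cyclic rotation of the factors of a triple product integral. -/
theorem integral_prod_rotate {A B C : Type*} [MeasurableSpace A] [MeasurableSpace B]
    [MeasurableSpace C] (μ : Measure A) (ν : Measure B) (ρ : Measure C) [SFinite μ] [SFinite ν]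
    [SFinite ρ] (φ : (A × B) × C → ℝ) :
    ∫ p, φ p ∂(μ.prod ν).prod ρ = ∫ q : (B × C) × A, φ ((q.2, q.1.1), q.1.2)
      ∂(ν.prod ρ).prod μ := by
  rw [← (measurePreserving_prodAssoc μ ν ρ).symm.integral_comp'
      (g := φ),
    ← (Measure.measurePreserving_swap (μ := ν.prod ρ) (ν := μ)).integral_comp
      MeasurableEquiv.prodComm.measurableEmbedding]
  rfl

/-- Cauchy–Schwarz in the first two variables of a triple integral: the factor that does not depend
on the third variable is eliminated at the cost of duplicating that variable. -/
theorem sq_integral_mul_le_duplicate {A B C : Type*} [MeasurableSpace A] [MeasurableSpace B]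
    [MeasurableSpace C] {μ : Measure A} {ν : Measure B} {ρ : Measure C} [IsFiniteMeasure μ]
    [IsFiniteMeasure ν] [IsFiniteMeasure ρ] {a : A × B → ℝ} {H : (A × B) × C → ℝ} {K M : ℝ}
    (ha : Measurable a) (haK : ∀ p, |a p| ≤ K) (hH : Measurable H) (hHM : ∀ p, |H p| ≤ M) :
    (∫ p, a p.1 * H p ∂(μ.prod ν).prod ρ) ^ 2 ≤ (∫ p, a p ^ 2 ∂μ.prod ν) *
      ∫ q : (B × (C × C)) × A, H ((q.2, q.1.1), q.1.2.1) * H ((q.2, q.1.1), q.1.2.2)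
        ∂(ν.prod (ρ.prod ρ)).prod μ := by
  have h1 : Integrable (fun p : (A × B) × C => a p.1 * H p) ((μ.prod ν).prod ρ) :=
    integrable_of_measurable_of_abs_le (by fun_prop) (M := K * M) fun p => by
      rw [abs_mul]
      exact mul_le_mul (haK _) (hHM _) (abs_nonneg _) ((abs_nonneg _).trans (haK p.1))
  have h2 : Integrable (fun p : (A × B) × (C × C) => H (p.1, p.2.1) * H (p.1, p.2.2))
      ((μ.prod ν).prod (ρ.prod ρ)) :=
    integrable_of_measurable_of_abs_le (by fun_prop) (M := M * M) fun p => by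
      rw [abs_mul]
      exact mul_le_mul (hHM _) (hHM _) (abs_nonneg _) ((abs_nonneg _).trans (hHM (p.1, p.2.1)))
  have hP : Measurable fun p : A × B => ∫ c, H (p, c) ∂ρ :=
    (hH.stronglyMeasurable.integral_prod_right').measurable
  have hPb : ∀ p : A × B, |∫ c, H (p, c) ∂ρ| ≤ M * ρ.real Set.univ := fun p => by
    rw [← Real.norm_eq_abs]
    exact norm_integral_le_of_norm_le_const (ae_of_all _ fun c => hHM (p, c))
  rw [integral_prod _ h1]
  simp_rw [integral_const_mul]
  refine (sq_integral_mul_le (memLp_of_measurable_of_abs_le ha haK)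
    (memLp_of_measurable_of_abs_le hP hPb)).trans_eq ?_
  congr 1
  rw [← integral_prod_rotate μ ν (ρ.prod ρ)
    fun p : (A × B) × (C × C) => H (p.1, p.2.1) * H (p.1, p.2.2), integral_prod _ h2]
  refine integral_congr_ae (ae_of_all _ fun p => ?_)
  simp only
  rw [integral_prod_mul (fun c => H (p, c)) (fun c => H (p, c)), sq]

/-- The integral over `u` of the product of `g` over the vertices of the parallelogram based at `u`
with sides `h.1` and `h.2`. -/
noncomputable def parallelogramIntegral {d : ℕ} (g : (Fin d → ℝ) → ℝ)
    (h : (Fin d → ℝ) × (Fin d → ℝ)) : ℝ :=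
  ∫ u, g u * g (u + h.1) * g (u + h.2) * g (u + h.1 + h.2)

theorem measurePreserving_cube_reparam (d : ℕ) :
    MeasurePreserving (fun p : ((Fin d → ℝ) × (Fin d → ℝ)) × ((Fin d → ℝ) × (Fin d → ℝ)) =>
      (p.2.1, p.1.1, p.1.2, -p.2.1 + p.2.2)) volume volume := by
  have h1 := (MeasurePreserving.id (volume : Measure ((Fin d → ℝ) × (Fin d → ℝ)))).prod
    (measurePreserving_prod_neg_add (volume : Measure (Fin d → ℝ)) (volume : Measure (Fin d → ℝ)))
  have h2 := Measure.measurePreserving_swap (μ := (volume : Measure ((Fin d → ℝ) × (Fin d → ℝ))))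
    (ν := (volume : Measure ((Fin d → ℝ) × (Fin d → ℝ))))
  have h3 := measurePreserving_prodAssoc (volume : Measure (Fin d → ℝ))
    (volume : Measure (Fin d → ℝ)) (volume : Measure ((Fin d → ℝ) × (Fin d → ℝ)))
  have h4 := (measurePreserving_prodAssoc (volume : Measure (Fin d → ℝ))
    (volume : Measure (Fin d → ℝ)) (volume : Measure (Fin d → ℝ))).comp
    (Measure.measurePreserving_swap (μ := (volume : Measure (Fin d → ℝ)))
      (ν := (volume : Measure ((Fin d → ℝ) × (Fin d → ℝ)))))
  have h5 := (MeasurePreserving.id (volume : Measure (Fin d → ℝ))).prod h4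
  exact h5.comp (h3.comp (h2.comp h1))

@[fun_prop]
theorem measurable_u3Integrand {d : ℕ} {g : (Fin d → ℝ) → ℝ} (hg : Measurable g) :
    Measurable (u3Integrand g) := by
  unfold u3Integrand
  fun_prop

theorem integrable_and_integral_parallelogramIntegral_sq {d : ℕ} {g : (Fin d → ℝ) → ℝ}
    (hg : Measurable g) (hu : Integrable (u3Integrand g)) :
    Integrable (fun h => parallelogramIntegral g h ^ 2) ∧
      ∫ w, u3Integrand g w = ∫ h, parallelogramIntegral g h ^ 2 := by
  have hmp := measurePreserving_cube_reparam d
  have hint := hmp.integrable_comp_of_integrable hu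
  have hsec : ∀ h : (Fin d → ℝ) × (Fin d → ℝ), (∫ q : (Fin d → ℝ) × (Fin d → ℝ),
      u3Integrand g (q.1, h.1, h.2, -q.1 + q.2)) = parallelogramIntegral g h ^ 2 := by
    intro h
    rw [sq, parallelogramIntegral, ← integral_prod_mul, ← Measure.volume_eq_prod]
    refine integral_congr_ae (ae_of_all _ fun q => ?_)
    simp only [u3Integrand]
    rw [show q.1 + (-q.1 + q.2) = q.2 by abel,
      show q.1 + h.1 + (-q.1 + q.2) = q.2 + h.1 by abel,
      show q.1 + h.2 + (-q.1 + q.2) = q.2 + h.2 by abel,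
      show q.1 + h.1 + h.2 + (-q.1 + q.2) = q.2 + h.1 + h.2 by abel]
    ring
  constructor
  · simp_rw [← hsec]
    exact hint.integral_prod_left
  · simp_rw [← hsec]
    conv_lhs => rw [← hmp.map_eq]
    rw [integral_map hmp.measurable.aemeasurable
      (measurable_u3Integrand hg).aestronglyMeasurable, Measure.volume_eq_prod]
    exact integral_prod _ hint

theorem integral_u3Integrand_nonneg {d : ℕ} {g : (Fin d → ℝ) → ℝ}
    (hg : Measurable g) (hu : Integrable (u3Integrand g)) : 0 ≤ ∫ w, u3Integrand g w := by
  rw [(integrable_and_integral_parallelogramIntegral_sq hg hu).2]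
  positivity

theorem lintegral_prod_sub_le {d : ℕ} (X Y : Set (Fin d → ℝ))
    {ψ : (Fin d → ℝ) × (Fin d → ℝ) → ENNReal} (hψ : Measurable ψ) :
    ∫⁻ q : ((Fin d → ℝ) × (Fin d → ℝ)) × ((Fin d → ℝ) × (Fin d → ℝ)),
        ψ (q.1.1 - q.1.2, q.2.1 - q.2.2)
        ∂(((volume.restrict X).prod (volume.restrict X)).prod
          ((volume.restrict Y).prod (volume.restrict Y))) ≤
      volume X * volume Y * ∫⁻ h, ψ h := by
  have hY : ∀ x x' : Fin d → ℝ, (∫⁻ q : (Fin d → ℝ) × (Fin d → ℝ), ψ (x - x', q.1 - q.2)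
      ∂(volume.restrict Y).prod (volume.restrict Y)) ≤
      volume Y * ∫⁻ k, ψ (x - x', k) := by
    intro x x'
    rw [lintegral_prod _ (by fun_prop)]
    calc _ ≤ ∫⁻ y in Y, ∫⁻ k, ψ (x - x', k) := by
          refine lintegral_mono fun y => ?_
          refine (setLIntegral_le_lintegral Y _).trans_eq ?_
          exact lintegral_sub_left_eq_self (fun k => ψ (x - x', k)) y
      _ = _ := by simp [mul_comm]
  have hΨ : Measurable fun h => ∫⁻ k, ψ (h, k) := hψ.lintegral_prod_right'
  rw [lintegral_prod _ (by fun_prop)]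
  refine (lintegral_mono fun q : (Fin d → ℝ) × (Fin d → ℝ) => hY q.1 q.2).trans ?_
  rw [lintegral_const_mul _ (by fun_prop), lintegral_prod _ (by fun_prop)]
  calc _ ≤ volume Y * ∫⁻ x in X, ∫⁻ h, ∫⁻ k, ψ (h, k) := by
        refine mul_le_mul_right (lintegral_mono fun x => ?_) _
        refine (setLIntegral_le_lintegral X _).trans_eq ?_
        exact lintegral_sub_left_eq_self (fun h => ∫⁻ k, ψ (h, k)) x
    _ = _ := by
        rw [Measure.volume_eq_prod, lintegral_prod _ hψ.aemeasurable]
        simp only [lintegral_const, Measure.restrict_apply_univ]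
        ring

theorem integral_box_product_le {d : ℕ} {X Y Z : Set (Fin d → ℝ)} (hX : MeasurableSet X)
    (hY : MeasurableSet Y) (hX' : volume X ≠ ⊤) (hY' : volume Y ≠ ⊤)
    (hZ' : volume Z ≠ ⊤) {g : (Fin d → ℝ) → ℝ} (hg : Measurable g) {M : ℝ}
    (hM : ∀ s, |g s| ≤ M) (hu : Integrable (u3Integrand g))
    (hZ : ∀ x ∈ X, ∀ y ∈ Y, ∀ z, g (z - x - y) ≠ 0 → z ∈ Z) :
    ∫ q : (((Fin d → ℝ) × (Fin d → ℝ)) × ((Fin d → ℝ) × (Fin d → ℝ))) ×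
        ((Fin d → ℝ) × (Fin d → ℝ)),
      (g (q.2.1 - q.1.1.1 - q.1.2.1) * g (q.2.1 - q.1.1.2 - q.1.2.1) *
        g (q.2.1 - q.1.1.1 - q.1.2.2) * g (q.2.1 - q.1.1.2 - q.1.2.2)) *
      (g (q.2.2 - q.1.1.1 - q.1.2.1) * g (q.2.2 - q.1.1.2 - q.1.2.1) *
        g (q.2.2 - q.1.1.1 - q.1.2.2) * g (q.2.2 - q.1.1.2 - q.1.2.2))
      ∂(((volume.restrict X).prod (volume.restrict X)).prod
          ((volume.restrict Y).prod (volume.restrict Y))).prod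
        ((volume.restrict Z).prod (volume.restrict Z)) ≤
      volume.real X * volume.real Y * ∫ w, u3Integrand g w := by
  have : IsFiniteMeasure ((volume : Measure (Fin d → ℝ)).restrict X) := ⟨by simpa using hX'.lt_top⟩
  have : IsFiniteMeasure ((volume : Measure (Fin d → ℝ)).restrict Y) := ⟨by simpa using hY'.lt_top⟩
  have : IsFiniteMeasure ((volume : Measure (Fin d → ℝ)).restrict Z) := ⟨by simpa using hZ'.lt_top⟩
  obtain ⟨hA, hU⟩ := integrable_and_integral_parallelogramIntegral_sq hg hu
  have hAm : Measurable (parallelogramIntegral g) := by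
    unfold parallelogramIntegral
    refine (StronglyMeasurable.integral_prod_right' (f := fun p : ((Fin d → ℝ) × (Fin d → ℝ)) ×
      (Fin d → ℝ) => g p.2 * g (p.2 + p.1.1) * g (p.2 + p.1.2) * g (p.2 + p.1.1 + p.1.2))
      ?_).measurable
    exact Measurable.stronglyMeasurable (by fun_prop)
  have hM0 : 0 ≤ M := (abs_nonneg _).trans (hM 0)
  rw [integral_prod]
  swap
  · refine integrable_of_measurable_of_abs_le (by fun_prop) (M := (M * M * M * M) * (M * M * M * M))
      fun q => ?_
    simp only [abs_mul]
    gcongr <;> exact hM _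
  have hinner : ∀ q : ((Fin d → ℝ) × (Fin d → ℝ)) × ((Fin d → ℝ) × (Fin d → ℝ)),
      q ∈ (X ×ˢ X) ×ˢ (Y ×ˢ Y) →
      (∫ r : (Fin d → ℝ) × (Fin d → ℝ), (g (r.1 - q.1.1 - q.2.1) * g (r.1 - q.1.2 - q.2.1) *
          g (r.1 - q.1.1 - q.2.2) * g (r.1 - q.1.2 - q.2.2)) *
        (g (r.2 - q.1.1 - q.2.1) * g (r.2 - q.1.2 - q.2.1) *
          g (r.2 - q.1.1 - q.2.2) * g (r.2 - q.1.2 - q.2.2))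
        ∂(volume.restrict Z).prod (volume.restrict Z)) =
      parallelogramIntegral g (q.1.1 - q.1.2, q.2.1 - q.2.2) ^ 2 := by
    rintro ⟨⟨x, x'⟩, ⟨y, y'⟩⟩ ⟨⟨hx, hx'⟩, ⟨hy, hy'⟩⟩
    simp only at hx hx' hy hy' ⊢
    rw [integral_prod_mul (fun z => g (z - x - y) * g (z - x' - y) *
          g (z - x - y') * g (z - x' - y')) (fun z => g (z - x - y) * g (z - x' - y) *
          g (z - x - y') * g (z - x' - y')), ← sq, parallelogramIntegral,
      setIntegral_eq_integral_of_forall_compl_eq_zero]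
    · congr 1
      rw [← integral_add_right_eq_self _ (x + y)]
      congr with u
      rw [show u + (x + y) - x - y = u by abel,
        show u + (x + y) - x' - y = u + (x - x') by abel,
        show u + (x + y) - x - y' = u + (y - y') by abel,
        show u + (x + y) - x' - y' = u + (x - x') + (y - y') by abel]
    · intro z hz
      have : g (z - x - y) = 0 := by
        by_contra h
        exact hz (hZ x hx y hy z h)
      simp [this]
  have hae : ∀ᵐ q ∂(((volume : Measure (Fin d → ℝ)).restrict X).prod (volume.restrict X)).prod
      (((volume : Measure (Fin d → ℝ)).restrict Y).prod (volume.restrict Y)),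
      q ∈ (X ×ˢ X) ×ˢ (Y ×ˢ Y) := by
    simp only [Measure.prod_restrict]
    exact ae_restrict_mem ((hX.prod hX).prod (hY.prod hY))
  rw [integral_congr_ae (hae.mono hinner), hU, integral_eq_lintegral_of_nonneg_ae
    (ae_of_all _ fun q => sq_nonneg _) (Measurable.aestronglyMeasurable (by fun_prop)),
    integral_eq_lintegral_of_nonneg_ae (ae_of_all _ fun q => sq_nonneg _)
    (Measurable.aestronglyMeasurable (by fun_prop)), Measure.real, Measure.real,
    ← ENNReal.toReal_mul, ← ENNReal.toReal_mul]
  refine ENNReal.toReal_mono ?_ (lintegral_prod_sub_le X Y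
    (ψ := fun h => ENNReal.ofReal (parallelogramIntegral g h ^ 2)) (by fun_prop))
  refine ENNReal.mul_ne_top (ENNReal.mul_ne_top hX' hY') ?_
  rw [← ofReal_integral_eq_lintegral_ofReal hA (ae_of_all _ fun q => sq_nonneg _)]
  exact ENNReal.ofReal_ne_top

theorem integral_sq_le_measureReal {α : Type*} [MeasurableSpace α] {μ : Measure α}
    [IsFiniteMeasure μ] {a : α → ℝ} {S : Set α} (hS : MeasurableSet S) (ha : Measurable a)
    (ha1 : ∀ p, |a p| ≤ 1) (haS : ∀ p, p ∉ S → a p = 0) :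
    ∫ p, a p ^ 2 ∂μ ≤ μ.real S := by
  rw [← integral_indicator_one hS]
  refine integral_mono (integrable_of_measurable_of_abs_le (by fun_prop) (M := 1) fun p => ?_)
    ((integrable_const (1 : ℝ)).indicator hS) fun p => ?_
  · rw [abs_pow]
    exact pow_le_one₀ (abs_nonneg _) (ha1 p)
  · by_cases hp : p ∈ S
    · simpa [hp] using ha1 p
    · simp [hp, haS p hp]

theorem abs_mul_le_one {a b : ℝ} (ha : |a| ≤ 1) (hb : |b| ≤ 1) : |a * b| ≤ 1 := by
  rw [abs_mul]
  exact mul_le_one₀ ha (abs_nonneg b) hb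

theorem measureReal_prod_sub_mem_le {d : ℕ} {W S D : Set (Fin d → ℝ)} (hS : MeasurableSet S)
    (hD : MeasurableSet D) (hW : volume W ≠ ⊤) (hD' : volume D ≠ ⊤) :
    ((volume.restrict W).prod (volume.restrict W)).real
      {p : (Fin d → ℝ) × (Fin d → ℝ) | p.1 ∈ S ∧ p.1 - p.2 ∈ D} ≤
    volume.real (S ∩ W) * volume.real D := by
  rw [Measure.real, Measure.real, Measure.real, ← ENNReal.toReal_mul]
  refine ENNReal.toReal_mono
    (ENNReal.mul_ne_top (measure_ne_top_of_subset Set.inter_subset_right hW) hD') ?_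
  have hm : MeasurableSet {p : (Fin d → ℝ) × (Fin d → ℝ) | p.1 ∈ S ∧ p.1 - p.2 ∈ D} :=
    (measurable_fst hS).inter ((measurable_fst.sub measurable_snd) hD)
  rw [Measure.prod_apply hm]
  calc _ ≤ ∫⁻ x in W, S.indicator (fun _ => volume D) x := by
        refine lintegral_mono fun x => ?_
        by_cases hx : x ∈ S
        · have : Prod.mk x ⁻¹' {p : (Fin d → ℝ) × (Fin d → ℝ) | p.1 ∈ S ∧ p.1 - p.2 ∈ D} =
              (fun y => x - y) ⁻¹' D := by
            ext y
            simp [hx]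
          simp only [this, hx, Set.indicator_of_mem]
          refine (Measure.restrict_apply_le _ _).trans_eq ?_
          rw [(Measure.measurePreserving_sub_left volume x).measure_preimage hD.nullMeasurableSet]
        · simp [hx]
    _ = _ := by
        rw [lintegral_indicator hS, setLIntegral_const, Measure.restrict_apply hS, mul_comm]

theorem pow_eight_le_of_sq_le {t₁ t₂ t₃ t₄ a₁ a₂ a₃ m₁ m₂ m₃ u : ℝ} (ha₁ : 0 ≤ a₁) (ha₂ : 0 ≤ a₂)
    (ha₃ : 0 ≤ a₃) (h₁ : t₁ ^ 2 ≤ a₁ * t₂) (hm₁ : a₁ ≤ m₁) (h₂ : t₂ ^ 2 ≤ a₂ * t₃) (hm₂ : a₂ ≤ m₂)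
    (h₃ : t₃ ^ 2 ≤ a₃ * t₄) (hm₃ : a₃ ≤ m₃) (hu : t₄ ≤ u) (hu0 : 0 ≤ u) :
    t₁ ^ 8 ≤ m₁ ^ 4 * m₂ ^ 2 * m₃ * u :=
  calc t₁ ^ 8 = (t₁ ^ 2) ^ 4 := by ring
    _ ≤ (a₁ * t₂) ^ 4 := by gcongr
    _ = a₁ ^ 4 * (t₂ ^ 2) ^ 2 := by ring
    _ ≤ a₁ ^ 4 * (a₂ * t₃) ^ 2 := by gcongr
    _ = a₁ ^ 4 * a₂ ^ 2 * t₃ ^ 2 := by ring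
    _ ≤ a₁ ^ 4 * a₂ ^ 2 * (a₃ * t₄) := by gcongr
    _ ≤ a₁ ^ 4 * a₂ ^ 2 * (a₃ * u) := by gcongr
    _ = a₁ ^ 4 * a₂ ^ 2 * a₃ * u := by ring
    _ ≤ m₁ ^ 4 * m₂ ^ 2 * m₃ * u := by gcongr

/-- The generalized von Neumann inequality for a bounded kernel `g`, localized to sets of finite
measure: three applications of the Cauchy–Schwarz inequality remove `F₁`, `F₂` and `F₃`. -/
theorem pow_eight_integral_le {d : ℕ} {X Y Z S D : Set (Fin d → ℝ)} (hX : MeasurableSet X)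
    (hY : MeasurableSet Y) (hS : MeasurableSet S) (hD : MeasurableSet D) (hX' : volume X ≠ ⊤)
    (hY' : volume Y ≠ ⊤) (hZ' : volume Z ≠ ⊤) (hS' : volume S ≠ ⊤) (hD' : volume D ≠ ⊤)
    {F₁ F₂ F₃ : (Fin d → ℝ) × (Fin d → ℝ) → ℝ} (hF₁ : Measurable F₁) (hF₂ : Measurable F₂)
    (hF₃ : Measurable F₃) (hF₁' : ∀ p, |F₁ p| ≤ 1) (hF₂' : ∀ p, |F₂ p| ≤ 1)
    (hF₃' : ∀ p, |F₃ p| ≤ 1) (hF₂S : ∀ p, F₂ p ≠ 0 → p.2 ∈ S)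
    (hF₃S : ∀ p, F₃ p ≠ 0 → p.2 ∈ S)
    {g : (Fin d → ℝ) → ℝ} (hg : Measurable g) {M : ℝ} (hM : ∀ s, |g s| ≤ M)
    (hu : Integrable (u3Integrand g))
    (hZ : ∀ x ∈ X, ∀ y ∈ Y, ∀ z, g (z - x - y) ≠ 0 → z ∈ Z)
    (hgD : ∀ s t, g s ≠ 0 → g t ≠ 0 → s - t ∈ D) :
    (∫ p : ((Fin d → ℝ) × (Fin d → ℝ)) × (Fin d → ℝ),
        F₁ p.1 * (F₂ (p.1.2, p.2) * F₃ (p.1.1, p.2) * g (p.2 - p.1.1 - p.1.2))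
        ∂((volume.restrict X).prod (volume.restrict Y)).prod (volume.restrict Z)) ^ 8 ≤
      (volume.real X * volume.real Y) ^ 4 *
        (volume.real Y * (volume.real S * volume.real D)) ^ 2 *
        ((volume.real S * volume.real D) * (volume.real X * volume.real D)) *
        (volume.real X * volume.real Y * ∫ w, u3Integrand g w) := by
  have : IsFiniteMeasure ((volume : Measure (Fin d → ℝ)).restrict X) := ⟨by simpa using hX'.lt_top⟩
  have : IsFiniteMeasure ((volume : Measure (Fin d → ℝ)).restrict Y) := ⟨by simpa using hY'.lt_top⟩
  have : IsFiniteMeasure ((volume : Measure (Fin d → ℝ)).restrict Z) := ⟨by simpa using hZ'.lt_top⟩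
  have hM0 : 0 ≤ M := (abs_nonneg _).trans (hM 0)
  set E : Set ((Fin d → ℝ) × (Fin d → ℝ)) := {p | p.1 ∈ S ∧ p.1 - p.2 ∈ D}
  have hEm : MeasurableSet E :=
    (measurable_fst hS).inter ((measurable_fst.sub measurable_snd) hD)
  set E' : Set ((Fin d → ℝ) × (Fin d → ℝ)) := {p | p.1 ∈ Set.univ ∧ p.1 - p.2 ∈ D}
  have hEm' : MeasurableSet E' :=
    (measurable_fst MeasurableSet.univ).inter ((measurable_fst.sub measurable_snd) hD)
  have hind : ∀ (T : Set ((Fin d → ℝ) × (Fin d → ℝ))) p,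
      |T.indicator (1 : (Fin d → ℝ) × (Fin d → ℝ) → ℝ) p| ≤ 1 := fun T p => by
    by_cases hp : p ∈ T <;> simp [hp]
  have hindE : Measurable (E.indicator (1 : (Fin d → ℝ) × (Fin d → ℝ) → ℝ)) :=
    measurable_one.indicator hEm
  have hindE' : Measurable (E'.indicator (1 : (Fin d → ℝ) × (Fin d → ℝ) → ℝ)) :=
    measurable_one.indicator hEm'
  have hEle : ((volume.restrict Z).prod (volume.restrict Z)).real E ≤
      volume.real S * volume.real D := by
    refine (measureReal_prod_sub_mem_le hS hD hZ' hD').trans ?_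
    gcongr
    exact Set.inter_subset_left
  have hEle' : ((volume.restrict X).prod (volume.restrict X)).real E' ≤
      volume.real X * volume.real D := by
    exact (measureReal_prod_sub_mem_le MeasurableSet.univ hD hX' hD').trans_eq (by simp)
  -- elimination of `F₁`
  have s₁ := sq_integral_mul_le_duplicate (μ := volume.restrict X) (ν := volume.restrict Y)
    (ρ := volume.restrict Z) (a := F₁)
    (H := fun p => F₂ (p.1.2, p.2) * F₃ (p.1.1, p.2) * g (p.2 - p.1.1 - p.1.2)) (K := 1)
    (M := 1 * 1 * M) hF₁ hF₁' (by fun_prop) fun p => by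
      simp only [abs_mul]
      gcongr <;> apply_assumption
  have m₁ : ∫ p, F₁ p ^ 2 ∂(volume.restrict X).prod (volume.restrict Y) ≤
      volume.real X * volume.real Y := by
    refine (integral_sq_le_measureReal MeasurableSet.univ hF₁ hF₁' (by simp)).trans_eq ?_
    rw [← Set.univ_prod_univ, measureReal_prod_prod]
    simp
  -- elimination of `F₂`
  have s₂ := sq_integral_mul_le_duplicate (μ := volume.restrict Y)
    (ν := (volume.restrict Z).prod (volume.restrict Z)) (ρ := volume.restrict X)
    (a := fun p => F₂ (p.1, p.2.1) * F₂ (p.1, p.2.2) * E.indicator 1 p.2)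
    (H := fun p => F₃ (p.2, p.1.2.1) * F₃ (p.2, p.1.2.2) * g (p.1.2.1 - p.2 - p.1.1) *
      g (p.1.2.2 - p.2 - p.1.1)) (K := 1) (M := 1 * 1 * M * M)
    (by fun_prop) (fun p => abs_mul_le_one (abs_mul_le_one (hF₂' _) (hF₂' _)) (hind _ _))
    (by fun_prop) (fun p => by simp only [abs_mul]; gcongr <;> apply_assumption)
  have m₂ : ∫ p : (Fin d → ℝ) × ((Fin d → ℝ) × (Fin d → ℝ)),
      (F₂ (p.1, p.2.1) * F₂ (p.1, p.2.2) * E.indicator 1 p.2) ^ 2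
      ∂(volume.restrict Y).prod ((volume.restrict Z).prod (volume.restrict Z)) ≤
      volume.real Y * (volume.real S * volume.real D) := by
    refine (integral_sq_le_measureReal (S := Set.univ ×ˢ E) (MeasurableSet.univ.prod hEm)
      (by fun_prop) (fun p => ?_) (fun p hp => ?_)).trans ?_
    · exact abs_mul_le_one (abs_mul_le_one (hF₂' _) (hF₂' _)) (hind _ _)
    · have : p.2 ∉ E := fun h => hp ⟨trivial, h⟩
      simp [this]
    · rw [measureReal_prod_prod]
      simp only [measureReal_restrict_apply_univ]
      gcongr
  have e₂ : (∫ q : ((Fin d → ℝ) × ((Fin d → ℝ) × (Fin d → ℝ))) × (Fin d → ℝ),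
      (F₂ (q.1.1, q.1.2.1) * F₃ (q.2, q.1.2.1) * g (q.1.2.1 - q.2 - q.1.1)) *
        (F₂ (q.1.1, q.1.2.2) * F₃ (q.2, q.1.2.2) * g (q.1.2.2 - q.2 - q.1.1))
      ∂((volume.restrict Y).prod ((volume.restrict Z).prod (volume.restrict Z))).prod
        (volume.restrict X)) =
      ∫ p : ((Fin d → ℝ) × ((Fin d → ℝ) × (Fin d → ℝ))) × (Fin d → ℝ),
        (F₂ (p.1.1, p.1.2.1) * F₂ (p.1.1, p.1.2.2) * E.indicator 1 p.1.2) *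
        (F₃ (p.2, p.1.2.1) * F₃ (p.2, p.1.2.2) * g (p.1.2.1 - p.2 - p.1.1) *
          g (p.1.2.2 - p.2 - p.1.1))
      ∂((volume.restrict Y).prod ((volume.restrict Z).prod (volume.restrict Z))).prod
        (volume.restrict X) := by
    refine integral_congr_ae (ae_of_all _ fun q => ?_)
    simp only
    by_cases hq : q.1.2 ∈ E
    · simp only [hq, Set.indicator_of_mem, Pi.one_apply]
      ring
    · have : F₂ (q.1.1, q.1.2.1) * g (q.1.2.1 - q.2 - q.1.1) * g (q.1.2.2 - q.2 - q.1.1) = 0 := by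
        by_contra h
        simp only [mul_eq_zero, not_or] at h
        refine hq ⟨hF₂S _ h.1.1, ?_⟩
        simpa using hgD _ _ h.1.2 h.2
      simp only [hq, not_false_eq_true, Set.indicator_of_notMem]
      linear_combination F₃ (q.2, q.1.2.1) * F₂ (q.1.1, q.1.2.2) * F₃ (q.2, q.1.2.2) * this
  -- elimination of `F₃`
  have s₃ := sq_integral_mul_le_duplicate (μ := (volume.restrict Z).prod (volume.restrict Z))
    (ν := (volume.restrict X).prod (volume.restrict X)) (ρ := volume.restrict Y)
    (a := fun p => (F₃ (p.2.1, p.1.1) * F₃ (p.2.1, p.1.2)) *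
      (F₃ (p.2.2, p.1.1) * F₃ (p.2.2, p.1.2)) * (E.indicator 1 p.1 * E'.indicator 1 p.2))
    (H := fun p => g (p.1.1.1 - p.1.2.1 - p.2) * g (p.1.1.2 - p.1.2.1 - p.2) *
      g (p.1.1.1 - p.1.2.2 - p.2) * g (p.1.1.2 - p.1.2.2 - p.2)) (K := 1) (M := M * M * M * M)
    (by fun_prop) (fun p => abs_mul_le_one (abs_mul_le_one (abs_mul_le_one (hF₃' _) (hF₃' _))
      (abs_mul_le_one (hF₃' _) (hF₃' _))) (abs_mul_le_one (hind _ _) (hind _ _))) (by fun_prop)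
    (fun p => by simp only [abs_mul]; gcongr <;> apply_assumption)
  have m₃ : ∫ p : ((Fin d → ℝ) × (Fin d → ℝ)) × ((Fin d → ℝ) × (Fin d → ℝ)),
      ((F₃ (p.2.1, p.1.1) * F₃ (p.2.1, p.1.2)) *
      (F₃ (p.2.2, p.1.1) * F₃ (p.2.2, p.1.2)) * (E.indicator 1 p.1 * E'.indicator 1 p.2)) ^ 2
      ∂((volume.restrict Z).prod (volume.restrict Z)).prod
        ((volume.restrict X).prod (volume.restrict X)) ≤
      (volume.real S * volume.real D) * (volume.real X * volume.real D) := by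
    refine (integral_sq_le_measureReal (S := E ×ˢ E') (hEm.prod hEm')
      (by fun_prop) (fun p => ?_) (fun p hp => ?_)).trans ?_
    · exact abs_mul_le_one (abs_mul_le_one (abs_mul_le_one (hF₃' _) (hF₃' _))
        (abs_mul_le_one (hF₃' _) (hF₃' _))) (abs_mul_le_one (hind _ _) (hind _ _))
    · have : p.1 ∉ E ∨ p.2 ∉ E' := by
        by_contra! h
        exact hp h
      rcases this with h | h <;> simp [h]
    · rw [measureReal_prod_prod]
      gcongr
  have e₃ : (∫ q : (((Fin d → ℝ) × (Fin d → ℝ)) × ((Fin d → ℝ) × (Fin d → ℝ))) × (Fin d → ℝ),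
      (F₃ (q.1.2.1, q.1.1.1) * F₃ (q.1.2.1, q.1.1.2) * g (q.1.1.1 - q.1.2.1 - q.2) *
        g (q.1.1.2 - q.1.2.1 - q.2)) *
      (F₃ (q.1.2.2, q.1.1.1) * F₃ (q.1.2.2, q.1.1.2) * g (q.1.1.1 - q.1.2.2 - q.2) *
        g (q.1.1.2 - q.1.2.2 - q.2))
      ∂(((volume.restrict Z).prod (volume.restrict Z)).prod
        ((volume.restrict X).prod (volume.restrict X))).prod (volume.restrict Y)) =
      ∫ p : (((Fin d → ℝ) × (Fin d → ℝ)) × ((Fin d → ℝ) × (Fin d → ℝ))) × (Fin d → ℝ),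
        ((F₃ (p.1.2.1, p.1.1.1) * F₃ (p.1.2.1, p.1.1.2)) *
          (F₃ (p.1.2.2, p.1.1.1) * F₃ (p.1.2.2, p.1.1.2)) *
            (E.indicator 1 p.1.1 * E'.indicator 1 p.1.2)) *
        (g (p.1.1.1 - p.1.2.1 - p.2) * g (p.1.1.2 - p.1.2.1 - p.2) *
          g (p.1.1.1 - p.1.2.2 - p.2) * g (p.1.1.2 - p.1.2.2 - p.2))
      ∂(((volume.restrict Z).prod (volume.restrict Z)).prod
        ((volume.restrict X).prod (volume.restrict X))).prod (volume.restrict Y) := by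
    refine integral_congr_ae (ae_of_all _ fun q => ?_)
    simp only
    by_cases hq : q.1.1 ∈ E ∧ q.1.2 ∈ E'
    · simp only [hq.1, hq.2, Set.indicator_of_mem, Pi.one_apply]
      ring
    · have h0 : E.indicator (1 : (Fin d → ℝ) × (Fin d → ℝ) → ℝ) q.1.1 *
          E'.indicator (1 : (Fin d → ℝ) × (Fin d → ℝ) → ℝ) q.1.2 = 0 := by
        by_contra h
        rw [mul_eq_zero, not_or] at h
        exact hq ⟨Set.mem_of_indicator_ne_zero h.1, Set.mem_of_indicator_ne_zero h.2⟩
      have : F₃ (q.1.2.1, q.1.1.1) * g (q.1.1.1 - q.1.2.1 - q.2) *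
          g (q.1.1.2 - q.1.2.1 - q.2) * g (q.1.1.1 - q.1.2.2 - q.2) = 0 := by
        by_contra h
        simp only [mul_eq_zero, not_or] at h
        refine hq ⟨⟨hF₃S _ h.1.1.1, ?_⟩, trivial, ?_⟩
        · simpa using hgD _ _ h.1.1.2 h.1.2
        · simpa using hgD _ _ h.2 h.1.1.2
      rw [h0]
      linear_combination F₃ (q.1.2.1, q.1.1.2) * F₃ (q.1.2.2, q.1.1.1) * F₃ (q.1.2.2, q.1.1.2) *
        g (q.1.1.2 - q.1.2.2 - q.2) * this
  have s₄ := integral_box_product_le hX hY hX' hY' hZ' hg hM hu hZ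
  have e₄ : (∫ q : (((Fin d → ℝ) × (Fin d → ℝ)) × ((Fin d → ℝ) × (Fin d → ℝ))) ×
        ((Fin d → ℝ) × (Fin d → ℝ)),
      (g (q.2.1 - q.1.1.1 - q.1.2.1) * g (q.2.2 - q.1.1.1 - q.1.2.1) *
        g (q.2.1 - q.1.1.2 - q.1.2.1) * g (q.2.2 - q.1.1.2 - q.1.2.1)) *
      (g (q.2.1 - q.1.1.1 - q.1.2.2) * g (q.2.2 - q.1.1.1 - q.1.2.2) *
        g (q.2.1 - q.1.1.2 - q.1.2.2) * g (q.2.2 - q.1.1.2 - q.1.2.2))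
      ∂(((volume.restrict X).prod (volume.restrict X)).prod
          ((volume.restrict Y).prod (volume.restrict Y))).prod
        ((volume.restrict Z).prod (volume.restrict Z))) ≤
      volume.real X * volume.real Y * ∫ w, u3Integrand g w := by
    refine le_of_eq_of_le (integral_congr_ae (ae_of_all _ fun q => ?_)) s₄
    simp only
    ring
  have hU := integral_u3Integrand_nonneg hg hu
  simp only at s₁ s₂ s₃
  rw [e₂] at s₁
  rw [e₃] at s₂
  exact pow_eight_le_of_sq_le (integral_nonneg fun _ => sq_nonneg _)
    (integral_nonneg fun _ => sq_nonneg _) (integral_nonneg fun _ => sq_nonneg _)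
    s₁ m₁ s₂ m₂ s₃ m₃ e₄ (by positivity)

theorem volume_real_Icc_const {d : ℕ} {a b : ℝ} (h : a ≤ b) :
    volume.real (Set.Icc (fun _ : Fin d => a) (fun _ => b)) = (b - a) ^ d := by
  rw [Measure.real, Real.volume_Icc_pi]
  simp [ENNReal.toReal_ofReal (sub_nonneg.2 h)]

theorem volume_Icc_ne_top {d : ℕ} (a b : Fin d → ℝ) : volume (Set.Icc a b) ≠ ⊤ :=
  isCompact_Icc.measure_lt_top.ne

/-- The trilinear corner form with kernel `g`, in the variables `((x, y), s)`. -/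
noncomputable def cornerIntegrand {d : ℕ} (f : (Fin d → ℝ) × (Fin d → ℝ) → ℝ)
    (g : (Fin d → ℝ) → ℝ) (p : ((Fin d → ℝ) × (Fin d → ℝ)) × (Fin d → ℝ)) : ℝ :=
  f (p.1.1, p.1.2) * f (p.1.1 + p.2, p.1.2) * f (p.1.1, p.1.2 + p.2) * g p.2

theorem measurable_cornerIntegrand {d : ℕ} {f : (Fin d → ℝ) × (Fin d → ℝ) → ℝ}
    {g : (Fin d → ℝ) → ℝ} (hf : Measurable f) (hg : Measurable g) :
    Measurable (cornerIntegrand f g) := by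
  unfold cornerIntegrand
  fun_prop

theorem measurePreserving_corner_shear (d : ℕ) :
    MeasurePreserving (fun p : ((Fin d → ℝ) × (Fin d → ℝ)) × (Fin d → ℝ) =>
      (p.1, p.2 - p.1.1 - p.1.2)) volume volume := by
  refine (MeasurePreserving.id (volume : Measure ((Fin d → ℝ) × (Fin d → ℝ)))).skew_product
    (g := fun q z => z - q.1 - q.2) (by fun_prop) (ae_of_all _ fun q => ?_)
  exact ((measurePreserving_sub_right volume q.2).comp
    (measurePreserving_sub_right volume q.1)).map_eq

theorem pow_eight_integral_cornerIntegrand_le {d : ℕ} {L N : ℝ} (hL : 0 ≤ L) (hN : 0 ≤ N)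
    {f : (Fin d → ℝ) × (Fin d → ℝ) → ℝ} (hf : Measurable f) (hf1 : ∀ z, |f z| ≤ 1)
    (hfs : ∀ z, f z ≠ 0 → z ∈ Set.Icc (fun _ : Fin d => (0 : ℝ)) (fun _ => N) ×ˢ
      Set.Icc (fun _ : Fin d => (0 : ℝ)) (fun _ => N))
    {g : (Fin d → ℝ) → ℝ} (hg : Measurable g) {M : ℝ} (hM : ∀ s, |g s| ≤ M)
    (hgs : ∀ s, g s ≠ 0 → s ∈ Set.Icc (fun _ : Fin d => -L) (fun _ => L))
    (hu : Integrable (u3Integrand g)) :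
    (∫ p, cornerIntegrand f g p) ^ 8 ≤
      2048 ^ d * N ^ (16 * d) * L ^ (4 * d) * ∫ w, u3Integrand g w := by
  have hmp := measurePreserving_corner_shear d
  have key := pow_eight_integral_le (X := Set.Icc (fun _ : Fin d => (0 : ℝ)) (fun _ => N))
    (Y := Set.Icc (fun _ : Fin d => (0 : ℝ)) (fun _ => N))
    (Z := Set.Icc (fun _ : Fin d => -L) (fun _ => 2 * N + L))
    (S := Set.Icc (fun _ : Fin d => (0 : ℝ)) (fun _ => 2 * N))
    (D := Set.Icc (fun _ : Fin d => -(2 * L)) (fun _ => 2 * L))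
    measurableSet_Icc measurableSet_Icc measurableSet_Icc measurableSet_Icc
    (volume_Icc_ne_top _ _) (volume_Icc_ne_top _ _) (volume_Icc_ne_top _ _)
    (volume_Icc_ne_top _ _) (volume_Icc_ne_top _ _)
    (F₁ := f) (F₂ := fun p => f (p.2 - p.1, p.1)) (F₃ := fun p => f (p.1, p.2 - p.1))
    hf (by fun_prop) (by fun_prop) hf1 (fun _ => hf1 _) (fun _ => hf1 _)
    (fun p hp => by
      obtain ⟨⟨h1, h2⟩, h3, h4⟩ := hfs _ hp
      refine ⟨fun i => ?_, fun i => ?_⟩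
      · have := h1 i; have := h3 i; simp only [Pi.sub_apply] at *; linarith
      · have := h2 i; have := h4 i; simp only [Pi.sub_apply] at *; linarith)
    (fun p hp => by
      obtain ⟨⟨h1, h2⟩, h3, h4⟩ := hfs _ hp
      refine ⟨fun i => ?_, fun i => ?_⟩
      · have := h1 i; have := h3 i; simp only [Pi.sub_apply] at *; linarith
      · have := h2 i; have := h4 i; simp only [Pi.sub_apply] at *; linarith)
    hg hM hu
    (fun x hx y hy z h => by
      obtain ⟨h1, h2⟩ := hgs _ h
      refine ⟨fun i => ?_, fun i => ?_⟩
      · have := h1 i; have := hx.1 i; have := hy.1 i; simp only [Pi.sub_apply] at *; linarith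
      · have := h2 i; have := hx.2 i; have := hy.2 i; simp only [Pi.sub_apply] at *; linarith)
    (fun s t hs ht => by
      obtain ⟨h1, h2⟩ := hgs _ hs
      obtain ⟨h3, h4⟩ := hgs _ ht
      refine ⟨fun i => ?_, fun i => ?_⟩
      · have := h1 i; have := h4 i; simp only [Pi.sub_apply] at *; linarith
      · have := h2 i; have := h3 i; simp only [Pi.sub_apply] at *; linarith)
  have hlhs : ∫ p, cornerIntegrand f g p = ∫ p : ((Fin d → ℝ) × (Fin d → ℝ)) × (Fin d → ℝ),
      f p.1 * (f (p.2 - p.1.2, p.1.2) * f (p.1.1, p.2 - p.1.1) * g (p.2 - p.1.1 - p.1.2))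
      ∂((volume.restrict (Set.Icc (fun _ : Fin d => (0 : ℝ)) (fun _ => N))).prod
        (volume.restrict (Set.Icc (fun _ : Fin d => (0 : ℝ)) (fun _ => N)))).prod
        (volume.restrict (Set.Icc (fun _ : Fin d => -L) (fun _ => 2 * N + L))) := by
    rw [Measure.prod_restrict, Measure.prod_restrict,
      setIntegral_eq_integral_of_forall_compl_eq_zero]
    · conv_lhs => rw [← hmp.map_eq]
      rw [integral_map hmp.measurable.aemeasurable
        (measurable_cornerIntegrand hf hg).aestronglyMeasurable]
      refine integral_congr_ae (ae_of_all _ fun p => ?_)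
      simp only [cornerIntegrand]
      rw [show p.1.1 + (p.2 - p.1.1 - p.1.2) = p.2 - p.1.2 by abel,
        show p.1.2 + (p.2 - p.1.1 - p.1.2) = p.2 - p.1.1 by abel]
      ring
    · intro p hp
      by_contra h
      simp only [mul_eq_zero, not_or] at h
      obtain ⟨hx, hy⟩ := hfs _ h.1
      obtain ⟨h1, h2⟩ := hgs _ h.2.2
      refine hp ⟨⟨hx, hy⟩, fun i => ?_, fun i => ?_⟩
      · have := h1 i; have := hx.1 i; have := hy.1 i; simp only [Pi.sub_apply] at *; linarith
      · have := h2 i; have := hx.2 i; have := hy.2 i; simp only [Pi.sub_apply] at *; linarith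
  rw [hlhs]
  refine key.trans_eq ?_
  rw [volume_real_Icc_const hN, volume_real_Icc_const (by linarith : (0 : ℝ) ≤ 2 * N),
    volume_real_Icc_const (by linarith : -(2 * L) ≤ 2 * L), sub_zero, sub_zero,
    show 2 * L - -(2 * L) = 4 * L by ring, mul_pow, mul_pow,
    show (2048 : ℝ) ^ d = (2 ^ d) ^ 3 * (4 ^ d) ^ 4 by
      rw [← pow_mul, ← pow_mul, mul_comm d, mul_comm d, pow_mul, pow_mul, ← mul_pow]; norm_num,
    show 16 * d = d * 16 by ring, show 4 * d = d * 4 by ring, pow_mul, pow_mul]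
  ring

/-- The function `g` with its values of absolute value greater than `n` replaced by `0`. -/
noncomputable def levelTruncation {α : Type*} (g : α → ℝ) (n : ℕ) (s : α) : ℝ :=
  if |g s| ≤ n then g s else 0

theorem measurable_levelTruncation {α : Type*} [MeasurableSpace α] {g : α → ℝ} (hg : Measurable g)
    (n : ℕ) : Measurable (levelTruncation g n) :=
  Measurable.ite (measurableSet_le hg.abs measurable_const) hg measurable_const

theorem abs_levelTruncation_le {α : Type*} (g : α → ℝ) (n : ℕ) (s : α) :
    |levelTruncation g n s| ≤ n := by
  unfold levelTruncation
  split_ifs with h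
  · exact h
  · simp

theorem abs_levelTruncation_le_abs {α : Type*} (g : α → ℝ) (n : ℕ) (s : α) :
    |levelTruncation g n s| ≤ |g s| := by
  unfold levelTruncation
  split_ifs <;> simp

theorem tendsto_levelTruncation {α : Type*} (g : α → ℝ) (s : α) :
    Filter.Tendsto (fun n => levelTruncation g n s) Filter.atTop (nhds (g s)) := by
  refine tendsto_const_nhds.congr' ?_
  obtain ⟨k, hk⟩ := exists_nat_ge |g s|
  filter_upwards [Filter.eventually_ge_atTop k] with n hn
  rw [levelTruncation, if_pos (hk.trans (by exact_mod_cast hn))]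

theorem abs_u3Integrand_le {d : ℕ} {g k : (Fin d → ℝ) → ℝ} (h : ∀ s, |k s| ≤ |g s|)
    (w : (Fin d → ℝ) × (Fin d → ℝ) × (Fin d → ℝ) × (Fin d → ℝ)) :
    |u3Integrand k w| ≤ |u3Integrand g w| := by
  simp only [u3Integrand, abs_mul]
  gcongr ?_ * ?_ * ?_ * ?_ * ?_ * ?_ * ?_ * ?_ <;> exact h _

theorem integrable_u3Integrand_of_abs_le {d : ℕ} {g k : (Fin d → ℝ) → ℝ} (hk : Measurable k)
    (h : ∀ s, |k s| ≤ |g s|) (hu : Integrable (u3Integrand g)) : Integrable (u3Integrand k) :=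
  hu.mono (measurable_u3Integrand hk).aestronglyMeasurable (ae_of_all _ (abs_u3Integrand_le h))

/-- A function of bounded support with finite `U³` norm is integrable. -/
theorem integrable_of_integrable_u3Integrand {d : ℕ} {L : ℝ}
    {g : (Fin d → ℝ) → ℝ} (hg : Measurable g)
    (hgs : ∀ s, g s ≠ 0 → s ∈ Set.Icc (fun _ : Fin d => -L) (fun _ => L))
    (hu : Integrable (u3Integrand g)) : Integrable g := by
  set X : Set (Fin d → ℝ) := Set.Icc (fun _ => 0) (fun _ => 1) with hX
  set Z : Set (Fin d → ℝ) := Set.Icc (fun _ => -L) (fun _ => 2 + L)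
  set D : Set (Fin d → ℝ) := Set.Icc (fun _ => -(2 * L)) (fun _ => 2 * L)
  have hX1 : volume.real X = 1 := by simp [hX, volume_real_Icc_const]
  have hXY : ∀ k : (Fin d → ℝ) → ℝ, (∀ s, k s ≠ 0 → g s ≠ 0) →
      ∀ x ∈ X, ∀ y ∈ X, ∀ z, k (z - x - y) ≠ 0 → z ∈ Z := by
    intro k hk x hx y hy z h
    obtain ⟨h1, h2⟩ := hgs _ (hk _ h)
    refine ⟨fun i => ?_, fun i => ?_⟩
    · have := h1 i; have := hx.1 i; have := hy.1 i; simp only [Pi.sub_apply] at *; linarith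
    · have := h2 i; have := hx.2 i; have := hy.2 i; simp only [Pi.sub_apply] at *; linarith
  obtain ⟨R, hR⟩ : ∃ R : ℝ, ∀ n, ∫ s, |levelTruncation g n s| ≤ R := by
    set K : ℝ := (volume.real X * volume.real X) ^ 4 *
        (volume.real X * (volume.real Z * volume.real D)) ^ 2 *
        ((volume.real Z * volume.real D) * (volume.real X * volume.real D)) *
        (volume.real X * volume.real X * ∫ w, |u3Integrand g w|) with hK
    refine ⟨max 1 K, fun n => ?_⟩
    set k : (Fin d → ℝ) → ℝ := fun s => |levelTruncation g n s| with hk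
    have hkm : Measurable k := (measurable_levelTruncation hg n).abs
    have hkg : ∀ s, |k s| ≤ |g s| := fun s => by
      simpa [hk] using abs_levelTruncation_le_abs g n s
    have hk0 : ∀ s, k s ≠ 0 → g s ≠ 0 := fun s h h' => h (by simpa [h'] using hkg s)
    have hku := integrable_u3Integrand_of_abs_le hkm hkg hu
    have hind : ∀ z, |Z.indicator (1 : (Fin d → ℝ) → ℝ) z| ≤ 1 := fun z => by
      by_cases hz : z ∈ Z <;> simp [hz]
    have hindm : Measurable (Z.indicator (1 : (Fin d → ℝ) → ℝ)) :=
      measurable_one.indicator measurableSet_Icc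
    have key := pow_eight_integral_le (X := X) (Y := X) (Z := Z) (S := Z) (D := D)
      measurableSet_Icc measurableSet_Icc measurableSet_Icc measurableSet_Icc
      (volume_Icc_ne_top _ _) (volume_Icc_ne_top _ _) (volume_Icc_ne_top _ _)
      (volume_Icc_ne_top _ _) (volume_Icc_ne_top _ _)
      (F₁ := 1) (F₂ := fun p => Z.indicator 1 p.2) (F₃ := fun p => Z.indicator 1 p.2)
      measurable_one (by fun_prop) (by fun_prop) (by simp) (fun _ => hind _) (fun _ => hind _)
      (fun p => Set.mem_of_indicator_ne_zero) (fun p => Set.mem_of_indicator_ne_zero)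
      hkm (M := n) (fun s => by simpa [hk] using abs_levelTruncation_le g n s) hku
      (hXY k hk0)
      (fun s t hs ht => by
        obtain ⟨h1, h2⟩ := hgs _ (hk0 _ hs)
        obtain ⟨h3, h4⟩ := hgs _ (hk0 _ ht)
        refine ⟨fun i => ?_, fun i => ?_⟩
        · have := h1 i; have := h4 i; simp only [Pi.sub_apply] at *; linarith
        · have := h2 i; have := h3 i; simp only [Pi.sub_apply] at *; linarith)
    have hlhs : (∫ p : ((Fin d → ℝ) × (Fin d → ℝ)) × (Fin d → ℝ),
        (1 : (Fin d → ℝ) × (Fin d → ℝ) → ℝ) p.1 *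
          (Z.indicator 1 p.2 * Z.indicator 1 p.2 * k (p.2 - p.1.1 - p.1.2))
        ∂((volume.restrict X).prod (volume.restrict X)).prod (volume.restrict Z)) =
        ∫ s, k s := by
      have : IsFiniteMeasure ((volume : Measure (Fin d → ℝ)).restrict X) :=
        ⟨by simpa using (volume_Icc_ne_top _ _).lt_top⟩
      have : IsFiniteMeasure ((volume : Measure (Fin d → ℝ)).restrict Z) :=
        ⟨by simpa using (volume_Icc_ne_top _ _).lt_top⟩
      rw [integral_prod]
      swap
      · refine integrable_of_measurable_of_abs_le (M := 1 * (1 * 1 * n))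
          (measurable_one.comp measurable_fst |>.mul (by fun_prop)) fun p => ?_
        simp only [abs_mul]
        gcongr
        · simp
        · exact hind _
        · exact hind _
        · simpa [hk] using abs_levelTruncation_le g n _
      have hinner : ∀ q ∈ X ×ˢ X, (∫ z in Z, (1 : (Fin d → ℝ) × (Fin d → ℝ) → ℝ) q *
          (Z.indicator 1 z * Z.indicator 1 z * k (z - q.1 - q.2))) = ∫ s, k s := by
        intro q hq
        rw [setIntegral_eq_integral_of_forall_compl_eq_zero (fun z hz => by simp [hz])]
        rw [← integral_sub_right_eq_self k (q.1 + q.2)]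
        congr with z
        rw [← sub_sub]
        by_cases hz : z ∈ Z
        · simp [hz]
        · have : k (z - q.1 - q.2) = 0 := by
            by_contra h
            exact hz (hXY k hk0 _ hq.1 _ hq.2 _ h)
          simp [hz, this]
      have hae : ∀ᵐ q ∂((volume : Measure (Fin d → ℝ)).restrict X).prod (volume.restrict X),
          q ∈ X ×ˢ X := by
        rw [Measure.prod_restrict]
        exact ae_restrict_mem (measurableSet_Icc.prod measurableSet_Icc)
      rw [integral_congr_ae (hae.mono hinner), integral_const, ← Set.univ_prod_univ,
        measureReal_prod_prod]
      simp [hX1]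
    rw [hlhs] at key
    have hle : (∫ s, k s) ^ 8 ≤ K := by
      refine key.trans ?_
      rw [hK]
      gcongr ?_ * (?_ * ?_)
      exact integral_mono hku hu.abs fun w => (le_abs_self _).trans (abs_u3Integrand_le hkg w)
    rcases le_total (∫ s, k s) 1 with h | h
    · exact h.trans (le_max_left _ _)
    · exact ((le_self_pow₀ h (by norm_num)).trans hle).trans (le_max_right _ _)
  have hti : ∀ n, Integrable (levelTruncation g n) := fun n => by
    refine (IntegrableOn.of_bound (s := Set.Icc (fun _ : Fin d => -L) (fun _ => L))
      (volume_Icc_ne_top _ _).lt_top (measurable_levelTruncation hg n).aestronglyMeasurable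
      n (ae_of_all _ (abs_levelTruncation_le g n))).integrable_of_forall_notMem_eq_zero
      fun s hs => ?_
    have : g s = 0 := by
      by_contra h
      exact hs (hgs s h)
    simp [levelTruncation, this]
  refine ⟨hg.aestronglyMeasurable, ?_⟩
  have hlim : ∫⁻ s, ‖g s‖ₑ ≤ ENNReal.ofReal R := by
    rw [← lintegral_congr fun s => (tendsto_levelTruncation g s).enorm.liminf_eq]
    refine (lintegral_liminf_le fun n => (measurable_levelTruncation hg n).enorm).trans ?_
    refine Filter.liminf_le_of_le (by isBoundedDefault) fun b hb => ?_
    obtain ⟨n, hn⟩ := hb.exists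
    refine hn.trans ?_
    rw [← ofReal_integral_norm_eq_lintegral_enorm (hti n)]
    exact ENNReal.ofReal_le_ofReal (hR n)
  exact hlim.trans_lt ENNReal.ofReal_lt_top

theorem abs_cornerIntegrand_le {d : ℕ} {f : (Fin d → ℝ) × (Fin d → ℝ) → ℝ}
    (hf1 : ∀ z, |f z| ≤ 1) {T : Set ((Fin d → ℝ) × (Fin d → ℝ))} (hfs : ∀ z, f z ≠ 0 → z ∈ T)
    {g k : (Fin d → ℝ) → ℝ} (h : ∀ s, |k s| ≤ |g s|)
    (p : ((Fin d → ℝ) × (Fin d → ℝ)) × (Fin d → ℝ)) :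
    |cornerIntegrand f k p| ≤ T.indicator 1 p.1 * |g p.2| := by
  by_cases hp : p.1 ∈ T
  · rw [cornerIntegrand, abs_mul, Set.indicator_of_mem hp, Pi.one_apply]
    gcongr ?_ * ?_
    · exact abs_mul_le_one (abs_mul_le_one (hf1 _) (hf1 _)) (hf1 _)
    · exact h _
  · have : f (p.1.1, p.1.2) = 0 := by
      by_contra h'
      exact hp (hfs _ h')
    simp [cornerIntegrand, this, hp]

theorem generalized_von_neumann_corners (d : ℕ) (hd : 1 ≤ d) (c₀ : ℝ) (hc₀ : 0 < c₀) :
    ∃ C : ℝ, ∀ lam N : ℝ, 0 < lam → 0 < N →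
      ∀ f : (Fin d → ℝ) × (Fin d → ℝ) → ℝ, Measurable f →
        (∀ z, f z ∈ Set.Icc (-1 : ℝ) 1) →
        (∀ z, f z ≠ 0 →
          z ∈ Set.Icc (0 : Fin d → ℝ) (fun _ => N) ×ˢ Set.Icc (0 : Fin d → ℝ) (fun _ => N)) →
        ∀ g : (Fin d → ℝ) → ℝ, Measurable g →
          (∀ s, g s ≠ 0 → s ∈ Set.Icc (fun _ => -(c₀ * lam)) (fun _ => c₀ * lam)) →
          Integrable (u3Integrand g) volume →
          |∫ x : Fin d → ℝ, ∫ y : Fin d → ℝ, ∫ s : Fin d → ℝ,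
              f (x, y) * f (x + s, y) * f (x, y + s) * g s| ≤
            C * N ^ (2 * d) * lam ^ ((d : ℝ) / 2) * u3Norm g := by
  refine ⟨(2048 ^ d * c₀ ^ (4 * d)) ^ ((1 : ℝ) / 8), ?_⟩
  intro lam N hlam hN f hf hf1 hfs g hg hgs hu
  have hL : 0 ≤ c₀ * lam := by positivity
  replace hf1 : ∀ z, |f z| ≤ 1 := fun z => abs_le.2 (hf1 z)
  have hgi := integrable_of_integrable_u3Integrand hg hgs hu
  set T : Set ((Fin d → ℝ) × (Fin d → ℝ)) :=
    Set.Icc (0 : Fin d → ℝ) (fun _ => N) ×ˢ Set.Icc (0 : Fin d → ℝ) (fun _ => N)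
  have hTm : MeasurableSet T := measurableSet_Icc.prod measurableSet_Icc
  have hTv : volume T ≠ ⊤ := (isCompact_Icc.prod isCompact_Icc).measure_lt_top.ne
  have hdom : Integrable (fun p : ((Fin d → ℝ) × (Fin d → ℝ)) × (Fin d → ℝ) =>
      T.indicator (1 : (Fin d → ℝ) × (Fin d → ℝ) → ℝ) p.1 * |g p.2|) :=
    Integrable.mul_prod ((integrable_indicator_iff hTm).2 (integrableOn_const hTv)) hgi.abs
  have hci : Integrable (cornerIntegrand f g) :=
    hdom.mono' (measurable_cornerIntegrand hf hg).aestronglyMeasurable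
      (ae_of_all _ (abs_cornerIntegrand_le hf1 hfs fun _ => le_rfl))
  have hiter : (∫ x : Fin d → ℝ, ∫ y : Fin d → ℝ, ∫ s : Fin d → ℝ,
      f (x, y) * f (x + s, y) * f (x, y + s) * g s) = ∫ p, cornerIntegrand f g p := by
    rw [Measure.volume_eq_prod, integral_prod _ hci, Measure.volume_eq_prod,
      integral_prod _ hci.integral_prod_left]
    rfl
  rw [hiter]
  have htr : ∀ n s, |levelTruncation g n s| ≤ |g s| := abs_levelTruncation_le_abs g
  have hbound : ∀ n, (∫ p, cornerIntegrand f (levelTruncation g n) p) ^ 8 ≤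
      2048 ^ d * N ^ (16 * d) * (c₀ * lam) ^ (4 * d) *
        ∫ w, u3Integrand (levelTruncation g n) w := fun n =>
    pow_eight_integral_cornerIntegrand_le hL hN.le hf hf1 hfs (measurable_levelTruncation hg n)
      (abs_levelTruncation_le g n)
      (fun s hs => hgs s fun h => hs (by simpa [h] using htr n s))
      (integrable_u3Integrand_of_abs_le (measurable_levelTruncation hg n) (htr n) hu)
  have hlim₁ : Filter.Tendsto (fun n => ∫ p, cornerIntegrand f (levelTruncation g n) p)
      Filter.atTop (nhds (∫ p, cornerIntegrand f g p)) :=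
    tendsto_integral_of_dominated_convergence _
      (fun n => (measurable_cornerIntegrand hf
        (measurable_levelTruncation hg n)).aestronglyMeasurable) hdom
      (fun n => ae_of_all _ (abs_cornerIntegrand_le hf1 hfs (htr n)))
      (ae_of_all _ fun p => (tendsto_levelTruncation g p.2).const_mul _)
  have hlim₂ : Filter.Tendsto (fun n => ∫ w, u3Integrand (levelTruncation g n) w)
      Filter.atTop (nhds (∫ w, u3Integrand g w)) := by
    refine tendsto_integral_of_dominated_convergence _
      (fun n => (measurable_u3Integrand (measurable_levelTruncation hg n)).aestronglyMeasurable)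
      hu.abs (fun n => ae_of_all _ (abs_u3Integrand_le (htr n))) (ae_of_all _ fun w => ?_)
    have := tendsto_levelTruncation g
    exact (((((((this _).mul (this _)).mul (this _)).mul (this _)).mul (this _)).mul
      (this _)).mul (this _)).mul (this _)
  have hmain := le_of_tendsto_of_tendsto' (hlim₁.pow 8) (hlim₂.const_mul _) hbound
  have hU := integral_u3Integrand_nonneg hg hu
  have hroot : ∀ x : ℝ, 0 ≤ x → (x ^ ((1 : ℝ) / 8)) ^ 8 = x := fun x hx => by
    rw [← Real.rpow_natCast, ← Real.rpow_mul hx]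
    norm_num
  have hlampow : (lam ^ ((d : ℝ) / 2)) ^ 8 = lam ^ (4 * d) := by
    rw [← Real.rpow_natCast, ← Real.rpow_mul hlam.le, ← Real.rpow_natCast]
    congr 1
    push_cast
    ring
  refine (pow_le_pow_iff_left₀ (abs_nonneg _) ?_ (by norm_num : (8 : ℕ) ≠ 0)).1 ?_
  · unfold u3Norm
    positivity
  · rw [← abs_pow, abs_of_nonneg (by positivity)]
    refine hmain.trans_eq ?_
    rw [mul_pow c₀, mul_pow, mul_pow, mul_pow, u3Norm, hroot _ hU, hroot _ (by positivity), hlampow]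
    ring
end

section
/- Let 1 < p < ∞, let 0 < ε < 1, and let d, J ≥ 1 be integers. Suppose λ_1 < λ_2 < ⋯ < λ_J are positive reals with λ_{j+1}/λ_j ≥ 2 for each 1 ≤ j ≤ J−1. There exists a constant C, depending only on p, d, ε and ψ (but not on J, N, the scales λ_j, or f), such that for every N > 0 and every measurable function f : ℝ^d × ℝ^d → [−1,1] supported in [0,N]^d × [0,N]^d one has ∑_{j=1}^J |E_{λ_j}^ε(f)|² ≤ C N^{4d}. -/
open MeasureTheory

/-- The Fourier transform `ψ̂(ξ) = ∫ ψ(x) e^{-2πi xξ} dx` of a function on `ℝ`. -/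
noncomputable def psiHat (ψ : ℝ → ℝ) : ℝ → ℂ :=
  fun ξ => ∫ x : ℝ, Complex.exp (-2 * Real.pi * Complex.I * (x * ξ)) * (ψ x : ℂ)

/-- The approximant `ω_λ^ε(s) = λ^{-d} ε^{-1} ψ̂(ε^{-1}(1 - ‖λ^{-1}s‖_{ℓ^p}^p))`. -/
noncomputable def omegaFn (ψ : ℝ → ℝ) (p : ℝ) (d : ℕ) (lam ε : ℝ) (s : Fin d → ℝ) : ℝ :=
  (lam ^ d)⁻¹ * ε⁻¹ * (psiHat ψ (ε⁻¹ * (1 - ∑ i, |lam⁻¹ * s i| ^ p))).re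

/-- The counting form `M_λ^ε(f)` for corners with side distribution `ω_λ^ε`. -/
noncomputable def Mform (ψ : ℝ → ℝ) (p : ℝ) (d : ℕ) (lam ε : ℝ)
    (f : (Fin d → ℝ) × (Fin d → ℝ) → ℝ) : ℝ :=
  ∫ x : Fin d → ℝ, ∫ y : Fin d → ℝ, ∫ s : Fin d → ℝ,
    f (x, y) * f (x + s, y) * f (x, y + s) * omegaFn ψ p d lam ε s

/-- The normalizing constant `c₁(ε) = (∫ ω_λ^ε)/(∫ ω_λ^1)`, which is independent of `λ`
(so we take `λ = 1`). -/
noncomputable def c1 (ψ : ℝ → ℝ) (p : ℝ) (d : ℕ) (ε : ℝ) : ℝ :=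
  (∫ s : Fin d → ℝ, omegaFn ψ p d 1 ε s) / (∫ s : Fin d → ℝ, omegaFn ψ p d 1 1 s)

/-- The error form `E_λ^ε(f) = M_λ^ε(f) - c₁(ε) M_λ^1(f)`. -/
noncomputable def Eform (ψ : ℝ → ℝ) (p : ℝ) (d : ℕ) (lam ε : ℝ)
    (f : (Fin d → ℝ) × (Fin d → ℝ) → ℝ) : ℝ :=
  Mform ψ p d lam ε f - c1 ψ p d ε * Mform ψ p d lam 1 f

section Gaussian

variable {d : ℕ}

/-- The Gaussian probability density `v^{-d/2} exp(-π |x|² / v)` on `ℝ^d`. -/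
noncomputable def gau (v : ℝ) (x : Fin d → ℝ) : ℝ :=
  ∏ i, ((√v)⁻¹ * Real.exp (-(Real.pi / v) * x i ^ 2))

lemma gau_eq (v : ℝ) (x : Fin d → ℝ) :
    gau v x = ((√v)⁻¹) ^ d * Real.exp (-(Real.pi / v) * ∑ i, x i ^ 2) := by
  unfold gau
  rw [Finset.prod_mul_distrib, ← Real.exp_sum, Finset.mul_sum]
  simp

lemma gau_nonneg (v : ℝ) (x : Fin d → ℝ) : 0 ≤ gau v x :=
  Finset.prod_nonneg fun _ _ => by positivity

lemma gau_pos {v : ℝ} (hv : 0 < v) (x : Fin d → ℝ) : 0 < gau v x :=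
  Finset.prod_pos fun _ _ => by positivity

lemma gau_le {v : ℝ} (hv : 0 < v) (x : Fin d → ℝ) : gau v x ≤ ((√v)⁻¹) ^ d := by
  rw [gau_eq]
  apply mul_le_of_le_one_right (by positivity)
  rw [Real.exp_le_one_iff, neg_mul, neg_nonpos]
  exact mul_nonneg (by positivity) (Finset.sum_nonneg fun _ _ => sq_nonneg _)

lemma continuous_gau (v : ℝ) : Continuous (gau v : (Fin d → ℝ) → ℝ) := by
  unfold gau
  fun_prop

@[fun_prop]
lemma measurable_gau (v : ℝ) : Measurable (gau v : (Fin d → ℝ) → ℝ) :=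
  (continuous_gau v).measurable

lemma gau_neg (v : ℝ) (x : Fin d → ℝ) : gau v (-x) = gau v x := by
  simp [gau]

lemma gau_sub_comm (v : ℝ) (x y : Fin d → ℝ) : gau v (x - y) = gau v (y - x) := by
  rw [← gau_neg, neg_sub]

lemma integrable_gau {v : ℝ} (hv : 0 < v) : Integrable (gau v : (Fin d → ℝ) → ℝ) := by
  unfold gau
  have h1 : Integrable fun t : ℝ => (√v)⁻¹ * Real.exp (-(Real.pi / v) * t ^ 2) :=
    (integrable_exp_neg_mul_sq (by positivity)).const_mul _
  exact Integrable.fintype_prod (fun _ : Fin d => h1)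

lemma integral_gau {v : ℝ} (hv : 0 < v) : ∫ x : Fin d → ℝ, gau v x = 1 := by
  unfold gau
  have := integral_fintype_prod_volume_eq_prod (ι := Fin d) (E := fun _ => ℝ) 
    (fun _ (t : ℝ) => (√v)⁻¹ * Real.exp (-(Real.pi / v) * t ^ 2))
  rw [this]
  apply Finset.prod_eq_one
  intro i _
  rw [integral_const_mul, integral_gaussian]
  have h : Real.pi / (Real.pi / v) = v := by field_simp
  rw [h]
  have : √v ≠ 0 := by positivity
  field_simp

lemma gau_sub_mul_gau {a b : ℝ} (ha : 0 < a) (hb : 0 < b) (x q : Fin d → ℝ) :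
    gau a (x - q) * gau b q =
      gau (a + b) x * gau (a * b / (a + b)) (q - (b / (a + b)) • x) := by
  unfold gau
  rw [← Finset.prod_mul_distrib, ← Finset.prod_mul_distrib]
  refine Finset.prod_congr rfl fun i _ => ?_
  have h1 : (√a)⁻¹ * (√b)⁻¹ = (√(a + b))⁻¹ * (√(a * b / (a + b)))⁻¹ := by
    rw [← mul_inv, ← mul_inv, ← Real.sqrt_mul ha.le, ← Real.sqrt_mul (by positivity)]
    congr 2
    field_simp
  have h2 : -(Real.pi / a) * (x - q) i ^ 2 + -(Real.pi / b) * q i ^ 2 =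
      -(Real.pi / (a + b)) * x i ^ 2 +
        -(Real.pi / (a * b / (a + b))) * (q - (b / (a + b)) • x) i ^ 2 := by
    simp only [Pi.sub_apply, Pi.smul_apply, smul_eq_mul]
    field_simp
    ring
  calc _ = ((√a)⁻¹ * (√b)⁻¹) * (Real.exp (-(Real.pi / a) * (x - q) i ^ 2) *
        Real.exp (-(Real.pi / b) * q i ^ 2)) := by ring
    _ = _ := by
      rw [h1, ← Real.exp_add, h2, Real.exp_add]
      ring

/-- Gaussian densities form a convolution semigroup. -/
lemma integral_gau_sub_mul_gau {a b : ℝ} (ha : 0 < a) (hb : 0 < b) (x : Fin d → ℝ) :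
    ∫ q, gau a (x - q) * gau b q = gau (a + b) x := by
  simp_rw [gau_sub_mul_gau ha hb]
  rw [integral_const_mul, integral_sub_right_eq_self (gau (a * b / (a + b))),
    integral_gau (by positivity), mul_one]

lemma gau_mul_gau {a : ℝ} (ha : 0 < a) (x y : Fin d → ℝ) :
    gau a x * gau a y = gau (2 * a) (x - y) * gau (a / 2) ((1 / 2 : ℝ) • (x + y)) := by
  unfold gau
  rw [← Finset.prod_mul_distrib, ← Finset.prod_mul_distrib]
  refine Finset.prod_congr rfl fun i _ => ?_
  have h1 : (√a)⁻¹ * (√a)⁻¹ = (√(2 * a))⁻¹ * (√(a / 2))⁻¹ := by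
    rw [← mul_inv, ← mul_inv, ← Real.sqrt_mul ha.le, ← Real.sqrt_mul (by positivity)]
    congr 2
    ring
  have h2 : -(Real.pi / a) * x i ^ 2 + -(Real.pi / a) * y i ^ 2 =
      -(Real.pi / (2 * a)) * (x - y) i ^ 2 +
        -(Real.pi / (a / 2)) * ((1 / 2 : ℝ) • (x + y)) i ^ 2 := by
    simp only [Pi.sub_apply, Pi.smul_apply, smul_eq_mul, Pi.add_apply]
    field_simp
    ring
  calc _ = ((√a)⁻¹ * (√a)⁻¹) * (Real.exp (-(Real.pi / a) * x i ^ 2) *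
        Real.exp (-(Real.pi / a) * y i ^ 2)) := by ring
    _ = _ := by
      rw [h1, ← Real.exp_add, h2, Real.exp_add]
      ring

lemma gau_smul {a μ : ℝ} (hμ : 0 < μ) (x : Fin d → ℝ) :
    gau (μ ^ 2 * a) (μ • x) = (μ ^ d)⁻¹ * gau a x := by
  rw [gau_eq, gau_eq, Real.sqrt_mul (by positivity), Real.sqrt_sq hμ.le, mul_inv, mul_pow, inv_pow,
    mul_assoc]
  congr 3
  simp only [Pi.smul_apply, smul_eq_mul, mul_pow, ← Finset.mul_sum]
  field_simp

lemma integral_gau_sub_mul_gau_sub {a : ℝ} (ha : 0 < a) (z z' : Fin d → ℝ) :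
    ∫ c, gau a (z - c) * gau a (z' - c) = gau (2 * a) (z - z') := by
  rw [← integral_add_left_eq_self _ z', two_mul, ← integral_gau_sub_mul_gau ha ha]
  refine integral_congr_ae (.of_forall fun q => ?_)
  simp only [sub_add_cancel_left, gau_neg, sub_sub]

lemma integral_gau_mul_gau_sub_mul_gau_sub {a b : ℝ} (ha : 0 < a) (hb : 0 < b)
    (w z z' : Fin d → ℝ) :
    ∫ c, gau b (c - w) * (gau a (z - c) * gau a (z' - c)) =
      gau (2 * a) (z - z') * gau (a / 2 + b) ((1 / 2 : ℝ) • (z + z') - w) := by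
  rw [← integral_add_right_eq_self _ w, ← integral_gau_sub_mul_gau (half_pos ha) hb,
    ← integral_const_mul]
  refine integral_congr_ae (.of_forall fun q => ?_)
  simp only [add_sub_cancel_right]
  rw [gau_mul_gau ha]
  have h1 : z - (q + w) - (z' - (q + w)) = z - z' := by abel
  have h2 : (1 / 2 : ℝ) • (z - (q + w) + (z' - (q + w))) = (1 / 2 : ℝ) • (z + z') - w - q := by
    ext i
    simp
    ring
  rw [h1, h2]
  ring

/-- Integrability of a Gaussian mixture in both the parameter and the position. -/
lemma Integrable.mul_gau_sub {α : Type*} [MeasurableSpace α] {ν : Measure α} [SFinite ν]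
    {h : α → ℝ} (hh : Integrable h ν) {m : α → Fin d → ℝ} (hm : Measurable m) {a : ℝ}
    (ha : 0 < a) :
    Integrable (fun t : α × (Fin d → ℝ) => h t.1 * gau a (m t.1 - t.2)) (ν.prod volume) := by
  have hmeas : AEStronglyMeasurable (fun t : α × (Fin d → ℝ) => h t.1 * gau a (m t.1 - t.2))
      (ν.prod volume) := by
    refine hh.aestronglyMeasurable.comp_fst.mul (Measurable.aestronglyMeasurable ?_)
    fun_prop
  rw [integrable_prod_iff hmeas]
  constructor
  · exact .of_forall fun t => ((integrable_gau ha).comp_sub_left (m t)).const_mul (h t)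
  · have : ∀ t, ∫ c, ‖h t * gau a (m t - c)‖ = ‖h t‖ := fun t => by
      simp_rw [norm_mul, Real.norm_of_nonneg (gau_nonneg a _)]
      rw [integral_const_mul, integral_sub_left_eq_self (gau a), integral_gau ha, mul_one]
    simp_rw [this]
    exact hh.norm

end Gaussian

section Smoothing

variable {d : ℕ}

/-- The Gaussian average of `φ` around `c` with variance parameter `a`. -/
noncomputable def gaussAvg (φ : (Fin d → ℝ) → ℝ) (a : ℝ) (c : Fin d → ℝ) : ℝ :=
  ∫ z, φ z * gau a (z - c)

/-- The bilinear form with Gaussian convolution kernel. -/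
noncomputable def gaussForm (v : ℝ) (A B : (Fin d → ℝ) → ℝ) : ℝ :=
  ∫ t : (Fin d → ℝ) × (Fin d → ℝ), gau v (t.1 - t.2) * (A t.1 * B t.2)

/-- The Gaussian-weighted mean square of the averages `gaussAvg φ a` around `w`. -/
noncomputable def avgSq (φ : (Fin d → ℝ) → ℝ) (a b : ℝ) (w : Fin d → ℝ) : ℝ :=
  ∫ c, gau b (c - w) * gaussAvg φ a c ^ 2

/-- The Gaussian-weighted local variance of the averages `gaussAvg φ a` around `w`. -/
noncomputable def avgVar (φ : (Fin d → ℝ) → ℝ) (a r b : ℝ) (w : Fin d → ℝ) : ℝ :=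
  ∫ c, gau b (c - w) *
    ∫ q, gau r q * (gaussAvg φ a (c + q) - gaussAvg φ (a + r) c) ^ 2

variable {φ : (Fin d → ℝ) → ℝ} {a b r : ℝ}

lemma abs_gaussAvg_le (hb : ∀ z, |φ z| ≤ 1) (ha : 0 < a) (c : Fin d → ℝ) :
    |gaussAvg φ a c| ≤ 1 := by
  have h1 : ∫ z, gau a (z - c) = 1 := by
    rw [integral_sub_right_eq_self (gau a), integral_gau ha]
  rw [← h1, ← Real.norm_eq_abs]
  refine norm_integral_le_of_norm_le ((integrable_gau ha).comp_sub_right c)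
    (.of_forall fun z => ?_)
  rw [norm_mul, Real.norm_of_nonneg (gau_nonneg a _)]
  exact mul_le_of_le_one_left (gau_nonneg a _) (hb z)

lemma sq_gaussAvg_le (hb : ∀ z, |φ z| ≤ 1) (ha : 0 < a) (c : Fin d → ℝ) :
    gaussAvg φ a c ^ 2 ≤ 1 := by
  rw [← sq_abs]
  exact pow_le_one₀ (abs_nonneg _) (abs_gaussAvg_le hb ha c)

lemma measurable_gaussAvg (hm : Measurable φ) (a : ℝ) : Measurable (gaussAvg φ a) := by
  unfold gaussAvg
  refine (StronglyMeasurable.integral_prod_right (f := fun c z => φ z * gau a (z - c)) ?_).measurable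
  exact Measurable.stronglyMeasurable (by fun_prop)

lemma integrable_weight_mul_gau (hφ : Integrable φ) (ha : 0 < a)
    {ω : (Fin d → ℝ) → ℝ} (hω : Measurable ω) {M : ℝ} (hM : ∀ c, |ω c| ≤ M) :
    Integrable (fun t : ((Fin d → ℝ) × (Fin d → ℝ)) × (Fin d → ℝ) =>
      φ t.1.1 * φ t.1.2 * (ω t.2 * (gau a (t.1.1 - t.2) * gau a (t.1.2 - t.2))))
      (volume.prod volume) := by
  have h := (Integrable.mul_gau_sub (hφ.mul_prod hφ) (m := Prod.fst) measurable_fst ha).mul_bdd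
    (c := M * ((√a)⁻¹) ^ d) (g := fun t => ω t.2 * gau a (t.1.2 - t.2))
    (Measurable.aestronglyMeasurable (by fun_prop)) (.of_forall fun t => ?_)
  · refine h.congr (.of_forall fun t => ?_)
    simp only
    ring
  · rw [norm_mul, Real.norm_of_nonneg (gau_nonneg _ _)]
    exact mul_le_mul (hM _) (gau_le ha _) (gau_nonneg _ _) ((abs_nonneg _).trans (hM 0))

lemma sq_gaussAvg_eq (a : ℝ) (c : Fin d → ℝ) :
    gaussAvg φ a c ^ 2 = ∫ t : (Fin d → ℝ) × (Fin d → ℝ),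
      φ t.1 * φ t.2 * (gau a (t.1 - c) * gau a (t.2 - c)) := by
  rw [sq, gaussAvg, ← integral_prod_mul]
  refine integral_congr_ae (.of_forall fun t => ?_)
  simp only
  ring

lemma integral_weight_mul_sq_gaussAvg (hφ : Integrable φ) (ha : 0 < a)
    {ω : (Fin d → ℝ) → ℝ} (hω : Measurable ω) {M : ℝ} (hM : ∀ c, |ω c| ≤ M) :
    ∫ c, ω c * gaussAvg φ a c ^ 2 = ∫ t : (Fin d → ℝ) × (Fin d → ℝ),
      φ t.1 * φ t.2 * ∫ c, ω c * (gau a (t.1 - c) * gau a (t.2 - c)) := by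
  simp_rw [sq_gaussAvg_eq, ← integral_const_mul]
  rw [integral_integral_swap (f := fun (t : (Fin d → ℝ) × (Fin d → ℝ)) c =>
    φ t.1 * φ t.2 * (ω c * (gau a (t.1 - c) * gau a (t.2 - c))))
    (integrable_weight_mul_gau hφ ha hω hM)]
  refine integral_congr_ae (.of_forall fun c => ?_)
  refine integral_congr_ae (.of_forall fun t => ?_)
  simp only
  ring

lemma integrable_sq_gaussAvg (hφ : Integrable φ) (ha : 0 < a) :
    Integrable fun c => gaussAvg φ a c ^ 2 := by
  have := (integrable_weight_mul_gau hφ ha (ω := fun _ => 1) measurable_const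
    (M := 1) (by simp)).swap.integral_prod_left
  refine this.congr (.of_forall fun c => ?_)
  simp [sq_gaussAvg_eq]

lemma integral_sq_gaussAvg (hφ : Integrable φ) (ha : 0 < a) :
    ∫ c, gaussAvg φ a c ^ 2 = gaussForm (2 * a) φ φ := by
  have := integral_weight_mul_sq_gaussAvg hφ ha (ω := fun _ => 1) measurable_const
    (M := 1) (by simp)
  simp only [one_mul] at this
  rw [this, gaussForm]
  refine integral_congr_ae (.of_forall fun t => ?_)
  simp only
  rw [integral_gau_sub_mul_gau_sub ha]
  ring

lemma avgSq_eq (hφ : Integrable φ) (ha : 0 < a) (hb : 0 < b)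
    (w : Fin d → ℝ) :
    avgSq φ a b w = ∫ t : (Fin d → ℝ) × (Fin d → ℝ), gau (2 * a) (t.1 - t.2) *
      (gau (a / 2 + b) ((1 / 2 : ℝ) • (t.1 + t.2) - w) * (φ t.1 * φ t.2)) := by
  have := integral_weight_mul_sq_gaussAvg hφ ha (ω := fun c => gau b (c - w)) (by fun_prop)
    (M := ((√b)⁻¹) ^ d) (fun c => by rw [abs_of_nonneg (gau_nonneg _ _)]; exact gau_le hb _)
  rw [avgSq, this]
  refine integral_congr_ae (.of_forall fun t => ?_)
  simp only
  rw [integral_gau_mul_gau_sub_mul_gau_sub ha hb]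
  ring

lemma gaussAvg_add (hφ : Integrable φ) (ha : 0 < a) (hr : 0 < r) (c : Fin d → ℝ) :
    gaussAvg φ (a + r) c = ∫ q, gau r q * gaussAvg φ a (c + q) := by
  have hi := ((Integrable.mul_gau_sub hφ (m := fun z => z - c) (by fun_prop) ha).mul_bdd
    (c := ((√r)⁻¹) ^ d) (g := fun t => gau r t.2)
    (Measurable.aestronglyMeasurable (by fun_prop)) (.of_forall fun t => by
      rw [Real.norm_of_nonneg (gau_nonneg _ _)]; exact gau_le hr _))
  simp_rw [gaussAvg, ← integral_const_mul]
  rw [integral_integral_swap (hi.swap.congr (.of_forall fun t => by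
    simp only [Function.comp, Prod.fst_swap, Prod.snd_swap, Function.uncurry, sub_sub]; ring))]
  refine integral_congr_ae (.of_forall fun z => ?_)
  simp only
  rw [← integral_gau_sub_mul_gau ha hr, ← integral_const_mul]
  refine integral_congr_ae (.of_forall fun q => ?_)
  simp only [sub_sub]
  ring

lemma integrable_gau_mul_of_abs_le {h : (Fin d → ℝ) → ℝ} (hh : Measurable h) {M : ℝ}
    (hM : ∀ q, |h q| ≤ M) (hr : 0 < r) : Integrable fun q => gau r q * h q :=
  (integrable_gau hr).mul_bdd hh.aestronglyMeasurable (.of_forall hM)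

lemma integral_gau_mul_sub_sq (hm : Measurable φ) (hφ : Integrable φ) (hb : ∀ z, |φ z| ≤ 1)
    (ha : 0 < a) (hr : 0 < r) (c : Fin d → ℝ) :
    ∫ q, gau r q * (gaussAvg φ a (c + q) - gaussAvg φ (a + r) c) ^ 2 =
      (∫ q, gau r q * gaussAvg φ a (c + q) ^ 2) - gaussAvg φ (a + r) c ^ 2 := by
  have hα : Measurable fun q => gaussAvg φ a (c + q) := (measurable_gaussAvg hm a).comp (by fun_prop)
  set β := gaussAvg φ (a + r) c with hβ
  have e : ∀ q, gau r q * (gaussAvg φ a (c + q) - β) ^ 2 =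
      gau r q * gaussAvg φ a (c + q) ^ 2 - (2 * β) * (gau r q * gaussAvg φ a (c + q)) +
        β ^ 2 * gau r q := fun q => by ring
  have i1 : Integrable fun q => gau r q * gaussAvg φ a (c + q) ^ 2 :=
    integrable_gau_mul_of_abs_le (M := 1) (hα.pow_const 2)
      (fun q => by rw [abs_of_nonneg (sq_nonneg _)]; exact sq_gaussAvg_le hb ha _) hr
  have i2 : Integrable fun q => gau r q * gaussAvg φ a (c + q) :=
    integrable_gau_mul_of_abs_le (M := 1) hα (fun q => abs_gaussAvg_le hb ha _) hr
  simp_rw [e]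
  rw [integral_add (by exact i1.sub (i2.const_mul _)) ((integrable_gau hr).const_mul _),
    integral_sub i1 (i2.const_mul _), integral_const_mul, integral_const_mul, integral_gau hr,
    ← gaussAvg_add hφ ha hr, ← hβ]
  ring

lemma sq_gaussAvg_add_le (hm : Measurable φ) (hφ : Integrable φ) (hb : ∀ z, |φ z| ≤ 1)
    (ha : 0 < a) (hr : 0 < r) (c : Fin d → ℝ) :
    gaussAvg φ (a + r) c ^ 2 ≤ ∫ q, gau r q * gaussAvg φ a (c + q) ^ 2 := by
  rw [← sub_nonneg, ← integral_gau_mul_sub_sq hm hφ hb ha hr]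
  exact integral_nonneg fun q => mul_nonneg (gau_nonneg _ _) (sq_nonneg _)

lemma integral_gau_mul_sq_gaussAvg_add (c : Fin d → ℝ) :
    ∫ q, gau r q * gaussAvg φ a (c + q) ^ 2 = ∫ p, gaussAvg φ a p ^ 2 * gau r (p - c) := by
  rw [← integral_sub_right_eq_self _ c]
  refine integral_congr_ae (.of_forall fun p => ?_)
  simp only [add_sub_cancel]
  ring

lemma integral_sq_gaussAvg_add_le (hm : Measurable φ) (hφ : Integrable φ) (hb : ∀ z, |φ z| ≤ 1)
    (ha : 0 < a) (hr : 0 < r) :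
    ∫ c, gaussAvg φ (a + r) c ^ 2 ≤ ∫ c, gaussAvg φ a c ^ 2 := by
  have hi := Integrable.mul_gau_sub (integrable_sq_gaussAvg hφ ha) measurable_id hr
  calc ∫ c, gaussAvg φ (a + r) c ^ 2 ≤ ∫ c, ∫ p, gaussAvg φ a p ^ 2 * gau r (p - c) := by
        refine integral_mono (integrable_sq_gaussAvg hφ (by positivity))
          hi.integral_prod_right fun c => ?_
        rw [← integral_gau_mul_sq_gaussAvg_add]
        exact sq_gaussAvg_add_le hm hφ hb ha hr c
    _ = ∫ p, ∫ c, gaussAvg φ a p ^ 2 * gau r (p - c) := (integral_integral_swap hi).symm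
    _ = _ := by
        refine integral_congr_ae (.of_forall fun p => ?_)
        simp only
        rw [integral_const_mul, integral_sub_left_eq_self (gau r), integral_gau hr, mul_one]

lemma gaussForm_self_nonneg (hφ : Integrable φ) {v : ℝ} (hv : 0 < v) :
    0 ≤ gaussForm v φ φ := by
  have := integral_sq_gaussAvg hφ (half_pos hv)
  rw [mul_div_cancel₀ v two_ne_zero] at this
  rw [← this]
  exact integral_nonneg fun _ => sq_nonneg _

lemma gaussForm_self_anti_of_bounded (hm : Measurable φ) (hφ : Integrable φ)
    (hb : ∀ z, |φ z| ≤ 1) {v v' : ℝ}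
    (hv : 0 < v) (hv' : v ≤ v') : gaussForm v' φ φ ≤ gaussForm v φ φ := by
  rcases hv'.eq_or_lt with rfl | hlt
  · exact le_rfl
  have h1 := integral_sq_gaussAvg hφ (half_pos hv)
  have h2 := integral_sq_gaussAvg hφ (half_pos (hv.trans hlt))
  rw [mul_div_cancel₀ _ two_ne_zero] at h1 h2
  rw [← h1, ← h2]
  have := integral_sq_gaussAvg_add_le hm hφ hb (half_pos hv) (r := (v' - v) / 2) (by linarith)
  convert this using 5
  ring

lemma avgVar_eq (hm : Measurable φ) (hφ : Integrable φ) (hb : ∀ z, |φ z| ≤ 1)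
    (ha : 0 < a) (hr : 0 < r) (hb' : 0 < b) (w : Fin d → ℝ) :
    avgVar φ a r b w = avgSq φ a (b + r) w - avgSq φ (a + r) b w := by
  have hi := (Integrable.mul_gau_sub (integrable_sq_gaussAvg hφ ha) measurable_id hr).mul_bdd
    (c := ((√b)⁻¹) ^ d) (g := fun t => gau b (t.2 - w))
    (Measurable.aestronglyMeasurable (by fun_prop)) (.of_forall fun t => by
      rw [Real.norm_of_nonneg (gau_nonneg _ _)]; exact gau_le hb' _)
  have i1 : Integrable fun c => gau b (c - w) * ∫ p, gaussAvg φ a p ^ 2 * gau r (p - c) := by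
    refine hi.integral_prod_right.congr (.of_forall fun c => ?_)
    simp only [id]
    rw [integral_mul_const, mul_comm]
  have i2 : Integrable fun c => gau b (c - w) * gaussAvg φ (a + r) c ^ 2 :=
    ((integrable_gau hb').comp_sub_right w).mul_bdd (c := 1)
      ((measurable_gaussAvg hm _).pow_const 2).aestronglyMeasurable (.of_forall fun c => by
        rw [Real.norm_of_nonneg (sq_nonneg _)]; exact sq_gaussAvg_le hb (by positivity) _)
  unfold avgVar
  simp_rw [integral_gau_mul_sub_sq hm hφ hb ha hr, integral_gau_mul_sq_gaussAvg_add, mul_sub]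
  rw [integral_sub i1 i2]
  congr 1
  have hs := integral_integral_swap (f := fun p c => gaussAvg φ a p ^ 2 * gau r (id p - c) *
    gau b (c - w)) hi
  simp only [id] at hs
  calc ∫ c, gau b (c - w) * ∫ p, gaussAvg φ a p ^ 2 * gau r (p - c)
      = ∫ c, ∫ p, gaussAvg φ a p ^ 2 * gau r (p - c) * gau b (c - w) := by
        refine integral_congr_ae (.of_forall fun c => ?_)
        simp only
        rw [integral_mul_const, mul_comm]
    _ = ∫ p, ∫ c, gaussAvg φ a p ^ 2 * gau r (p - c) * gau b (c - w) := hs.symm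
    _ = avgSq φ a (b + r) w := by
        refine integral_congr_ae (.of_forall fun p => ?_)
        simp only [mul_assoc]
        rw [integral_const_mul, mul_comm, ← integral_add_right_eq_self _ w, add_comm b r,
          ← integral_gau_sub_mul_gau hr hb']
        congr 1
        refine integral_congr_ae (.of_forall fun q => ?_)
        simp only [add_sub_cancel_right]
        congr 2
        abel

end Smoothing

section Forms

variable {d : ℕ}

lemma integrable_gau_mul_prod {A B : (Fin d → ℝ) → ℝ} {v : ℝ} (hv : 0 < v) (hA : Integrable A)
    (hBm : Measurable B) (hB : ∀ y, |B y| ≤ 1) :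
    Integrable fun t : (Fin d → ℝ) × (Fin d → ℝ) => gau v (t.1 - t.2) * (A t.1 * B t.2) := by
  have h := (Integrable.mul_gau_sub hA measurable_id hv).mul_bdd (c := 1)
    (g := fun t => B t.2) (Measurable.aestronglyMeasurable (by fun_prop))
    (.of_forall fun t => hB _)
  refine h.congr (.of_forall fun t => ?_)
  simp only [id]
  ring

lemma abs_gaussForm_le {A B : (Fin d → ℝ) → ℝ} {v : ℝ} (hv : 0 < v) (hA : Integrable A)
    (hB : ∀ y, |B y| ≤ 1) : |gaussForm v A B| ≤ ∫ y, |A y| := by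
  have h := Integrable.mul_gau_sub hA.abs measurable_id hv
  have e : ∫ t : (Fin d → ℝ) × (Fin d → ℝ), |A t.1| * gau v (t.1 - t.2) = ∫ y, |A y| := by
    refine (integral_prod _ h).trans (integral_congr_ae (.of_forall fun y => ?_))
    simp only [id]
    rw [integral_const_mul, integral_sub_left_eq_self (gau v), integral_gau hv, mul_one]
  rw [← e, gaussForm, ← Real.norm_eq_abs]
  refine norm_integral_le_of_norm_le h (.of_forall fun t => ?_)
  rw [norm_mul, norm_mul, Real.norm_of_nonneg (gau_nonneg _ _), mul_comm]
  exact mul_le_mul_of_nonneg_right (mul_le_of_le_one_right (abs_nonneg _) (hB _)) (gau_nonneg _ _)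

/-- Expansion of the form at a sum, with the symmetry of the kernel. -/
lemma gaussForm_add_self {A B : (Fin d → ℝ) → ℝ} {v : ℝ} (hv : 0 < v)
    (hAm : Measurable A) (hBm : Measurable B) (hAi : Integrable A) (hBi : Integrable B)
    (hA : ∀ y, |A y| ≤ 1) (hB : ∀ y, |B y| ≤ 1) :
    4 * gaussForm v (fun y => (A y + B y) / 2) (fun y => (A y + B y) / 2) =
      gaussForm v A A + 2 * gaussForm v A B + gaussForm v B B := by
  have h1 := integrable_gau_mul_prod hv hAi hAm hA
  have h2 := integrable_gau_mul_prod hv hAi hBm hB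
  have h3 := integrable_gau_mul_prod hv hBi hAm hA
  have h4 := integrable_gau_mul_prod hv hBi hBm hB
  have hs : gaussForm v B A = gaussForm v A B := by
    unfold gaussForm
    refine Eq.trans ?_ (integral_prod_swap (μ := volume) (ν := volume) _)
    refine integral_congr_ae (.of_forall fun t => ?_)
    simp only [Prod.fst_swap, Prod.snd_swap]
    rw [gau_sub_comm, mul_comm (B t.1)]
  have e : 4 * gaussForm v (fun y => (A y + B y) / 2) (fun y => (A y + B y) / 2) =
      gaussForm v A A + gaussForm v A B + (gaussForm v B A + gaussForm v B B) := by
    unfold gaussForm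
    rw [← integral_add h1 h2, ← integral_add h3 h4, ← integral_add (by exact h1.add h2)
      (by exact h3.add h4), ← integral_const_mul]
    refine integral_congr_ae (.of_forall fun t => ?_)
    simp only
    ring
  rw [e, hs]
  ring

lemma gaussForm_sub_le {A B : (Fin d → ℝ) → ℝ} {v v' : ℝ} (hv : 0 < v) (hvv : v ≤ v')
    (hAm : Measurable A) (hBm : Measurable B) (hAi : Integrable A) (hBi : Integrable B)
    (hA : ∀ y, |A y| ≤ 1) (hB : ∀ y, |B y| ≤ 1) :
    gaussForm v' A B - gaussForm v A B ≤
      ((gaussForm v A A - gaussForm v' A A) + (gaussForm v B B - gaussForm v' B B)) / 2 := by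
  have h := gaussForm_self_anti_of_bounded (φ := fun y => (A y + B y) / 2) (by fun_prop)
    ((hAi.add hBi).div_const 2) (fun y => by
      rw [abs_div, abs_two, div_le_one two_pos]
      exact (abs_add_le _ _).trans (by linarith [hA y, hB y])) hv hvv
  have h1 := gaussForm_add_self hv hAm hBm hAi hBi hA hB
  have h2 := gaussForm_add_self (hv.trans_le hvv) hAm hBm hAi hBi hA hB
  linarith

/-- Reflection `x ↦ m - x` in the second variable of a Gaussian form. -/
lemma gaussForm_reflect {A B : (Fin d → ℝ) → ℝ} {v : ℝ} (m : Fin d → ℝ) :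
    gaussForm v A (fun y => B (m - y)) =
      ∫ u : (Fin d → ℝ) × (Fin d → ℝ), gau v (m - (u.1 + u.2)) * (A u.2 * B u.1) := by
  have mp : MeasurePreserving (fun u : (Fin d → ℝ) × (Fin d → ℝ) => (m - u.2, u.1)) := by
    have h1 := (MeasurePreserving.id (volume : Measure (Fin d → ℝ))).prod
      (Measure.measurePreserving_sub_left volume m)
    have h2 := (Measure.measurePreserving_swap (μ := (volume : Measure (Fin d → ℝ)))
      (ν := (volume : Measure (Fin d → ℝ)))).comp h1
    exact h2
  have me : MeasurableEmbedding (fun u : (Fin d → ℝ) × (Fin d → ℝ) => (m - u.2, u.1)) := by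
    refine Measurable.measurableEmbedding (by fun_prop) fun u u' h => ?_
    simp only [Prod.mk.injEq, sub_right_inj] at h
    exact Prod.ext h.2 h.1
  rw [← mp.integral_comp me, gaussForm]
  refine integral_congr_ae (.of_forall fun u => ?_)
  simp only
  rw [← gau_neg]
  congr 2
  abel

lemma gaussForm_reflect_reflect {B : (Fin d → ℝ) → ℝ} {v : ℝ} (m : Fin d → ℝ) :
    gaussForm v (fun y => B (m - y)) (fun y => B (m - y)) = gaussForm v B B := by
  rw [gaussForm_reflect m, gaussForm]
  have mp : MeasurePreserving (fun u : (Fin d → ℝ) × (Fin d → ℝ) => (u.1, m - u.2)) :=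
    (MeasurePreserving.id (volume : Measure (Fin d → ℝ))).prod
      (Measure.measurePreserving_sub_left volume m)
  have me : MeasurableEmbedding (fun u : (Fin d → ℝ) × (Fin d → ℝ) => (u.1, m - u.2)) := by
    refine Measurable.measurableEmbedding (by fun_prop) fun u u' h => ?_
    simp only [Prod.mk.injEq, sub_right_inj] at h
    exact Prod.ext h.1 h.2
  rw [← mp.integral_comp me]
  refine integral_congr_ae (.of_forall fun u => ?_)
  simp only
  rw [sub_sub_cancel, mul_comm (B u.2), gau_sub_comm v u.1]
  congr 2
  abel

/-- A measurable kernel dominated by the tensor square of an integrable weight at most `1`. -/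
structure WeightedKernel (κ : (Fin d → ℝ) → ℝ) (K : (Fin d → ℝ) → (Fin d → ℝ) → ℝ) : Prop where
  measurable_weight : Measurable κ
  weight_nonneg : ∀ z, 0 ≤ κ z
  weight_le_one : ∀ z, κ z ≤ 1
  integrable_weight : Integrable κ
  measurable : Measurable (Function.uncurry K)
  abs_le : ∀ z y, |K z y| ≤ κ z * κ y

namespace WeightedKernel

variable {κ : (Fin d → ℝ) → ℝ} {K F H : (Fin d → ℝ) → (Fin d → ℝ) → ℝ}

lemma flip (hK : WeightedKernel κ K) : WeightedKernel κ fun y z => K z y :=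
  ⟨hK.1, hK.2, hK.3, hK.4, hK.5.comp measurable_swap, fun y z => by rw [mul_comm]; exact hK.6 z y⟩

lemma abs_le_left (hK : WeightedKernel κ K) (z y : Fin d → ℝ) : |K z y| ≤ κ z :=
  (hK.abs_le z y).trans (mul_le_of_le_one_right (hK.weight_nonneg z) (hK.weight_le_one y))

lemma abs_le_right (hK : WeightedKernel κ K) (z y : Fin d → ℝ) : |K z y| ≤ κ y :=
  hK.flip.abs_le_left y z

lemma abs_le_one (hK : WeightedKernel κ K) (z y : Fin d → ℝ) : |K z y| ≤ 1 :=
  (hK.abs_le_left z y).trans (hK.weight_le_one z)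

lemma measurable_comp (hK : WeightedKernel κ K) {α : Type*} [MeasurableSpace α]
    {p q : α → Fin d → ℝ} (hp : Measurable p) (hq : Measurable q) :
    Measurable fun t => K (p t) (q t) :=
  hK.measurable.comp (hp.prodMk hq)

lemma integrable (hK : WeightedKernel κ K) :
    Integrable fun t : (Fin d → ℝ) × (Fin d → ℝ) => K t.1 t.2 :=
  (hK.integrable_weight.mul_prod hK.integrable_weight).mono'
    (hK.measurable_comp measurable_fst measurable_snd).aestronglyMeasurable
    (.of_forall fun _ => hK.abs_le _ _)

lemma integrable_slice (hK : WeightedKernel κ K) (z : Fin d → ℝ) : Integrable (K z) :=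
  hK.integrable_weight.mono' (hK.measurable_comp measurable_const measurable_id).aestronglyMeasurable
    (.of_forall fun _ => hK.abs_le_right _ _)

lemma abs_mul_le (hK : WeightedKernel κ K) (a : ℝ) (z y : Fin d → ℝ) : |a * K z y| ≤ |a| := by
  rw [abs_mul]
  exact mul_le_of_le_one_right (abs_nonneg _) (hK.abs_le_one _ _)

lemma integrable_slice_mul (hK : WeightedKernel κ K) (z z' : Fin d → ℝ) :
    Integrable fun y => K z y * K z' y :=
  (hK.integrable_slice z).abs.mono' ((hK.measurable_comp measurable_const measurable_id).mul
    (hK.measurable_comp measurable_const measurable_id)).aestronglyMeasurable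
    (.of_forall fun _ => hK.abs_mul_le _ _ _)

end WeightedKernel

end Forms

section CornerForms

variable {d : ℕ}

/-- The Gaussian box form of a kernel. -/
noncomputable def boxForm (K : (Fin d → ℝ) → (Fin d → ℝ) → ℝ) (r v : ℝ) : ℝ :=
  ∫ t : (Fin d → ℝ) × (Fin d → ℝ), gau r (t.1 - t.2) *
    gaussForm v (fun y => K t.1 y * K t.2 y) (fun y => K t.1 y * K t.2 y)

/-- The form coupling two kernels through the reflection `x ↦ (z + z') / 2 - x`. -/
noncomputable def crossForm (F H : (Fin d → ℝ) → (Fin d → ℝ) → ℝ) (r v : ℝ) : ℝ :=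
  ∫ t : (Fin d → ℝ) × (Fin d → ℝ), gau r (t.1 - t.2) *
    gaussForm v (fun y => F t.1 y * F t.2 y)
      (fun y => H t.1 ((1 / 2 : ℝ) • (t.1 + t.2) - y) * H t.2 ((1 / 2 : ℝ) • (t.1 + t.2) - y))

namespace WeightedKernel

variable {κ : (Fin d → ℝ) → ℝ} {K F H : (Fin d → ℝ) → (Fin d → ℝ) → ℝ} {r r' v v' : ℝ}

lemma integrable_of_abs_le (hK : WeightedKernel κ K)
    {g : ((Fin d → ℝ) × (Fin d → ℝ)) × ((Fin d → ℝ) × (Fin d → ℝ)) → ℝ} (hg : Measurable g)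
    {M : ℝ} (hM : ∀ p, |g p| ≤ M * ((κ p.1.1 * κ p.1.2) * (κ p.2.1 * κ p.2.2))) :
    Integrable g (volume.prod volume) := by
  have h := hK.integrable_weight.mul_prod hK.integrable_weight
  exact ((h.mul_prod h).const_mul M).mono' hg.aestronglyMeasurable (.of_forall hM)

lemma integrable_gau_mul_gaussForm (hK : WeightedKernel κ K) (hr : 0 < r) (hv : 0 < v)
    {B : (Fin d → ℝ) → (Fin d → ℝ) → (Fin d → ℝ) → ℝ}
    (hBm : Measurable fun p : ((Fin d → ℝ) × (Fin d → ℝ)) × (Fin d → ℝ) => B p.1.1 p.1.2 p.2)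
    (hB : ∀ z z' y, |B z z' y| ≤ 1) :
    Integrable fun t : (Fin d → ℝ) × (Fin d → ℝ) => gau r (t.1 - t.2) *
      gaussForm v (fun y => K t.1 y * K t.2 y) (B t.1 t.2) := by
  have hm := hK.measurable
  have hi := (hK.integrable_weight.mul_prod hK.integrable_weight).const_mul
    (((√r)⁻¹) ^ d * ∫ y, κ y)
  refine hi.mono' ?_ (.of_forall fun t => ?_)
  · refine Measurable.aestronglyMeasurable (Measurable.mul (by fun_prop) ?_)
    unfold gaussForm
    refine (StronglyMeasurable.integral_prod_right (f := fun (t u : (Fin d → ℝ) × (Fin d → ℝ)) =>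
      gau v (u.1 - u.2) * ((K t.1 u.1 * K t.2 u.1) * B t.1 t.2 u.2)) ?_).measurable
    have hB' : Measurable fun p : ((Fin d → ℝ) × (Fin d → ℝ)) × ((Fin d → ℝ) × (Fin d → ℝ)) =>
        B p.1.1 p.1.2 p.2.2 := hBm.comp
          (measurable_fst.prodMk (measurable_snd.comp measurable_snd))
    exact Measurable.stronglyMeasurable (Measurable.mul (by fun_prop)
      (Measurable.mul (by fun_prop) hB'))
  · have h1 : |gaussForm v (fun y => K t.1 y * K t.2 y) (B t.1 t.2)| ≤ (κ t.1 * κ t.2) * ∫ y, κ y := by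
      refine (abs_gaussForm_le hv (hK.integrable_slice_mul _ _) (hB _ _)).trans ?_
      rw [← integral_const_mul]
      refine integral_mono (hK.integrable_slice_mul _ _).abs (hK.integrable_weight.const_mul _)
        fun y => ?_
      simp only [abs_mul]
      calc |K t.1 y| * |K t.2 y| ≤ κ t.1 * (κ t.2 * κ y) :=
            mul_le_mul (hK.abs_le_left _ _) (hK.abs_le _ _) (abs_nonneg _) (hK.weight_nonneg _)
        _ = _ := by ring
    rw [norm_mul, Real.norm_of_nonneg (gau_nonneg _ _)]
    refine (mul_le_mul (gau_le hr _) h1 (abs_nonneg _) (by positivity)).trans (le_of_eq ?_)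
    ring

lemma abs_integral_gau_mul_gaussForm_le (hK : WeightedKernel κ K) (hr : 0 < r) (hv : 0 < v)
    {B : (Fin d → ℝ) → (Fin d → ℝ) → (Fin d → ℝ) → ℝ}
    (hB : ∀ z z' y, |B z z' y| ≤ 1) :
    |∫ t : (Fin d → ℝ) × (Fin d → ℝ), gau r (t.1 - t.2) *
      gaussForm v (fun y => K t.1 y * K t.2 y) (B t.1 t.2)| ≤
      ∫ t : (Fin d → ℝ) × (Fin d → ℝ), |K t.1 t.2| := by
  have hi : Integrable fun z => ∫ y, |K z y| := hK.integrable.abs.integral_prod_left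
  have hs : ∀ t : (Fin d → ℝ) × (Fin d → ℝ),
      |gaussForm v (fun y => K t.1 y * K t.2 y) (B t.1 t.2)| ≤ ∫ y, |K t.1 y| := fun t => by
    refine (abs_gaussForm_le hv (hK.integrable_slice_mul _ _) (hB _ _)).trans ?_
    exact integral_mono (hK.integrable_slice_mul _ _).abs (hK.integrable_slice _).abs
      fun y => hK.abs_mul_le _ _ _
  have h1 : ∫ t : (Fin d → ℝ) × (Fin d → ℝ), |K t.1 t.2| = ∫ z, |(∫ y, |K z y|)| := by
    refine (integral_prod _ hK.integrable.abs).trans (integral_congr_ae (.of_forall fun z => ?_))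
    exact (abs_of_nonneg (integral_nonneg fun _ => abs_nonneg _)).symm
  have h2 := integrable_gau_mul_prod hr hi (B := fun _ => 1) measurable_const (by simp)
  refine le_trans ?_ ((le_abs_self _).trans
    ((abs_gaussForm_le hr hi (B := fun _ => 1) (by simp)).trans_eq h1.symm))
  rw [← Real.norm_eq_abs, gaussForm]
  refine norm_integral_le_of_norm_le h2 (.of_forall fun t => ?_)
  rw [norm_mul, Real.norm_of_nonneg (gau_nonneg _ _), mul_one]
  exact mul_le_mul_of_nonneg_left (hs t) (gau_nonneg _ _)

lemma boxForm_le (hK : WeightedKernel κ K) (hr : 0 < r) (hv : 0 < v) :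
    boxForm K r v ≤ ∫ t : (Fin d → ℝ) × (Fin d → ℝ), |K t.1 t.2| :=
  (le_abs_self _).trans (hK.abs_integral_gau_mul_gaussForm_le
    (B := fun z z' y => K z y * K z' y) hr hv fun _ _ _ => (hK.abs_mul_le _ _ _).trans (hK.abs_le_one _ _))

lemma crossForm_le (hF : WeightedKernel κ F) (hH : WeightedKernel κ H) (hr : 0 < r) (hv : 0 < v) :
    crossForm F H r v ≤ ∫ t : (Fin d → ℝ) × (Fin d → ℝ), |F t.1 t.2| :=
  (le_abs_self _).trans (hF.abs_integral_gau_mul_gaussForm_le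
    (B := fun z z' y => H z ((1 / 2 : ℝ) • (z + z') - y) * H z' ((1 / 2 : ℝ) • (z + z') - y))
    hr hv fun _ _ _ => (hH.abs_mul_le _ _ _).trans (hH.abs_le_one _ _))

lemma integrable_boxForm (hK : WeightedKernel κ K) (hr : 0 < r) (hv : 0 < v) :
    Integrable fun t : (Fin d → ℝ) × (Fin d → ℝ) => gau r (t.1 - t.2) *
      gaussForm v (fun y => K t.1 y * K t.2 y) (fun y => K t.1 y * K t.2 y) := by
  have hm := hK.measurable
  exact hK.integrable_gau_mul_gaussForm (B := fun z z' y => K z y * K z' y) hr hv (by fun_prop)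
    fun _ _ _ => (hK.abs_mul_le _ _ _).trans (hK.abs_le_one _ _)

lemma integrable_crossForm (hF : WeightedKernel κ F) (hH : WeightedKernel κ H) (hr : 0 < r)
    (hv : 0 < v) :
    Integrable fun t : (Fin d → ℝ) × (Fin d → ℝ) => gau r (t.1 - t.2) *
      gaussForm v (fun y => F t.1 y * F t.2 y)
      (fun y => H t.1 ((1 / 2 : ℝ) • (t.1 + t.2) - y) * H t.2 ((1 / 2 : ℝ) • (t.1 + t.2) - y)) := by
  have hm := hH.measurable
  exact hF.integrable_gau_mul_gaussForm
    (B := fun z z' y => H z ((1 / 2 : ℝ) • (z + z') - y) * H z' ((1 / 2 : ℝ) • (z + z') - y))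
    hr hv (by fun_prop) fun _ _ _ => (hH.abs_mul_le _ _ _).trans (hH.abs_le_one _ _)

lemma boxForm_nonneg (hK : WeightedKernel κ K) (hv : 0 < v) :
    0 ≤ boxForm K r v :=
  integral_nonneg fun _ => mul_nonneg (gau_nonneg _ _)
    (gaussForm_self_nonneg (hK.integrable_slice_mul _ _) hv)

lemma measurable_slice_mul (hK : WeightedKernel κ K) (z z' : Fin d → ℝ) :
    Measurable fun y => K z y * K z' y := by
  have hm := hK.measurable
  fun_prop

lemma abs_slice_mul_le (hK : WeightedKernel κ K) (z z' y y' : Fin d → ℝ) :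
    |K z y * K z' y'| ≤ 1 :=
  (hK.abs_mul_le _ _ _).trans (hK.abs_le_one _ _)

lemma boxForm_anti_right (hK : WeightedKernel κ K) (hr : 0 < r) (hv : 0 < v) (hvv : v ≤ v') :
    boxForm K r v' ≤ boxForm K r v :=
  integral_mono (hK.integrable_boxForm hr (hv.trans_le hvv)) (hK.integrable_boxForm hr hv)
    fun _ => mul_le_mul_of_nonneg_left (gaussForm_self_anti_of_bounded
      (hK.measurable_slice_mul _ _) (hK.integrable_slice_mul _ _)
      (fun _ => hK.abs_slice_mul_le _ _ _ _) hv hvv) (gau_nonneg _ _)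

lemma boxForm_flip (hK : WeightedKernel κ K) (hr : 0 < r) (hv : 0 < v) :
    boxForm (fun y z => K z y) v r = boxForm K r v := by
  have hm := hK.measurable
  have hi := hK.integrable_of_abs_le (M := ((√r)⁻¹) ^ d * ((√v)⁻¹) ^ d)
    (g := fun p => gau r (p.1.1 - p.1.2) * (gau v (p.2.1 - p.2.2) *
      (K p.1.1 p.2.1 * K p.1.2 p.2.1 * (K p.1.1 p.2.2 * K p.1.2 p.2.2)))) (by fun_prop) (fun p => by
      have h1 := mul_le_mul (hK.abs_le p.1.1 p.2.1) (hK.abs_le p.1.2 p.2.2) (abs_nonneg _)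
        (mul_nonneg (hK.weight_nonneg _) (hK.weight_nonneg _))
      have h2 : |K p.1.2 p.2.1 * K p.1.1 p.2.2| ≤ 1 := hK.abs_slice_mul_le _ _ _ _
      rw [abs_mul, abs_mul, abs_of_nonneg (gau_nonneg _ _), abs_of_nonneg (gau_nonneg _ _),
        ← mul_assoc]
      refine mul_le_mul (mul_le_mul (gau_le hr _) (gau_le hv _) (gau_nonneg _ _) (by positivity)) ?_
        (abs_nonneg _) (by positivity)
      calc _ = |K p.1.1 p.2.1| * |K p.1.2 p.2.2| * |K p.1.2 p.2.1 * K p.1.1 p.2.2| := by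
            simp only [abs_mul]; ring
        _ ≤ |K p.1.1 p.2.1| * |K p.1.2 p.2.2| := mul_le_of_le_one_right (by positivity) h2
        _ ≤ _ := h1.trans_eq (by ring))
  unfold boxForm gaussForm
  simp_rw [← integral_const_mul]
  rw [integral_integral_swap (f := fun (t u : (Fin d → ℝ) × (Fin d → ℝ)) =>
    gau v (t.1 - t.2) * (gau r (u.1 - u.2) * (K u.1 t.1 * K u.1 t.2 * (K u.2 t.1 * K u.2 t.2))))]
  · refine integral_congr_ae (.of_forall fun t => integral_congr_ae (.of_forall fun u => ?_))
    simp only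
    ring
  · refine hi.swap.congr (.of_forall fun p => ?_)
    simp only [Function.comp, Prod.fst_swap, Prod.snd_swap, Function.uncurry]
    ring

lemma boxForm_anti_left (hK : WeightedKernel κ K) (hr : 0 < r) (hrr : r ≤ r') (hv : 0 < v) :
    boxForm K r' v ≤ boxForm K r v := by
  rw [← hK.boxForm_flip hr hv, ← hK.boxForm_flip (hr.trans_le hrr) hv]
  exact hK.flip.boxForm_anti_right hv hr hrr

lemma crossForm_sub_le (hF : WeightedKernel κ F) (hH : WeightedKernel κ H) (hr : 0 < r)
    (hv : 0 < v) (hvv : v ≤ v') :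
    crossForm F H r v' - crossForm F H r v ≤
      ((boxForm F r v - boxForm F r v') + (boxForm H r v - boxForm H r v')) / 2 := by
  have hv' := hv.trans_le hvv
  have i1 := hF.integrable_boxForm hr hv
  have i2 := hF.integrable_boxForm hr hv'
  have i3 := hH.integrable_boxForm hr hv
  have i4 := hH.integrable_boxForm hr hv'
  have i5 := hF.integrable_crossForm hH hr hv
  have i6 := hF.integrable_crossForm hH hr hv'
  unfold crossForm boxForm
  rw [← integral_sub i6 i5, ← integral_sub i1 i2, ← integral_sub i3 i4,
    ← integral_add (by exact i1.sub i2) (by exact i3.sub i4), ← integral_div]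
  refine integral_mono (i6.sub i5) (((i1.sub i2).add (i3.sub i4)).div_const 2) fun t => ?_
  have h := gaussForm_sub_le hv hvv (hF.measurable_slice_mul t.1 t.2)
    (B := fun y => H t.1 ((1 / 2 : ℝ) • (t.1 + t.2) - y) * H t.2 ((1 / 2 : ℝ) • (t.1 + t.2) - y))
    ((hH.measurable_slice_mul t.1 t.2).comp (measurable_const.sub measurable_id))
    (hF.integrable_slice_mul t.1 t.2)
    ((hH.integrable_slice_mul t.1 t.2).comp_sub_left ((1 / 2 : ℝ) • (t.1 + t.2)))
    (fun _ => hF.abs_slice_mul_le _ _ _ _) (fun _ => hH.abs_slice_mul_le _ _ _ _)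
  have e : ∀ v, gaussForm v
      (fun y => H t.1 ((1 / 2 : ℝ) • (t.1 + t.2) - y) * H t.2 ((1 / 2 : ℝ) • (t.1 + t.2) - y))
      (fun y => H t.1 ((1 / 2 : ℝ) • (t.1 + t.2) - y) * H t.2 ((1 / 2 : ℝ) • (t.1 + t.2) - y)) =
      gaussForm v (fun y => H t.1 y * H t.2 y) (fun y => H t.1 y * H t.2 y) := fun v =>
    gaussForm_reflect_reflect (B := fun y => H t.1 y * H t.2 y) _
  rw [e, e] at h
  have := mul_le_mul_of_nonneg_left h (gau_nonneg r (t.1 - t.2))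
  simp only
  linarith

end WeightedKernel

end CornerForms

section Telescoping

variable {d : ℕ} {κ : (Fin d → ℝ) → ℝ} {F H : (Fin d → ℝ) → (Fin d → ℝ) → ℝ} {a b : ℝ}

namespace WeightedKernel

lemma integrable_mul_slice (hF : WeightedKernel κ F) (hH : WeightedKernel κ H)
    (x y : Fin d → ℝ) : Integrable fun z => F z y * H z x :=
  (hF.flip.integrable_slice y).mul_bdd (c := 1)
    (hH.flip.integrable_slice x).aestronglyMeasurable (.of_forall fun _ => hH.abs_le_one _ _)

lemma measurable_mul_slice (hF : WeightedKernel κ F) (hH : WeightedKernel κ H)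
    (x y : Fin d → ℝ) : Measurable fun z => F z y * H z x := by
  have hFm := hF.measurable
  have hHm := hH.measurable
  fun_prop

lemma abs_mul_slice_le (hF : WeightedKernel κ F) (hH : WeightedKernel κ H)
    (x y z : Fin d → ℝ) : |F z y * H z x| ≤ 1 :=
  (hH.abs_mul_le _ _ _).trans (hF.abs_le_one _ _)

lemma integrable_cross_kernel (hF : WeightedKernel κ F) (hH : WeightedKernel κ H) {r v : ℝ}
    (hr : 0 < r) (hv : 0 < v) :
    Integrable (fun p : ((Fin d → ℝ) × (Fin d → ℝ)) × ((Fin d → ℝ) × (Fin d → ℝ)) =>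
      gau r (p.1.1 - p.1.2) * (gau v ((1 / 2 : ℝ) • (p.1.1 + p.1.2) - (p.2.1 + p.2.2)) *
      (F p.1.1 p.2.2 * H p.1.1 p.2.1 * (F p.1.2 p.2.2 * H p.1.2 p.2.1))))
      (volume.prod volume) := by
  have hFm := hF.measurable
  have hHm := hH.measurable
  refine hF.integrable_of_abs_le (M := ((√r)⁻¹) ^ d * ((√v)⁻¹) ^ d) (by fun_prop) fun p => ?_
  have h1 := mul_le_mul (hF.abs_le p.1.1 p.2.2) (hH.abs_le p.1.2 p.2.1) (abs_nonneg _)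
    (mul_nonneg (hF.weight_nonneg _) (hF.weight_nonneg _))
  have h2 : |F p.1.2 p.2.2 * H p.1.1 p.2.1| ≤ 1 := (hH.abs_mul_le _ _ _).trans (hF.abs_le_one _ _)
  rw [abs_mul, abs_mul, abs_of_nonneg (gau_nonneg _ _), abs_of_nonneg (gau_nonneg _ _), ← mul_assoc]
  refine mul_le_mul (mul_le_mul (gau_le hr _) (gau_le hv _) (gau_nonneg _ _) (by positivity)) ?_
    (abs_nonneg _) (by positivity)
  calc _ = |F p.1.1 p.2.2| * |H p.1.2 p.2.1| * |F p.1.2 p.2.2 * H p.1.1 p.2.1| := by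
        simp only [abs_mul]; ring
    _ ≤ |F p.1.1 p.2.2| * |H p.1.2 p.2.1| := mul_le_of_le_one_right (by positivity) h2
    _ ≤ _ := h1.trans_eq (by ring)

lemma integrable_avgSq (hF : WeightedKernel κ F) (hH : WeightedKernel κ H) (ha : 0 < a)
    (hb : 0 < b) : Integrable fun u : (Fin d → ℝ) × (Fin d → ℝ) =>
      avgSq (fun z => F z u.2 * H z u.1) a b (u.1 + u.2) := by
  have := (hF.integrable_cross_kernel hH (r := 2 * a) (v := a / 2 + b) (by positivity)
    (by positivity)).integral_prod_right
  refine this.congr (.of_forall fun u => ?_)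
  simp only
  rw [avgSq_eq (hF.integrable_mul_slice hH _ _) ha hb]

lemma integral_avgSq (hF : WeightedKernel κ F) (hH : WeightedKernel κ H) (ha : 0 < a)
    (hb : 0 < b) : ∫ u : (Fin d → ℝ) × (Fin d → ℝ),
      avgSq (fun z => F z u.2 * H z u.1) a b (u.1 + u.2) = crossForm F H (2 * a) (a / 2 + b) := by
  have hi := hF.integrable_cross_kernel hH (r := 2 * a) (v := a / 2 + b) (by positivity)
    (by positivity)
  calc _ = ∫ u : (Fin d → ℝ) × (Fin d → ℝ), ∫ t : (Fin d → ℝ) × (Fin d → ℝ),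
        gau (2 * a) (t.1 - t.2) * (gau (a / 2 + b) ((1 / 2 : ℝ) • (t.1 + t.2) - (u.1 + u.2)) *
        (F t.1 u.2 * H t.1 u.1 * (F t.2 u.2 * H t.2 u.1))) :=
        integral_congr_ae (.of_forall fun u => avgSq_eq (hF.integrable_mul_slice hH _ _) ha hb _)
    _ = _ := (integral_integral_swap hi).symm
    _ = _ := integral_congr_ae (.of_forall fun t => ?_)
  simp only
  rw [integral_const_mul, gaussForm_reflect (A := fun y => F t.1 y * F t.2 y)
    (B := fun y => H t.1 y * H t.2 y)]
  congr 1
  refine integral_congr_ae (.of_forall fun u => ?_)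
  simp only
  ring

lemma integrable_avgVar (hF : WeightedKernel κ F) (hH : WeightedKernel κ H) (ha : 0 < a)
    (hb : 0 < b) : Integrable fun u : (Fin d → ℝ) × (Fin d → ℝ) =>
      avgVar (fun z => F z u.2 * H z u.1) a (3 * a) b (u.1 + u.2) := by
  refine ((hF.integrable_avgSq hH ha (b := b + 3 * a) (by positivity)).sub
    (hF.integrable_avgSq hH (a := a + 3 * a) (by positivity) hb)).congr (.of_forall fun u => ?_)
  exact (avgVar_eq (hF.measurable_mul_slice hH _ _) (hF.integrable_mul_slice hH _ _)
    (fun z => hF.abs_mul_slice_le hH _ _ _) ha (by positivity) hb _).symm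

lemma integral_avgVar (hF : WeightedKernel κ F) (hH : WeightedKernel κ H) (ha : 0 < a)
    (hb : 0 < b) : ∫ u : (Fin d → ℝ) × (Fin d → ℝ),
      avgVar (fun z => F z u.2 * H z u.1) a (3 * a) b (u.1 + u.2) =
      crossForm F H (2 * a) (7 * a / 2 + b) - crossForm F H (8 * a) (2 * a + b) := by
  have h1 := hF.integral_avgSq hH ha (b := b + 3 * a) (by positivity)
  have h2 := hF.integral_avgSq hH (a := a + 3 * a) (by positivity) hb
  rw [show 2 * (a + 3 * a) = 8 * a by ring, show (a + 3 * a) / 2 + b = 2 * a + b by ring] at h2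
  rw [show a / 2 + (b + 3 * a) = 7 * a / 2 + b by ring] at h1
  rw [← h1, ← h2, ← integral_sub (hF.integrable_avgSq hH ha (by positivity))
    (hF.integrable_avgSq hH (by positivity) hb)]
  refine integral_congr_ae (.of_forall fun u => ?_)
  exact avgVar_eq (hF.measurable_mul_slice hH _ _) (hF.integrable_mul_slice hH _ _)
    (fun z => hF.abs_mul_slice_le hH _ _ _) ha (by positivity) hb _

lemma crossForm_nonneg (hF : WeightedKernel κ F) (hH : WeightedKernel κ H) (ha : 0 < a)
    (hb : 0 < b) : 0 ≤ crossForm F H (2 * a) (a / 2 + b) := by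
  rw [← hF.integral_avgSq hH ha hb]
  exact integral_nonneg fun u => integral_nonneg fun c => mul_nonneg (gau_nonneg _ _) (sq_nonneg _)

/-- One scale of the telescoping estimate. -/
lemma integral_avgVar_le (hF : WeightedKernel κ F) (hH : WeightedKernel κ H) (ha : 0 < a)
    (hb : 0 < b) : ∫ u : (Fin d → ℝ) × (Fin d → ℝ),
      avgVar (fun z => F z u.2 * H z u.1) a (3 * a) b (u.1 + u.2) ≤
      (crossForm F H (2 * a) (a / 2 + b / 4) - crossForm F H (8 * a) (2 * a + b)) +
      ((boxForm F (2 * a) (a / 2 + b / 4) - boxForm F (8 * a) (2 * a + b)) +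
       (boxForm F (2 * a) (2 * a + b) - boxForm F (8 * a) (8 * a + 4 * b)) +
       (boxForm H (2 * a) (a / 2 + b / 4) - boxForm H (8 * a) (2 * a + b)) +
       (boxForm H (2 * a) (2 * a + b) - boxForm H (8 * a) (8 * a + 4 * b))) / 2 := by
  have h0 := hF.crossForm_sub_le hH (r := 2 * a) (v := a / 2 + b / 4) (v' := 7 * a / 2 + b)
    (by positivity) (by positivity) (by linarith)
  have key : ∀ {K : (Fin d → ℝ) → (Fin d → ℝ) → ℝ}, WeightedKernel κ K →
      boxForm K (8 * a) (8 * a + 4 * b) ≤ boxForm K (2 * a) (7 * a / 2 + b) ∧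
      boxForm K (8 * a) (2 * a + b) ≤ boxForm K (2 * a) (2 * a + b) := fun hK =>
    ⟨(hK.boxForm_anti_left (by positivity) (by linarith) (by positivity)).trans
      (hK.boxForm_anti_right (by positivity) (by positivity) (by linarith)),
      hK.boxForm_anti_left (by positivity) (by linarith) (by positivity)⟩
  rw [hF.integral_avgVar hH ha hb]
  linarith [(key hF).1, (key hF).2, (key hH).1, (key hH).2]

/-- The Gaussian variances of the corner products are summable over dyadic scales. -/
lemma sum_integral_avgVar_le (hF : WeightedKernel κ F) (hH : WeightedKernel κ H) (ha : 0 < a)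
    (hb : 0 < b) {M : ℝ} (hFM : ∫ t : (Fin d → ℝ) × (Fin d → ℝ), |F t.1 t.2| ≤ M)
    (hHM : ∫ t : (Fin d → ℝ) × (Fin d → ℝ), |H t.1 t.2| ≤ M) (n : ℕ) :
    ∑ l ∈ Finset.range n, ∫ u : (Fin d → ℝ) × (Fin d → ℝ),
      avgVar (fun z => F z u.2 * H z u.1) (4 ^ l * a) (3 * (4 ^ l * a)) (4 ^ l * b) (u.1 + u.2) ≤
      3 * M := by
  set X : ℕ → ℝ := fun l =>
    crossForm F H (2 * (4 ^ l * a)) (4 ^ l * a / 2 + 4 ^ l * b / 4) +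
      (boxForm F (2 * (4 ^ l * a)) (4 ^ l * a / 2 + 4 ^ l * b / 4) +
        boxForm F (2 * (4 ^ l * a)) (2 * (4 ^ l * a) + 4 ^ l * b) +
        boxForm H (2 * (4 ^ l * a)) (4 ^ l * a / 2 + 4 ^ l * b / 4) +
        boxForm H (2 * (4 ^ l * a)) (2 * (4 ^ l * a) + 4 ^ l * b)) / 2 with hX
  have hstep : ∀ l, ∫ u : (Fin d → ℝ) × (Fin d → ℝ),
      avgVar (fun z => F z u.2 * H z u.1) (4 ^ l * a) (3 * (4 ^ l * a)) (4 ^ l * b) (u.1 + u.2) ≤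
      X l - X (l + 1) := fun l => by
    refine (hF.integral_avgVar_le hH (a := 4 ^ l * a) (b := 4 ^ l * b) (by positivity)
      (by positivity)).trans (le_of_eq ?_)
    have e1 : 2 * (4 ^ (l + 1) * a) = 8 * (4 ^ l * a) := by ring
    have e2 : 4 ^ (l + 1) * a / 2 + 4 ^ (l + 1) * b / 4 = 2 * (4 ^ l * a) + 4 ^ l * b := by ring
    have e3 : 8 * (4 ^ l * a) + 4 ^ (l + 1) * b = 8 * (4 ^ l * a) + 4 * (4 ^ l * b) := by ring
    simp only [hX, e1, e2, e3]
    ring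
  have hXl : ∀ l, X l ≤ 3 * M := fun l => by
    have h1 := hF.crossForm_le hH (r := 2 * (4 ^ l * a)) (v := 4 ^ l * a / 2 + 4 ^ l * b / 4)
      (by positivity) (by positivity)
    have h2 := hF.boxForm_le (r := 2 * (4 ^ l * a)) (v := 4 ^ l * a / 2 + 4 ^ l * b / 4)
      (by positivity) (by positivity)
    have h3 := hH.boxForm_le (r := 2 * (4 ^ l * a)) (v := 4 ^ l * a / 2 + 4 ^ l * b / 4)
      (by positivity) (by positivity)
    have h4 := hF.boxForm_le (r := 2 * (4 ^ l * a)) (v := 2 * (4 ^ l * a) + 4 ^ l * b)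
      (by positivity) (by positivity)
    have h5 := hH.boxForm_le (r := 2 * (4 ^ l * a)) (v := 2 * (4 ^ l * a) + 4 ^ l * b)
      (by positivity) (by positivity)
    simp only [hX]
    linarith
  have hXn : 0 ≤ X n := by
    have h1 := hF.crossForm_nonneg hH (a := 4 ^ n * a) (b := 4 ^ n * b / 4) (by positivity)
      (by positivity)
    have h2 := hF.boxForm_nonneg (r := 2 * (4 ^ n * a)) (v := 4 ^ n * a / 2 + 4 ^ n * b / 4)
      (by positivity)
    have h3 := hH.boxForm_nonneg (r := 2 * (4 ^ n * a)) (v := 4 ^ n * a / 2 + 4 ^ n * b / 4)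
      (by positivity)
    have h4 := hF.boxForm_nonneg (r := 2 * (4 ^ n * a)) (v := 2 * (4 ^ n * a) + 4 ^ n * b)
      (by positivity)
    have h5 := hH.boxForm_nonneg (r := 2 * (4 ^ n * a)) (v := 2 * (4 ^ n * a) + 4 ^ n * b)
      (by positivity)
    simp only [hX]
    linarith
  calc _ ≤ ∑ l ∈ Finset.range n, (X l - X (l + 1)) := Finset.sum_le_sum fun l _ => hstep l
    _ = X 0 - X n := Finset.sum_range_sub' X n
    _ ≤ _ := by linarith [hXl 0]

end WeightedKernel

end Telescoping

lemma sq_integral_mul_le_s11 {α : Type*} [MeasurableSpace α] {μ : Measure α} {f g : α → ℝ}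
    (hfg : Integrable (fun x => f x * g x) μ) (hf : Integrable (fun x => f x ^ 2) μ)
    (hg : Integrable (fun x => g x ^ 2) μ) :
    (∫ x, f x * g x ∂μ) ^ 2 ≤ (∫ x, f x ^ 2 ∂μ) * ∫ x, g x ^ 2 ∂μ := by
  have h : ∀ t : ℝ, 0 ≤ (∫ x, g x ^ 2 ∂μ) * (t * t) + (-2 * ∫ x, f x * g x ∂μ) * t +
      ∫ x, f x ^ 2 ∂μ := fun t => by
    have e : ∫ x, (f x - t * g x) ^ 2 ∂μ = (∫ x, g x ^ 2 ∂μ) * (t * t) +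
        (-2 * ∫ x, f x * g x ∂μ) * t + ∫ x, f x ^ 2 ∂μ := by
      rw [← integral_mul_const, ← integral_const_mul, ← integral_mul_const,
        ← integral_add (hg.mul_const _) ((hfg.const_mul _).mul_const _),
        ← integral_add (by exact (hg.mul_const _).add ((hfg.const_mul _).mul_const _)) hf]
      refine integral_congr_ae (.of_forall fun x => ?_)
      simp only
      ring
    rw [← e]
    exact integral_nonneg fun x => sq_nonneg _
  have := discrim_le_zero h
  rw [discrim] at this
  linarith

section TestKernel

variable {d : ℕ}

/-- Mean-zero kernels supported in the ball of radius `√B`, bounded by `√L` and with Lipschitz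
constant `√L`, both with respect to the Euclidean norm. -/
structure IsTestKernel (L B : ℝ) (k : (Fin d → ℝ) → ℝ) : Prop where
  continuous : Continuous k
  sq_le : ∀ x, k x ^ 2 ≤ L
  sq_sub_le : ∀ x y, (k x - k y) ^ 2 ≤ L * ∑ i, (x - y) i ^ 2
  eq_zero : ∀ x, B < ∑ i, x i ^ 2 → k x = 0
  integral_eq_zero : ∫ x, k x = 0

lemma exp_neg_eq_gau {v : ℝ} (hv : 0 < v) (x : Fin d → ℝ) :
    Real.exp (-(Real.pi / v) * ∑ i, x i ^ 2) = √v ^ d * gau v x := by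
  rw [gau_eq, ← mul_assoc, ← mul_pow, mul_inv_cancel₀ (by positivity), one_pow, one_mul]

lemma sum_sq_sub_le (x y : Fin d → ℝ) :
    ∑ i, (x - y) i ^ 2 ≤ 2 * ∑ i, x i ^ 2 + 2 * ∑ i, y i ^ 2 := by
  rw [Finset.mul_sum, Finset.mul_sum, ← Finset.sum_add_distrib]
  refine Finset.sum_le_sum fun i _ => ?_
  simp only [Pi.sub_apply]
  nlinarith [sq_nonneg (x i + y i)]

lemma sum_sq_nonneg (x : Fin d → ℝ) : 0 ≤ ∑ i, x i ^ 2 := Finset.sum_nonneg fun _ _ => sq_nonneg _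

/-- Absorbing a quadratic factor in a Gaussian. -/
lemma sum_sq_mul_exp_le {v : ℝ} (hv : 0 < v) (x : Fin d → ℝ) :
    (∑ i, x i ^ 2) * Real.exp (-(Real.pi / v) * ∑ i, x i ^ 2) ≤
      2 * v * (√(2 * v) ^ d * gau (2 * v) x) := by
  rw [← exp_neg_eq_gau (by positivity)]
  set n := ∑ i, x i ^ 2
  have hπ := Real.pi_gt_three
  have h1 : n ≤ 2 * v * Real.exp (Real.pi / (2 * v) * n) := by
    have h2 : n = 2 * v / Real.pi * (Real.pi / (2 * v) * n) := by field_simp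
    have h3 : Real.pi / (2 * v) * n ≤ Real.exp (Real.pi / (2 * v) * n) := by
      linarith [Real.add_one_le_exp (Real.pi / (2 * v) * n)]
    have h4 : 2 * v / Real.pi ≤ 2 * v := div_le_self (by positivity) (by linarith)
    calc n = 2 * v / Real.pi * (Real.pi / (2 * v) * n) := h2
      _ ≤ 2 * v / Real.pi * Real.exp (Real.pi / (2 * v) * n) := by gcongr
      _ ≤ _ := by gcongr
  calc n * Real.exp (-(Real.pi / v) * n) ≤
      2 * v * Real.exp (Real.pi / (2 * v) * n) * Real.exp (-(Real.pi / v) * n) := by gcongr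
    _ = 2 * v * Real.exp (-(Real.pi / (2 * v)) * n) := by
      rw [mul_assoc, ← Real.exp_add]
      congr 2
      field_simp
      ring

variable {L B : ℝ} {k φ : (Fin d → ℝ) → ℝ} {a : ℝ}

namespace IsTestKernel

lemma nonneg (hk : IsTestKernel L B k) : 0 ≤ L := (sq_nonneg _).trans (hk.sq_le 0)

lemma measurable (hk : IsTestKernel L B k) : Measurable k := hk.continuous.measurable

lemma abs_le (hk : IsTestKernel L B k) (x : Fin d → ℝ) : |k x| ≤ √L := Real.abs_le_sqrt (hk.sq_le x)

lemma sq_le_gau (hk : IsTestKernel L B k) (x : Fin d → ℝ) :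
    k x ^ 2 ≤ L * Real.exp (Real.pi * B) * gau 1 x := by
  by_cases h : B < ∑ i, x i ^ 2
  · rw [hk.eq_zero x h, zero_pow two_ne_zero]
    exact mul_nonneg (mul_nonneg hk.nonneg (Real.exp_pos _).le) (gau_nonneg _ _)
  · have : 1 ≤ Real.exp (Real.pi * B) * gau 1 x := by
      rw [gau_eq, Real.sqrt_one, inv_one, one_pow, one_mul, ← Real.exp_add, Real.one_le_exp_iff]
      nlinarith [Real.pi_pos, not_lt.mp h]
    rw [mul_assoc]
    exact (hk.sq_le x).trans (le_mul_of_one_le_right hk.nonneg this)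

lemma abs_le_gau (hk : IsTestKernel L B k) (x : Fin d → ℝ) :
    |k x| ≤ √L * Real.exp (Real.pi * B) * gau 1 x := by
  by_cases h : B < ∑ i, x i ^ 2
  · rw [hk.eq_zero x h, abs_zero]
    exact mul_nonneg (by positivity) (gau_nonneg _ _)
  · have : 1 ≤ Real.exp (Real.pi * B) * gau 1 x := by
      rw [gau_eq, Real.sqrt_one, inv_one, one_pow, one_mul, ← Real.exp_add, Real.one_le_exp_iff]
      nlinarith [Real.pi_pos, not_lt.mp h]
    rw [mul_assoc]
    exact (hk.abs_le x).trans (le_mul_of_one_le_right (by positivity) this)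

lemma integrable (hk : IsTestKernel L B k) : Integrable k :=
  ((integrable_gau one_pos).const_mul _).mono' hk.measurable.aestronglyMeasurable
    (.of_forall hk.abs_le_gau)

end IsTestKernel

/-- The pairing of a test kernel with Gaussian averages. -/
noncomputable def avgPairing (k φ : (Fin d → ℝ) → ℝ) (a : ℝ) : ℝ := ∫ c, k c * gaussAvg φ a c

lemma integrable_gau_mul_gau_sub {b r : ℝ} (hb : 0 < b) (hr : 0 < r) :
    Integrable fun t : (Fin d → ℝ) × (Fin d → ℝ) => gau b t.1 * gau r (t.1 - t.2) :=
  Integrable.mul_gau_sub (integrable_gau hb) measurable_id hr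

lemma integral_gau_mul_gau_sub {b r : ℝ} (hb : 0 < b) (hr : 0 < r) :
    ∫ t : (Fin d → ℝ) × (Fin d → ℝ), gau b t.1 * gau r (t.1 - t.2) = 1 := by
  refine (integral_prod _ (integrable_gau_mul_gau_sub hb hr)).trans ?_
  simp only
  simp_rw [integral_const_mul, integral_sub_left_eq_self (gau r), integral_gau hr, mul_one,
    integral_gau hb]

lemma avgVar_zero_eq (hm : Measurable φ) (hb : ∀ z, |φ z| ≤ 1) {a r b : ℝ} (ha : 0 < a)
    (hr : 0 < r) (hb' : 0 < b) :
    Integrable (fun t : (Fin d → ℝ) × (Fin d → ℝ) => gau b t.1 * gau r (t.1 - t.2) *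
      (gaussAvg φ a t.2 - gaussAvg φ (a + r) t.1) ^ 2) ∧
    avgVar φ a r b 0 = ∫ t : (Fin d → ℝ) × (Fin d → ℝ), gau b t.1 * gau r (t.1 - t.2) *
      (gaussAvg φ a t.2 - gaussAvg φ (a + r) t.1) ^ 2 := by
  have hi : Integrable (fun t : (Fin d → ℝ) × (Fin d → ℝ) => gau b t.1 * gau r (t.1 - t.2) *
      (gaussAvg φ a t.2 - gaussAvg φ (a + r) t.1) ^ 2) := by
    have m1 := measurable_gaussAvg hm a
    have m2 := measurable_gaussAvg hm (a + r)
    refine (integrable_gau_mul_gau_sub hb' hr).mul_bdd (c := 4)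
      (Measurable.aestronglyMeasurable (by fun_prop)) (.of_forall fun t => ?_)
    have h1 := abs_le.mp (abs_gaussAvg_le hb ha t.2)
    have h2 := abs_le.mp (abs_gaussAvg_le hb (add_pos ha hr) t.1)
    rw [Real.norm_of_nonneg (sq_nonneg _)]
    nlinarith
  refine ⟨hi, ((integral_prod _ hi).trans (integral_congr_ae (.of_forall fun c => ?_))).symm⟩
  simp only [mul_assoc]
  rw [integral_const_mul, sub_zero, ← integral_add_left_eq_self _ c]
  congr 1
  refine integral_congr_ae (.of_forall fun q => ?_)
  simp only [sub_add_cancel_left, gau_neg]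

/-- Cauchy–Schwarz against the Gaussian variance. -/
lemma sq_integral_mul_sub_le (hm : Measurable φ) (hb : ∀ z, |φ z| ≤ 1) {a r b : ℝ} (ha : 0 < a)
    (hr : 0 < r) (hb' : 0 < b) {G P : (Fin d → ℝ) × (Fin d → ℝ) → ℝ} (hG : Measurable G)
    (hP : Integrable P) (hGP : ∀ t, G t ^ 2 ≤ gau b t.1 * gau r (t.1 - t.2) * P t) :
    (∫ t : (Fin d → ℝ) × (Fin d → ℝ), G t * (gaussAvg φ a t.2 - gaussAvg φ (a + r) t.1)) ^ 2 ≤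
      (∫ t, P t) * avgVar φ a r b 0 := by
  obtain ⟨hi, he⟩ := avgVar_zero_eq hm hb ha hr hb'
  have m1 := measurable_gaussAvg hm a
  have m2 := measurable_gaussAvg hm (a + r)
  set w : (Fin d → ℝ) × (Fin d → ℝ) → ℝ := fun t => gau b t.1 * gau r (t.1 - t.2) with hw
  have hwm : Measurable w := by fun_prop
  have hw0 : ∀ t, 0 < w t := fun t => mul_pos (gau_pos hb' _) (gau_pos hr _)
  set D : (Fin d → ℝ) × (Fin d → ℝ) → ℝ :=
    fun t => gaussAvg φ a t.2 - gaussAvg φ (a + r) t.1 with hD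
  have hDm : Measurable D := by fun_prop
  have e1 : ∀ t, (G t / √(w t)) ^ 2 = G t ^ 2 / w t := fun t => by
    rw [div_pow, Real.sq_sqrt (hw0 t).le]
  have e2 : ∀ t, (√(w t) * D t) ^ 2 = w t * D t ^ 2 := fun t => by
    rw [mul_pow, Real.sq_sqrt (hw0 t).le]
  have e3 : ∀ t, G t / √(w t) * (√(w t) * D t) = G t * D t := fun t => by
    have := Real.sqrt_pos.mpr (hw0 t)
    field_simp
  have hle : ∀ t, G t ^ 2 / w t ≤ P t := fun t => by
    rw [div_le_iff₀ (hw0 t), mul_comm]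
    exact hGP t
  have hPi : Integrable fun t => G t ^ 2 / w t :=
    hP.mono' (Measurable.aestronglyMeasurable (by fun_prop)) (.of_forall fun t => by
      rw [Real.norm_of_nonneg (div_nonneg (sq_nonneg _) (hw0 t).le)]
      exact hle t)
  have hGD : Integrable fun t => G t * D t := by
    refine (hPi.add hi).mono' (Measurable.aestronglyMeasurable (by fun_prop))
      (.of_forall fun t => ?_)
    rw [← e3, Real.norm_eq_abs, abs_mul]
    simp only [Pi.add_apply]
    rw [← e1, show gau b t.1 * gau r (t.1 - t.2) *
      (gaussAvg φ a t.2 - gaussAvg φ (a + r) t.1) ^ 2 = (√(w t) * D t) ^ 2 from (e2 t).symm]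
    rw [← sq_abs, ← sq_abs (√(w t) * D t)]
    nlinarith [sq_nonneg (|G t / √(w t)| - |√(w t) * D t|), sq_nonneg (|G t / √(w t)| + |√(w t) * D t|)]
  have h := sq_integral_mul_le_s11 (μ := volume) (f := fun t => G t / √(w t)) (g := fun t => √(w t) * D t)
    (by simpa only [e3] using hGD) (by simpa only [e1] using hPi) (by simpa only [e2] using hi)
  simp only [e1, e2, e3] at h
  rw [he]
  refine h.trans (mul_le_mul_of_nonneg_right (integral_mono hPi hP hle) ?_)
  exact integral_nonneg fun t => mul_nonneg (hw0 t).le (sq_nonneg _)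

end TestKernel

section TestKernelBounds

variable {d : ℕ} {L B : ℝ} {k φ : (Fin d → ℝ) → ℝ} {a r : ℝ}

lemma integral_mul_gau_sub {h : (Fin d → ℝ) → ℝ} (hh : Integrable h) (hr : 0 < r) :
    ∫ t : (Fin d → ℝ) × (Fin d → ℝ), h t.1 * gau r (t.1 - t.2) = ∫ c, h c := by
  refine (integral_prod _ (Integrable.mul_gau_sub hh measurable_id hr)).trans
    (integral_congr_ae (.of_forall fun c => ?_))
  simp only [id]
  rw [integral_const_mul, integral_sub_left_eq_self (gau r), integral_gau hr, mul_one]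

lemma integrable_mul_gaussAvg_mul_gau_sub {h : (Fin d → ℝ) → ℝ} (hh : Integrable h)
    (hm : Measurable φ) (hb : ∀ z, |φ z| ≤ 1) (ha : 0 < a) (hr : 0 < r) :
    Integrable fun t : (Fin d → ℝ) × (Fin d → ℝ) =>
      h t.1 * gau r (t.1 - t.2) * gaussAvg φ a t.2 := by
  have m1 := measurable_gaussAvg hm a
  exact (Integrable.mul_gau_sub hh measurable_id hr).mul_bdd (c := 1)
    (Measurable.aestronglyMeasurable (by fun_prop)) (.of_forall fun t => abs_gaussAvg_le hb ha _)

lemma integral_mul_gaussAvg_mul_gau_sub {h : (Fin d → ℝ) → ℝ} (hh : Integrable h)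
    (hm : Measurable φ) (hφ : Integrable φ) (hb : ∀ z, |φ z| ≤ 1) (ha : 0 < a) (hr : 0 < r) :
    ∫ t : (Fin d → ℝ) × (Fin d → ℝ), h t.1 * gau r (t.1 - t.2) * gaussAvg φ a t.2 =
      avgPairing h φ (a + r) := by
  refine (integral_prod _ (integrable_mul_gaussAvg_mul_gau_sub hh hm hb ha hr)).trans
    (integral_congr_ae (.of_forall fun c => ?_))
  simp only [mul_assoc]
  rw [integral_const_mul, gaussAvg_add hφ ha hr, ← integral_add_left_eq_self _ c]
  simp only [sub_add_cancel_left, gau_neg]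

namespace IsTestKernel

lemma integrable_mul_gaussAvg (hk : IsTestKernel L B k) (hm : Measurable φ)
    (hb : ∀ z, |φ z| ≤ 1) (ha : 0 < a) : Integrable fun c => k c * gaussAvg φ a c :=
  hk.integrable.mul_bdd (c := 1) (measurable_gaussAvg hm a).aestronglyMeasurable
    (.of_forall fun _ => abs_gaussAvg_le hb ha _)

lemma avgPairing_eq (hk : IsTestKernel L B k) (hm : Measurable φ) (hb : ∀ z, |φ z| ≤ 1)
    (ha : 0 < a) (hr : 0 < r) :
    ∫ t : (Fin d → ℝ) × (Fin d → ℝ), gau 1 t.1 * k t.2 *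
      (gaussAvg φ a t.2 - gaussAvg φ (a + r) t.1) = avgPairing k φ a := by
  have i1 := (integrable_gau (d := d) one_pos).mul_prod (hk.integrable_mul_gaussAvg hm hb ha)
  have i2 := (integrable_gau_mul_of_abs_le (r := 1) (measurable_gaussAvg hm (a + r))
    (abs_gaussAvg_le hb (add_pos ha hr)) one_pos).mul_prod hk.integrable
  calc _ = ∫ t : (Fin d → ℝ) × (Fin d → ℝ), (gau 1 t.1 * (k t.2 * gaussAvg φ a t.2) -
        gau 1 t.1 * gaussAvg φ (a + r) t.1 * k t.2) :=
        integral_congr_ae (.of_forall fun t => by simp only; ring)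
    _ = _ := integral_sub i1 i2
    _ = _ := by
      have e1 := integral_prod_mul (μ := (volume : Measure (Fin d → ℝ)))
        (ν := (volume : Measure (Fin d → ℝ))) (gau 1) (fun p => k p * gaussAvg φ a p)
      have e2 := integral_prod_mul (μ := (volume : Measure (Fin d → ℝ)))
        (ν := (volume : Measure (Fin d → ℝ))) (fun c => gau 1 c * gaussAvg φ (a + r) c) k
      rw [integral_gau one_pos, one_mul] at e1
      rw [hk.integral_eq_zero, mul_zero] at e2
      rw [avgPairing, ← e1]
      refine (congrArg _ e2).trans (sub_zero _)

lemma avgPairing_sub_eq (hk : IsTestKernel L B k) (hm : Measurable φ) (hφ : Integrable φ)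
    (hb : ∀ z, |φ z| ≤ 1) (ha : 0 < a) (hr : 0 < r) :
    ∫ t : (Fin d → ℝ) × (Fin d → ℝ), gau r (t.1 - t.2) * (k t.2 - k t.1) *
      (gaussAvg φ a t.2 - gaussAvg φ (a + r) t.1) =
      avgPairing k φ a - avgPairing k φ (a + r + r) := by
  have har := add_pos ha hr
  have j1 := Integrable.mul_gau_sub (hk.integrable_mul_gaussAvg hm hb ha) measurable_id hr
  have j2 := integrable_mul_gaussAvg_mul_gau_sub hk.integrable hm hb har hr
  have i1 := j1.swap
  have i2 := j2.swap
  have i3 := integrable_mul_gaussAvg_mul_gau_sub hk.integrable hm hb ha hr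
  have i4 := Integrable.mul_gau_sub (hk.integrable_mul_gaussAvg hm hb har) measurable_id hr
  have e1 := (integral_prod_swap (μ := (volume : Measure (Fin d → ℝ)))
    (ν := (volume : Measure (Fin d → ℝ)))
    (fun t => k t.1 * gaussAvg φ a t.1 * gau r (t.1 - t.2))).trans
    (integral_mul_gau_sub (hk.integrable_mul_gaussAvg hm hb ha) hr)
  have e2 := (integral_prod_swap (μ := (volume : Measure (Fin d → ℝ)))
    (ν := (volume : Measure (Fin d → ℝ)))
    (fun t => k t.1 * gau r (t.1 - t.2) * gaussAvg φ (a + r) t.2)).trans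
    (integral_mul_gaussAvg_mul_gau_sub hk.integrable hm hφ hb har hr)
  have e3 := integral_mul_gaussAvg_mul_gau_sub hk.integrable hm hφ hb ha hr
  have e4 := integral_mul_gau_sub (hk.integrable_mul_gaussAvg hm hb har) hr
  have key := (integral_sub (by exact i1.sub i2) (by exact i3.sub i4)).trans
    (congrArg₂ _ (integral_sub i1 i2) (integral_sub i3 i4))
  refine Eq.trans (integral_congr_ae (.of_forall fun t => ?_)) (key.trans ?_)
  · simp only [Function.comp, Prod.fst_swap, Prod.snd_swap, id, gau_sub_comm r t.2 t.1]
    ring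
  · calc _ = (avgPairing k φ a - avgPairing k φ (a + r + r)) -
          (avgPairing k φ (a + r) - avgPairing k φ (a + r)) :=
          congrArg₂ _ (congrArg₂ _ e1 e2) (congrArg₂ _ e3 e4)
      _ = _ := by ring

lemma sq_avgPairing_le (hk : IsTestKernel L B k) (hm : Measurable φ) (hb : ∀ z, |φ z| ≤ 1) :
    avgPairing k φ 1 ^ 2 ≤ (√3 ^ d * √3 ^ d * Real.exp (2 * Real.pi / 3 * B) *
      (L * Real.exp (Real.pi * B))) * avgVar φ 1 3 1 0 := by
  set C := √3 ^ d * √3 ^ d * Real.exp (2 * Real.pi / 3 * B) * (L * Real.exp (Real.pi * B)) with hC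
  have hkm := hk.measurable
  have hL := hk.nonneg
  have hPi : Integrable fun t : (Fin d → ℝ) × (Fin d → ℝ) => C * (gau 3 t.1 * gau 1 t.2) :=
    ((integrable_gau three_pos).mul_prod (integrable_gau one_pos)).const_mul _
  have hP1 : ∫ t : (Fin d → ℝ) × (Fin d → ℝ), C * (gau 3 t.1 * gau 1 t.2) = C := by
    rw [integral_const_mul]
    have := integral_prod_mul (μ := (volume : Measure (Fin d → ℝ)))
        (ν := (volume : Measure (Fin d → ℝ))) (gau 3) (gau 1)
    rw [integral_gau one_pos, integral_gau three_pos, mul_one] at this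
    exact (congrArg _ this).trans (mul_one _)
  have h := sq_integral_mul_sub_le hm hb one_pos three_pos one_pos
    (G := fun t => gau 1 t.1 * k t.2) (by fun_prop) hPi fun t => ?_
  · rwa [hk.avgPairing_eq hm hb one_pos three_pos, hP1] at h
  have hmain : gau 1 t.1 * k t.2 ^ 2 ≤ gau 3 (t.1 - t.2) * (C * (gau 3 t.1 * gau 1 t.2)) := by
    by_cases hB : B < ∑ i, t.2 i ^ 2
    · rw [hk.eq_zero _ hB, zero_pow two_ne_zero, mul_zero]
      exact mul_nonneg (gau_nonneg _ _) (mul_nonneg (by positivity)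
        (mul_nonneg (gau_nonneg _ _) (gau_nonneg _ _)))
    have h1 : gau 1 t.1 ≤ (√3 ^ d * gau 3 t.1) * ((√3 ^ d * gau 3 (t.1 - t.2)) *
        Real.exp (2 * Real.pi / 3 * B)) := by
      rw [← exp_neg_eq_gau three_pos, ← exp_neg_eq_gau three_pos, gau_eq, Real.sqrt_one, inv_one,
        one_pow, one_mul, ← Real.exp_add, ← Real.exp_add, Real.exp_le_exp]
      nlinarith [sum_sq_sub_le t.1 t.2, Real.pi_pos, not_lt.mp hB]
    refine (mul_le_mul h1 (hk.sq_le_gau t.2) (sq_nonneg _) ?_).trans (le_of_eq ?_)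
    · exact mul_nonneg (mul_nonneg (by positivity) (gau_nonneg _ _)) (mul_nonneg
        (mul_nonneg (by positivity) (gau_nonneg _ _)) (by positivity))
    · rw [hC]
      ring
  calc (gau 1 t.1 * k t.2) ^ 2 = gau 1 t.1 * (gau 1 t.1 * k t.2 ^ 2) := by ring
    _ ≤ _ := by
      rw [mul_assoc]
      exact mul_le_mul_of_nonneg_left hmain (gau_nonneg _ _)

lemma sq_avgPairing_sub_le (hk : IsTestKernel L B k) (hm : Measurable φ) (hφ : Integrable φ)
    (hb : ∀ z, |φ z| ≤ 1) (ha : 0 < a) (ha' : a ≤ 1 / 7) :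
    (avgPairing k φ a - avgPairing k φ (7 * a)) ^ 2 ≤
      (L * Real.exp (13 * Real.pi / 6 * B) * 84 * √28 ^ d * √12 ^ d) * a *
        avgVar φ a (3 * a) 1 0 := by
  set C := L * Real.exp (13 * Real.pi / 6 * B) * 84 * √28 ^ d * √12 ^ d with hC
  have hkm := hk.measurable
  have hL := hk.nonneg
  have h3a : 0 < 3 * a := by positivity
  have hPi : Integrable fun t : (Fin d → ℝ) × (Fin d → ℝ) =>
      C * a * (gau 12 t.1 * gau (84 * a) (t.1 - t.2)) :=
    (integrable_gau_mul_gau_sub (by norm_num) (by positivity)).const_mul _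
  have hP1 : ∫ t : (Fin d → ℝ) × (Fin d → ℝ),
      C * a * (gau 12 t.1 * gau (84 * a) (t.1 - t.2)) = C * a := by
    rw [integral_const_mul, integral_gau_mul_gau_sub (by norm_num) (by positivity), mul_one]
  have h := sq_integral_mul_sub_le hm hb ha h3a one_pos
    (G := fun t => gau (3 * a) (t.1 - t.2) * (k t.2 - k t.1)) (by fun_prop) hPi fun t => ?_
  · rwa [hk.avgPairing_sub_eq hm hφ hb ha h3a, hP1, show a + 3 * a + 3 * a = 7 * a by ring] at h
  have hmain : gau (3 * a) (t.1 - t.2) * (k t.2 - k t.1) ^ 2 ≤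
      gau 1 t.1 * (C * a * (gau 12 t.1 * gau (84 * a) (t.1 - t.2))) := by
    by_cases h0 : k t.2 - k t.1 = 0
    · rw [h0, zero_pow two_ne_zero, mul_zero]
      exact mul_nonneg (gau_nonneg _ _) (mul_nonneg (by positivity)
        (mul_nonneg (gau_nonneg _ _) (gau_nonneg _ _)))
    have hn : ∑ i, t.1 i ^ 2 ≤ 2 * ∑ i, (t.1 - t.2) i ^ 2 + 2 * B := by
      by_cases h1 : B < ∑ i, t.1 i ^ 2
      · have h2 : ∑ i, t.2 i ^ 2 ≤ B := by
          by_contra! h2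
          rw [hk.eq_zero _ h1, hk.eq_zero _ h2, sub_zero] at h0
          exact h0 rfl
        have h3 := sum_sq_sub_le (t.1 - t.2) (-t.2)
        simp only [sub_neg_eq_add, sub_add_cancel, Pi.neg_apply, neg_sq] at h3
        linarith
      · linarith [sum_sq_nonneg (t.1 - t.2), sum_sq_nonneg t.1, not_lt.mp h1]
    have hs : √(84 * a) = √28 * √(3 * a) := by
      rw [← Real.sqrt_mul (by norm_num)]
      congr 1
      ring
    have hk2 : (k t.2 - k t.1) ^ 2 ≤ L * ∑ i, (t.1 - t.2) i ^ 2 := by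
      rw [← neg_sub, neg_sq]
      exact hk.sq_sub_le _ _
    set n := ∑ i, (t.1 - t.2) i ^ 2 with hn'
    have hn0 : 0 ≤ n := sum_sq_nonneg _
    have hexp : Real.exp (-(Real.pi / (3 * a)) * n) ≤ Real.exp (-(Real.pi / (42 * a)) * n) *
        (Real.exp (13 * Real.pi / 6 * B) * (gau 1 t.1 * (√12 ^ d * gau 12 t.1))) := by
      rw [← exp_neg_eq_gau (by norm_num), gau_eq, Real.sqrt_one, inv_one, one_pow, one_mul,
        ← Real.exp_add, ← Real.exp_add, ← Real.exp_add, Real.exp_le_exp]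
      have h7 : 7 ≤ a⁻¹ := by
        rw [le_inv_comm₀ (by norm_num) ha]
        linarith
      have e1 : Real.pi / (3 * a) = Real.pi * a⁻¹ / 3 := by field_simp
      have e2 : Real.pi / (42 * a) = Real.pi * a⁻¹ / 42 := by field_simp
      rw [e1, e2]
      have h8 : Real.pi * (7 * n) ≤ Real.pi * (a⁻¹ * n) := by gcongr
      have h9 := mul_le_mul_of_nonneg_left hn Real.pi_pos.le
      nlinarith
    have hq := sum_sq_mul_exp_le (v := 42 * a) (by positivity) (t.1 - t.2)
    rw [← hn', show 2 * (42 * a) = 84 * a by ring] at hq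
    have hW : 0 ≤ Real.exp (13 * Real.pi / 6 * B) * (gau 1 t.1 * (√12 ^ d * gau 12 t.1)) :=
      mul_nonneg (by positivity) (mul_nonneg (gau_nonneg _ _)
        (mul_nonneg (by positivity) (gau_nonneg _ _)))
    set W := Real.exp (13 * Real.pi / 6 * B) * (gau 1 t.1 * (√12 ^ d * gau 12 t.1)) with hWdef
    have hs0 : 0 < √(3 * a) := Real.sqrt_pos.mpr h3a
    calc gau (3 * a) (t.1 - t.2) * (k t.2 - k t.1) ^ 2
        ≤ gau (3 * a) (t.1 - t.2) * (L * n) := mul_le_mul_of_nonneg_left hk2 (gau_nonneg _ _)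
      _ = ((√(3 * a))⁻¹) ^ d * Real.exp (-(Real.pi / (3 * a)) * n) * (L * n) := by rw [gau_eq]
      _ ≤ ((√(3 * a))⁻¹) ^ d * (Real.exp (-(Real.pi / (42 * a)) * n) * W) * (L * n) := by gcongr
      _ = ((√(3 * a))⁻¹) ^ d * L * W * (n * Real.exp (-(Real.pi / (42 * a)) * n)) := by ring
      _ ≤ ((√(3 * a))⁻¹) ^ d * L * W * (84 * a * (√(84 * a) ^ d * gau (84 * a) (t.1 - t.2))) :=
        mul_le_mul_of_nonneg_left hq (by positivity)
      _ = _ := by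
        rw [hs, hWdef, hC, inv_pow, mul_pow]
        field_simp
  calc (gau (3 * a) (t.1 - t.2) * (k t.2 - k t.1)) ^ 2 =
      gau (3 * a) (t.1 - t.2) * (gau (3 * a) (t.1 - t.2) * (k t.2 - k t.1) ^ 2) := by ring
    _ ≤ gau (3 * a) (t.1 - t.2) * (gau 1 t.1 * (C * a * (gau 12 t.1 * gau (84 * a) (t.1 - t.2)))) :=
      mul_le_mul_of_nonneg_left hmain (gau_nonneg _ _)
    _ = _ := by ring

end IsTestKernel

end TestKernelBounds

section TestKernelPairing

variable {d : ℕ} {L B : ℝ} {k φ : (Fin d → ℝ) → ℝ} {a r : ℝ}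

namespace IsTestKernel

lemma abs_avgPairing_sub_integral_le (hk : IsTestKernel L B k) (hφ : Integrable φ) (ha : 0 < a) :
    |avgPairing k φ a - ∫ z, φ z * k z| ≤ √a * (1 + 2 * L * √2 ^ d) * ∫ z, |φ z| := by
  have hkm := hk.measurable
  have hL := hk.nonneg
  have hφk : Integrable fun z => φ z * k z :=
    hφ.mul_bdd hkm.aestronglyMeasurable (.of_forall hk.abs_le)
  have i1 : Integrable (fun t : (Fin d → ℝ) × (Fin d → ℝ) => φ t.1 * gau a (t.1 - t.2) * k t.2)
      (volume.prod volume) :=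
    (Integrable.mul_gau_sub hφ measurable_id ha).mul_bdd
      (Measurable.aestronglyMeasurable (by fun_prop)) (.of_forall fun t => hk.abs_le t.2)
  have i2 := Integrable.mul_gau_sub hφk measurable_id ha
  have e1 : ∫ t : (Fin d → ℝ) × (Fin d → ℝ), φ t.1 * gau a (t.1 - t.2) * k t.2 =
      avgPairing k φ a := by
    refine (integral_prod_symm _ i1).trans (integral_congr_ae (.of_forall fun c => ?_))
    simp only
    rw [integral_mul_const, mul_comm, gaussAvg]
  have e2 := integral_mul_gau_sub hφk ha
  have e3 : ∫ t : (Fin d → ℝ) × (Fin d → ℝ),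
      φ t.1 * gau a (t.1 - t.2) * (k t.2 - k t.1) = avgPairing k φ a - ∫ z, φ z * k z := by
    rw [← e1, ← e2]
    refine Eq.trans (integral_congr_ae (.of_forall fun t => ?_)) (integral_sub i1 i2)
    simp only
    ring
  have j1 := (Integrable.mul_gau_sub hφ.abs measurable_id ha).const_mul √a
  have j2 := (Integrable.mul_gau_sub hφ.abs measurable_id
    (a := 2 * a) (by positivity)).const_mul (√a * (2 * L * √2 ^ d))
  have e4 : √a * (1 + 2 * L * √2 ^ d) * ∫ z, |φ z| = ∫ t : (Fin d → ℝ) × (Fin d → ℝ),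
      (√a * (|φ t.1| * gau a (t.1 - t.2)) +
        √a * (2 * L * √2 ^ d) * (|φ t.1| * gau (2 * a) (t.1 - t.2))) := by
    refine Eq.trans ?_ (integral_add j1 j2).symm
    rw [integral_const_mul, integral_const_mul]
    have e5 := integral_mul_gau_sub hφ.abs ha
    have e6 := integral_mul_gau_sub hφ.abs (r := 2 * a) (by positivity)
    calc _ = √a * (∫ z, |φ z|) + √a * (2 * L * √2 ^ d) * ∫ z, |φ z| := by ring
      _ = _ := congrArg₂ _ (congrArg _ e5.symm) (congrArg _ e6.symm)
  rw [← e3, e4, ← Real.norm_eq_abs]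
  refine norm_integral_le_of_norm_le (j1.add j2) (.of_forall fun t => ?_)
  have hsa : 0 < √a := Real.sqrt_pos.mpr ha
  have hsq : √a * √a = a := Real.mul_self_sqrt ha.le
  set n := ∑ i, (t.1 - t.2) i ^ 2 with hn
  have h1 : |k t.2 - k t.1| ≤ √a + (√a)⁻¹ * (L * n) := by
    have h2 : (k t.2 - k t.1) ^ 2 ≤ L * n := by
      rw [← neg_sub, neg_sq]
      exact hk.sq_sub_le _ _
    rw [← sq_abs] at h2
    have h3 : |k t.2 - k t.1| ≤ √a + (√a)⁻¹ * |k t.2 - k t.1| ^ 2 := by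
      rw [← mul_le_mul_iff_right₀ hsa, mul_add, mul_inv_cancel_left₀ hsa.ne']
      nlinarith [sq_nonneg (√a - |k t.2 - k t.1|), sq_nonneg (√a), sq_nonneg |k t.2 - k t.1|]
    refine h3.trans ?_
    gcongr
  have hq : gau a (t.1 - t.2) * n ≤ 2 * a * √2 ^ d * gau (2 * a) (t.1 - t.2) := by
    have h := sum_sq_mul_exp_le ha (t.1 - t.2)
    rw [← hn, Real.sqrt_mul (by norm_num)] at h
    rw [gau_eq a, ← hn]
    calc _ = ((√a)⁻¹) ^ d * (n * Real.exp (-(Real.pi / a) * n)) := by ring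
      _ ≤ ((√a)⁻¹) ^ d * (2 * a * ((√2 * √a) ^ d * gau (2 * a) (t.1 - t.2))) := by gcongr
      _ = _ := by
        rw [inv_pow, mul_pow]
        field_simp
  rw [norm_mul, norm_mul, Real.norm_of_nonneg (gau_nonneg _ _)]
  calc _ ≤ |φ t.1| * gau a (t.1 - t.2) * (√a + (√a)⁻¹ * (L * n)) :=
        mul_le_mul_of_nonneg_left h1 (mul_nonneg (abs_nonneg _) (gau_nonneg _ _))
    _ = √a * (|φ t.1| * gau a (t.1 - t.2)) +
        |φ t.1| * (√a)⁻¹ * L * (gau a (t.1 - t.2) * n) := by ring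
    _ ≤ √a * (|φ t.1| * gau a (t.1 - t.2)) +
        |φ t.1| * (√a)⁻¹ * L * (2 * a * √2 ^ d * gau (2 * a) (t.1 - t.2)) := by gcongr
    _ = _ := by
      rw [show (√a)⁻¹ = √a * a⁻¹ by nth_rewrite 3 [← hsq]; field_simp]
      field_simp

end IsTestKernel

/-- The pairing with a test kernel is controlled by Gaussian variances at geometric scales. -/
lemma exists_sq_integral_mul_le (d : ℕ) {L : ℝ} (hL : 0 ≤ L) (B : ℝ) :
    ∃ C : ℝ, 0 ≤ C ∧ ∀ k φ : (Fin d → ℝ) → ℝ, IsTestKernel L B k → Measurable φ → Integrable φ →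
      (∀ z, |φ z| ≤ 1) → ∀ M : ℕ, (∫ z, φ z * k z) ^ 2 ≤
        C * (∑ m ∈ Finset.range (M + 1),
          (2 / 7) ^ m * avgVar φ ((1 / 7) ^ m) (3 * (1 / 7) ^ m) 1 0) +
        C * (1 / 7) ^ M * (∫ z, |φ z|) ^ 2 := by
  set C₁ := √3 ^ d * √3 ^ d * Real.exp (2 * Real.pi / 3 * B) * (L * Real.exp (Real.pi * B))
  set C₂ := L * Real.exp (13 * Real.pi / 6 * B) * 84 * √28 ^ d * √12 ^ d
  set C₃ := (1 + 2 * L * √2 ^ d) ^ 2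
  have hC₁ : 0 ≤ C₁ := by positivity
  have hC₂ : 0 ≤ C₂ := by positivity
  have hC₃ : 0 ≤ C₃ := by positivity
  refine ⟨4 * (C₁ + C₂) + 2 * C₃, by positivity, fun k φ hk hm hφ hb M => ?_⟩
  set T : ℕ → ℝ := fun m => avgPairing k φ ((1 / 7) ^ m) with hT
  set v : ℕ → ℝ := fun m => avgVar φ ((1 / 7) ^ m) (3 * (1 / 7) ^ m) 1 0 with hv
  have hv0 : ∀ m, 0 ≤ v m := fun m => integral_nonneg fun c => mul_nonneg (gau_nonneg _ _)
    (integral_nonneg fun q => mul_nonneg (gau_nonneg _ _) (sq_nonneg _))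
  set D : ℕ → ℝ := fun m => Nat.casesOn m (T 0) fun i => T (i + 1) - T i with hD
  have hsum : ∀ n, ∑ m ∈ Finset.range (n + 1), D m = T n := fun n => by
    induction n with
    | zero => simp [hD]
    | succ i ih => rw [Finset.sum_range_succ, ih]; simp [hD]
  have hDle : ∀ m, D m ^ 2 ≤ (C₁ + C₂) * (1 / 7) ^ m * v m := fun m => by
    cases m with
    | zero =>
      have h := hk.sq_avgPairing_le hm hb
      simp only [hD, hT, hv, pow_zero, mul_one] at h ⊢
      refine h.trans (mul_le_mul_of_nonneg_right (le_add_of_nonneg_right hC₂) ?_)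
      simpa [hv] using hv0 0
    | succ i =>
      have h := hk.sq_avgPairing_sub_le hm hφ hb (a := (1 / 7) ^ (i + 1)) (by positivity) (by
        rw [pow_succ]
        exact mul_le_of_le_one_left (by norm_num) (pow_le_one₀ (by norm_num) (by norm_num)))
      rw [show (7 : ℝ) * (1 / 7) ^ (i + 1) = (1 / 7) ^ i by ring] at h
      refine h.trans ?_
      have := hv0 (i + 1)
      simp only [hv] at this ⊢
      gcongr
      exact le_add_of_nonneg_left hC₁
  have hgeo : ∑ m ∈ Finset.range (M + 1), (1 / 2 : ℝ) ^ m ≤ 2 := by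
    rw [geom_sum_eq (by norm_num)]
    have : (0 : ℝ) ≤ (1 / 2) ^ (M + 1) := by positivity
    rw [div_le_iff_of_neg (by norm_num)]
    linarith
  have hTM : T M ^ 2 ≤ 2 * ((C₁ + C₂) * ∑ m ∈ Finset.range (M + 1), (2 / 7) ^ m * v m) := by
    rw [← hsum M]
    have h := Finset.sum_sq_le_sum_mul_sum_of_sq_le_mul (Finset.range (M + 1))
      (r := D) (f := fun m => (1 / 2 : ℝ) ^ m) (g := fun m => 2 ^ m * D m ^ 2)
      (fun _ _ => by positivity) (fun _ _ => by positivity) (fun m _ => le_of_eq <| by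
        rw [← mul_assoc, ← mul_pow]
        norm_num)
    refine h.trans (mul_le_mul hgeo ?_ (Finset.sum_nonneg fun _ _ => by positivity) (by norm_num))
    rw [Finset.mul_sum]
    refine Finset.sum_le_sum fun m _ => ?_
    calc (2 : ℝ) ^ m * D m ^ 2 ≤ 2 ^ m * ((C₁ + C₂) * (1 / 7) ^ m * v m) := by
          gcongr
          exact hDle m
      _ = (C₁ + C₂) * ((2 * (1 / 7)) ^ m * v m) := by rw [mul_pow]; ring
      _ = _ := by norm_num
  have herr := hk.abs_avgPairing_sub_integral_le hφ (a := (1 / 7) ^ M) (by positivity)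
  have herr2 : (T M - ∫ z, φ z * k z) ^ 2 ≤ (1 / 7) ^ M * C₃ * (∫ z, |φ z|) ^ 2 := by
    rw [← sq_abs]
    refine (pow_le_pow_left₀ (abs_nonneg _) herr 2).trans (le_of_eq ?_)
    rw [mul_pow, mul_pow, Real.sq_sqrt (by positivity)]
  have hS : 0 ≤ ∑ m ∈ Finset.range (M + 1), (2 / 7) ^ m * v m :=
    Finset.sum_nonneg fun m _ => mul_nonneg (by positivity) (hv0 m)
  have hE : 0 ≤ (1 / 7 : ℝ) ^ M * (∫ z, |φ z|) ^ 2 := by positivity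
  have h2 : (∫ z, φ z * k z) ^ 2 ≤ 2 * T M ^ 2 + 2 * (T M - ∫ z, φ z * k z) ^ 2 := by
    nlinarith [sq_nonneg (2 * T M - ∫ z, φ z * k z)]
  nlinarith [mul_nonneg hC₃ hS, mul_nonneg (add_nonneg hC₁ hC₂) hE]

end TestKernelPairing

section Scaling

variable {d : ℕ} {φ : (Fin d → ℝ) → ℝ} {L B μ : ℝ}

lemma integral_comp_add_smul (F : (Fin d → ℝ) → ℝ) (hμ : 0 < μ) (w : Fin d → ℝ) :
    ∫ z, F (w + μ • z) = (μ ^ d)⁻¹ * ∫ z, F z := by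
  have h := Measure.integral_comp_smul volume (fun z => F (w + z)) μ
  rw [Module.finrank_fin_fun, abs_of_pos (by positivity), smul_eq_mul] at h
  rw [h, integral_add_left_eq_self]

lemma gaussAvg_comp_add_smul (φ : (Fin d → ℝ) → ℝ) (hμ : 0 < μ) (a : ℝ) (w c : Fin d → ℝ) :
    gaussAvg (fun z => φ (w + μ • z)) a c = gaussAvg φ (μ ^ 2 * a) (w + μ • c) := by
  rw [gaussAvg, gaussAvg, ← mul_right_inj' (a := (μ ^ d)⁻¹) (by positivity),
    ← integral_comp_add_smul (fun z => φ z * gau (μ ^ 2 * a) (z - (w + μ • c))) hμ w,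
    ← integral_const_mul]
  refine integral_congr_ae (.of_forall fun z => ?_)
  simp only
  rw [add_sub_add_left_eq_sub, ← smul_sub, gau_smul hμ]
  ring

lemma avgVar_comp_add_smul (φ : (Fin d → ℝ) → ℝ) (hμ : 0 < μ) (a r b : ℝ) (w : Fin d → ℝ) :
    avgVar (fun z => φ (w + μ • z)) a r b 0 =
      avgVar φ (μ ^ 2 * a) (μ ^ 2 * r) (μ ^ 2 * b) w := by
  have hd : (μ ^ d)⁻¹ ≠ 0 := by positivity
  rw [avgVar, avgVar, ← mul_right_inj' hd, ← integral_comp_add_smul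
    (fun c => gau (μ ^ 2 * b) (c - w) * ∫ q, gau (μ ^ 2 * r) q *
      (gaussAvg φ (μ ^ 2 * a) (c + q) - gaussAvg φ (μ ^ 2 * a + μ ^ 2 * r) c) ^ 2) hμ w,
    ← integral_const_mul]
  refine integral_congr_ae (.of_forall fun c => ?_)
  simp only [sub_zero, gaussAvg_comp_add_smul _ hμ]
  rw [add_sub_cancel_left, gau_smul hμ, ← mul_assoc]
  congr 1
  rw [← mul_right_inj' hd, ← integral_const_mul]
  have h := integral_comp_add_smul (fun q => gau (μ ^ 2 * r) q *
      (gaussAvg φ (μ ^ 2 * a) (w + μ • c + q) -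
        gaussAvg φ (μ ^ 2 * a + μ ^ 2 * r) (w + μ • c)) ^ 2) hμ 0
  rw [← h]
  refine integral_congr_ae (.of_forall fun q => ?_)
  simp only [zero_add]
  rw [gau_smul hμ, smul_add, add_assoc, mul_add]
  ring

lemma avgVar_nonneg (φ : (Fin d → ℝ) → ℝ) (a r b : ℝ) (w : Fin d → ℝ) : 0 ≤ avgVar φ a r b w :=
  integral_nonneg fun _ => mul_nonneg (gau_nonneg _ _)
    (integral_nonneg fun _ => mul_nonneg (gau_nonneg _ _) (sq_nonneg _))

/-- The `L¹`-normalized dilate of a kernel. -/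
noncomputable def dilate (k : (Fin d → ℝ) → ℝ) (r : ℝ) (x : Fin d → ℝ) : ℝ :=
  (r ^ d)⁻¹ * k (r⁻¹ • x)

variable {k : (Fin d → ℝ) → ℝ}

lemma dilate_smul (k : (Fin d → ℝ) → ℝ) (hμ : 0 < μ) (r : ℝ) (x : Fin d → ℝ) :
    dilate k (μ * r) (μ • x) = (μ ^ d)⁻¹ * dilate k r x := by
  rw [dilate, dilate, smul_smul, mul_pow, mul_inv, mul_inv, mul_assoc]
  congr 4
  field_simp

namespace IsTestKernel

lemma dilate (hk : IsTestKernel L B k) {r : ℝ} (h1 : 1 ≤ r) (h2 : r ≤ 2) :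
    IsTestKernel L (4 * B) (dilate k r) := by
  have hr : 0 < r := by linarith
  have hd : ((r ^ d)⁻¹) ^ 2 ≤ 1 :=
    pow_le_one₀ (by positivity) (inv_le_one_of_one_le₀ (one_le_pow₀ h1))
  have hr2 : (r⁻¹) ^ 2 ≤ 1 := pow_le_one₀ (by positivity) (inv_le_one_of_one_le₀ h1)
  refine ⟨?_, fun x => ?_, fun x y => ?_, fun x hx => ?_, ?_⟩
  · have := hk.continuous
    unfold _root_.dilate
    fun_prop
  · rw [_root_.dilate, mul_pow]
    exact (mul_le_of_le_one_left (sq_nonneg _) hd).trans (hk.sq_le _)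
  · rw [_root_.dilate, _root_.dilate, ← mul_sub, mul_pow]
    refine ((mul_le_of_le_one_left (sq_nonneg _) hd).trans (hk.sq_sub_le _ _)).trans
      (mul_le_mul_of_nonneg_left (Finset.sum_le_sum fun i _ => ?_) hk.nonneg)
    rw [← smul_sub, Pi.smul_apply, smul_eq_mul, mul_pow]
    exact mul_le_of_le_one_left (sq_nonneg _) hr2
  · rw [_root_.dilate, hk.eq_zero, mul_zero]
    simp only [Pi.smul_apply, smul_eq_mul, mul_pow, ← Finset.mul_sum]
    rw [inv_pow, inv_mul_eq_div, lt_div_iff₀ (by positivity)]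
    have hr4 : r ^ 2 ≤ 4 := by nlinarith
    have := sum_sq_nonneg x
    by_cases hB : 0 ≤ B
    · nlinarith
    · exact lt_of_lt_of_le (mul_neg_of_neg_of_pos (not_le.mp hB) (by positivity)) this
  · simp only [_root_.dilate]
    have h := integral_comp_add_smul k (inv_pos.mpr hr) 0
    simp only [zero_add] at h
    rw [integral_const_mul, h, hk.integral_eq_zero, mul_zero, mul_zero]

end IsTestKernel

lemma IsTestKernel.exists_sq_integral_dilate_le (hk : IsTestKernel L B k) :
    ∃ C : ℝ, 0 ≤ C ∧ ∀ φ : (Fin d → ℝ) → ℝ, Measurable φ → Integrable φ → (∀ z, |φ z| ≤ 1) →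
      ∀ μ r : ℝ, 0 < μ → 1 ≤ r → r ≤ 2 → ∀ (w : Fin d → ℝ) (M : ℕ),
      (∫ s, φ (w + s) * _root_.dilate k (μ * r) s) ^ 2 ≤
        C * (∑ m ∈ Finset.range (M + 1), (2 / 7) ^ m *
          avgVar φ (μ ^ 2 * (1 / 7) ^ m) (3 * (μ ^ 2 * (1 / 7) ^ m)) (μ ^ 2) w) +
        C * (1 / 7) ^ M * ((μ ^ d)⁻¹ * ∫ z, |φ z|) ^ 2 := by
  obtain ⟨C, hC, h⟩ := exists_sq_integral_mul_le d hk.nonneg (4 * B)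
  refine ⟨C, hC, fun φ hm hφ hb μ r hμ h1 h2 w M => ?_⟩
  have hφ' : Integrable fun z => φ (w + μ • z) :=
    (hφ.comp_add_left w).comp_smul hμ.ne'
  have h3 := h _ (fun z => φ (w + μ • z)) (hk.dilate h1 h2) (by fun_prop) hφ' (fun z => hb _) M
  simp only [avgVar_comp_add_smul _ hμ] at h3
  rw [integral_comp_add_smul (fun z => |φ z|) hμ] at h3
  have e : ∫ z, φ (w + μ • z) * _root_.dilate k r z =
      ∫ s, φ (w + s) * _root_.dilate k (μ * r) s := by
    have h4 := integral_comp_add_smul (fun s => φ (w + s) * _root_.dilate k (μ * r) s) hμ 0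
    simp only [zero_add, dilate_smul _ hμ] at h4
    rw [← mul_right_inj' (a := (μ ^ d)⁻¹) (by positivity), ← h4, ← integral_const_mul]
    refine integral_congr_ae (.of_forall fun z => ?_)
    simp only
    ring
  rw [e] at h3
  convert h3 using 6
  · ring
  · ring

end Scaling

section CornerAverages

variable {d : ℕ} {κ k : (Fin d → ℝ) → ℝ} {F H : (Fin d → ℝ) → (Fin d → ℝ) → ℝ} {L B : ℝ}

/-- The average of `F (x + y + s) y * H (x + y + s) x` over `s` against a dilated kernel. -/
noncomputable def cornerAvg (F H : (Fin d → ℝ) → (Fin d → ℝ) → ℝ) (k : (Fin d → ℝ) → ℝ) (r : ℝ)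
    (u : (Fin d → ℝ) × (Fin d → ℝ)) : ℝ :=
  ∫ s, F (u.1 + u.2 + s) u.2 * H (u.1 + u.2 + s) u.1 * dilate k r s

namespace WeightedKernel

lemma measurable_cornerAvg (hF : WeightedKernel κ F) (hH : WeightedKernel κ H) (hk : Measurable k)
    (r : ℝ) : Measurable (cornerAvg F H k r) := by
  unfold cornerAvg
  refine (StronglyMeasurable.integral_prod_right (f := fun (u : (Fin d → ℝ) × (Fin d → ℝ)) s =>
    F (u.1 + u.2 + s) u.2 * H (u.1 + u.2 + s) u.1 * dilate k r s) ?_).measurable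
  unfold dilate
  refine Measurable.stronglyMeasurable (Measurable.mul (Measurable.mul ?_ ?_) (by fun_prop))
  · exact hF.measurable_comp (by fun_prop) (by fun_prop)
  · exact hH.measurable_comp (by fun_prop) (by fun_prop)

lemma sq_integral_abs_mul_slice_le (hF : WeightedKernel κ F) (hH : WeightedKernel κ H)
    (u : (Fin d → ℝ) × (Fin d → ℝ)) :
    (∫ z, |F z u.2 * H z u.1|) ^ 2 ≤ (∫ z, κ z) ^ 2 * (κ u.1 * κ u.2) := by
  have h0 := hF.weight_nonneg
  have h1 := hF.weight_le_one
  have hK : 0 ≤ ∫ z, κ z := integral_nonneg h0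
  have h : ∫ z, |F z u.2 * H z u.1| ≤ (∫ z, κ z) * (κ u.1 * κ u.2) := by
    rw [← integral_mul_const]
    refine integral_mono_of_nonneg (.of_forall fun _ => abs_nonneg _)
      (hF.integrable_weight.mul_const _) (.of_forall fun z => ?_)
    simp only
    rw [abs_mul]
    calc _ ≤ (κ z * κ u.2) * (κ z * κ u.1) :=
          mul_le_mul (hF.abs_le _ _) (hH.abs_le _ _) (abs_nonneg _) (mul_nonneg (h0 _) (h0 _))
      _ = κ z * (κ z * (κ u.1 * κ u.2)) := by ring
      _ ≤ _ := mul_le_of_le_one_left (mul_nonneg (h0 _) (mul_nonneg (h0 _) (h0 _))) (h1 _)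
  have h2 : (κ u.1 * κ u.2) ^ 2 ≤ κ u.1 * κ u.2 := by
    have : κ u.1 * κ u.2 ≤ 1 := mul_le_one₀ (h1 _) (h0 _) (h1 _)
    exact pow_le_of_le_one (mul_nonneg (h0 _) (h0 _)) this two_ne_zero
  refine (pow_le_pow_left₀ (integral_nonneg fun _ => abs_nonneg _) h 2).trans ?_
  rw [mul_pow]
  gcongr

/-- Mean square of a corner average in terms of Gaussian variances at geometric scales. -/
lemma exists_integral_sq_cornerAvg_le (hk : IsTestKernel L B k) :
    ∃ C : ℝ, 0 ≤ C ∧ ∀ (κ : (Fin d → ℝ) → ℝ) (F H : (Fin d → ℝ) → (Fin d → ℝ) → ℝ),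
      WeightedKernel κ F → WeightedKernel κ H → ∀ μ r : ℝ, 0 < μ → 1 ≤ r → r ≤ 2 →
      Integrable (fun u => cornerAvg F H k (μ * r) u ^ 2) ∧
      ∀ M : ℕ, ∫ u, cornerAvg F H k (μ * r) u ^ 2 ≤
        C * (∑ m ∈ Finset.range (M + 1), (2 / 7) ^ m * ∫ u : (Fin d → ℝ) × (Fin d → ℝ),
          avgVar (fun z => F z u.2 * H z u.1) (μ ^ 2 * (1 / 7) ^ m) (3 * (μ ^ 2 * (1 / 7) ^ m))
            (μ ^ 2) (u.1 + u.2)) +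
        C * (((μ ^ d)⁻¹) ^ 2 * (∫ z, κ z) ^ 4) * (1 / 7) ^ M := by
  obtain ⟨C, hC, h⟩ := hk.exists_sq_integral_dilate_le
  refine ⟨C, hC, fun κ F H hF hH μ r hμ h1 h2 => ?_⟩
  set Φ : ℕ → (Fin d → ℝ) × (Fin d → ℝ) → ℝ := fun M u =>
    C * (∑ m ∈ Finset.range (M + 1), (2 / 7) ^ m *
      avgVar (fun z => F z u.2 * H z u.1) (μ ^ 2 * (1 / 7) ^ m) (3 * (μ ^ 2 * (1 / 7) ^ m))
        (μ ^ 2) (u.1 + u.2)) +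
    C * (((μ ^ d)⁻¹) ^ 2 * (∫ z, κ z) ^ 2) * (1 / 7) ^ M * (κ u.1 * κ u.2) with hΦ
  have hle : ∀ M u, cornerAvg F H k (μ * r) u ^ 2 ≤ Φ M u := fun M u => by
    refine (h (fun z => F z u.2 * H z u.1) (hF.measurable_mul_slice hH _ _)
      (hF.integrable_mul_slice hH _ _) (fun z => hF.abs_mul_slice_le hH _ _ _) μ r hμ h1 h2
      (u.1 + u.2) M).trans ?_
    refine add_le_add_right ?_ _
    have h4 := hF.sq_integral_abs_mul_slice_le hH u
    calc _ = C * (1 / 7) ^ M * ((μ ^ d)⁻¹) ^ 2 * (∫ z, |F z u.2 * H z u.1|) ^ 2 := by ring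
      _ ≤ C * (1 / 7) ^ M * ((μ ^ d)⁻¹) ^ 2 * ((∫ z, κ z) ^ 2 * (κ u.1 * κ u.2)) := by gcongr
      _ = _ := by ring
  have i1 : ∀ m : ℕ, Integrable fun u : (Fin d → ℝ) × (Fin d → ℝ) => (2 / 7 : ℝ) ^ m *
      avgVar (fun z => F z u.2 * H z u.1) (μ ^ 2 * (1 / 7) ^ m) (3 * (μ ^ 2 * (1 / 7) ^ m))
        (μ ^ 2) (u.1 + u.2) := fun m =>
    (hF.integrable_avgVar hH (by positivity) (by positivity)).const_mul _
  have i2 := hF.integrable_weight.mul_prod hF.integrable_weight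
  have i3 : ∀ M, Integrable fun u : (Fin d → ℝ) × (Fin d → ℝ) =>
      C * (∑ m ∈ Finset.range (M + 1), (2 / 7) ^ m *
      avgVar (fun z => F z u.2 * H z u.1) (μ ^ 2 * (1 / 7) ^ m) (3 * (μ ^ 2 * (1 / 7) ^ m))
        (μ ^ 2) (u.1 + u.2)) := fun M => (integrable_finsetSum _ fun m _ => i1 m).const_mul _
  have iΦ : ∀ M, Integrable (Φ M) := fun M => (i3 M).add (i2.const_mul _)
  have iT : Integrable (fun u => cornerAvg F H k (μ * r) u ^ 2) :=
    (iΦ 0).mono' ((hF.measurable_cornerAvg hH hk.measurable _).pow_const 2).aestronglyMeasurable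
      (.of_forall fun u => by
        rw [Real.norm_of_nonneg (sq_nonneg _)]
        exact hle 0 u)
  refine ⟨iT, fun M => (integral_mono iT (iΦ M) (hle M)).trans (le_of_eq ?_)⟩
  refine (integral_add (i3 M) (i2.const_mul _)).trans ?_
  rw [integral_const_mul, integral_const_mul, integral_finsetSum _ fun m _ => i1 m,
    show (∫ u : (Fin d → ℝ) × (Fin d → ℝ), κ u.1 * κ u.2) = (∫ z, κ z) * ∫ z, κ z from
      integral_prod_mul _ _]
  simp only [integral_const_mul]
  ring

end WeightedKernel

lemma exists_lacunary_index {J : ℕ} (hJ : 1 ≤ J) {lam : ℕ → ℝ} (hpos : ∀ j, j < J → 0 < lam j)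
    (hlac : ∀ j, j + 1 < J → 2 * lam j ≤ lam (j + 1)) :
    ∃ n : ℕ → ℕ, Set.InjOn n (Finset.range J) ∧
      ∀ j < J, 2 ^ n j * lam 0 ≤ lam j ∧ lam j ≤ 2 * (2 ^ n j * lam 0) := by
  have h0 : 0 < lam 0 := hpos 0 (by lia)
  have hlac' : ∀ i j, i < j → j < J → 2 * lam i ≤ lam j := fun i j hij => by
    induction j, hij using Nat.le_induction with
    | base => exact hlac i
    | succ j hij ih =>
      intro hj
      have h1 := ih (by lia)
      have h2 := hlac j hj
      have h3 := hpos j (by lia)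
      linarith
  have hone : ∀ j < J, 1 ≤ lam j / lam 0 := fun j hj => by
    rw [one_le_div h0]
    rcases j.eq_zero_or_pos with rfl | h
    · exact le_rfl
    · linarith [hlac' 0 j h hj]
  have hex : ∀ j, ∃ n : ℕ, j < J → 2 ^ n ≤ lam j / lam 0 ∧ lam j / lam 0 < 2 ^ (n + 1) :=
    fun j => by
      by_cases hj : j < J
      · obtain ⟨n, hn⟩ := exists_nat_pow_near (hone j hj) (one_lt_two (α := ℝ))
        exact ⟨n, fun _ => hn⟩
      · exact ⟨0, fun h => absurd h hj⟩
  choose n hn using hex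
  have hlt : ∀ i j, i < j → j < J → n i < n j := fun i j hij hj => by
    have h1 := (hn i (hij.trans hj)).1
    have h2 := (hn j hj).2
    have h3 := div_le_div_of_nonneg_right (hlac' i j hij hj) h0.le
    have h4 : (2 : ℝ) ^ (n i + 1) < 2 ^ (n j + 1) := by
      rw [mul_div_assoc] at h3
      rw [pow_succ]
      linarith
    have := (pow_lt_pow_iff_right₀ one_lt_two).mp h4
    lia
  refine ⟨n, fun i hi j hj hij => ?_, fun j hj => ?_⟩
  · simp only [Finset.coe_range, Set.mem_Iio] at hi hj
    rcases lt_trichotomy i j with h | h | h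
    · exact absurd hij (hlt i j h hj).ne
    · exact h
    · exact absurd hij.symm (hlt j i h hi).ne
  · obtain ⟨h1, h2⟩ := hn j hj
    rw [le_div_iff₀ h0] at h1
    rw [div_lt_iff₀ h0, pow_succ] at h2
    exact ⟨h1, by linarith⟩

/-- Square function estimate for corner averages at lacunary scales. -/
lemma WeightedKernel.exists_sum_integral_sq_cornerAvg_le (hk : IsTestKernel L B k) :
    ∃ C : ℝ, 0 ≤ C ∧ ∀ (κ : (Fin d → ℝ) → ℝ) (F H : (Fin d → ℝ) → (Fin d → ℝ) → ℝ),
      WeightedKernel κ F → WeightedKernel κ H → ∀ A : ℝ,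
      (∫ t : (Fin d → ℝ) × (Fin d → ℝ), |F t.1 t.2| ≤ A) →
      (∫ t : (Fin d → ℝ) × (Fin d → ℝ), |H t.1 t.2| ≤ A) →
      ∀ J : ℕ, 1 ≤ J → ∀ lam : ℕ → ℝ, (∀ j, j < J → 0 < lam j) →
      (∀ j, j + 1 < J → 2 * lam j ≤ lam (j + 1)) →
      (∀ j < J, Integrable fun u => cornerAvg F H k (lam j) u ^ 2) ∧
      ∑ j ∈ Finset.range J, ∫ u, cornerAvg F H k (lam j) u ^ 2 ≤ C * A := by
  obtain ⟨C, hC, h⟩ := exists_integral_sq_cornerAvg_le hk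
  refine ⟨C * (7 / 5 * 3), by positivity,
    fun κ F H hF hH A hFA hHA J hJ lam hpos hlac => ?_⟩
  obtain ⟨n, hinj, hn⟩ := exists_lacunary_index hJ hpos hlac
  have h0 : 0 < lam 0 := hpos 0 (by lia)
  have hA : 0 ≤ A := (integral_nonneg fun _ => abs_nonneg _).trans hFA
  have hμ : ∀ j, 0 < 2 ^ n j * lam 0 := fun j => by positivity
  have hscale : ∀ j < J, Integrable (fun u => cornerAvg F H k (lam j) u ^ 2) ∧ _ := fun j hj => by
    have h1 := h κ F H hF hH (2 ^ n j * lam 0) (lam j / (2 ^ n j * lam 0)) (hμ j)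
      ((one_le_div (hμ j)).mpr (hn j hj).1) ((div_le_iff₀ (hμ j)).mpr (hn j hj).2)
    rwa [mul_div_cancel₀ _ (hμ j).ne'] at h1
  refine ⟨fun j hj => (hscale j hj).1, ?_⟩
  set X : ℕ → ℕ → ℝ := fun m l => ∫ u : (Fin d → ℝ) × (Fin d → ℝ),
    avgVar (fun z => F z u.2 * H z u.1) (4 ^ l * (lam 0 ^ 2 * (1 / 7) ^ m))
      (3 * (4 ^ l * (lam 0 ^ 2 * (1 / 7) ^ m))) (4 ^ l * lam 0 ^ 2) (u.1 + u.2) with hX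
  have hX0 : ∀ m l, 0 ≤ X m l := fun m l => integral_nonneg fun _ => avgVar_nonneg _ _ _ _ _
  have hXsum : ∀ m, ∑ j ∈ Finset.range J, X m (n j) ≤ 3 * A := fun m => by
    rw [← Finset.sum_image (f := X m) hinj]
    refine le_trans (Finset.sum_le_sum_of_subset_of_nonneg
      (Finset.image_subset_iff.mpr fun j hj => Finset.mem_range_succ_iff.mpr
        (Finset.le_sup hj)) fun l _ _ => hX0 m l)
      (hF.sum_integral_avgVar_le hH (by positivity) (by positivity) hFA hHA
        ((Finset.range J).sup n + 1))
  set R : ℝ := ∑ j ∈ Finset.range J, C * ((((2 ^ n j * lam 0) ^ d)⁻¹) ^ 2 * (∫ z, κ z) ^ 4)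
  have hM : ∀ M : ℕ, ∑ j ∈ Finset.range J, ∫ u, cornerAvg F H k (lam j) u ^ 2 ≤
      C * (7 / 5 * 3) * A + R * (1 / 7) ^ M := fun M => by
    have hj : ∀ j ∈ Finset.range J, ∫ u, cornerAvg F H k (lam j) u ^ 2 ≤
        C * (∑ m ∈ Finset.range (M + 1), (2 / 7) ^ m * X m (n j)) +
        C * ((((2 ^ n j * lam 0) ^ d)⁻¹) ^ 2 * (∫ z, κ z) ^ 4) * (1 / 7) ^ M := fun j hj => by
      have h1 := (hscale j (Finset.mem_range.mp hj)).2 M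
      have e : (2 ^ n j * lam 0) ^ 2 = 4 ^ n j * lam 0 ^ 2 := by
        rw [mul_pow, ← pow_mul, mul_comm (n j), pow_mul]
        norm_num
      simp only [e, mul_assoc ((4 : ℝ) ^ n j)] at h1
      exact h1
    refine (Finset.sum_le_sum hj).trans ?_
    rw [Finset.sum_add_distrib, ← Finset.sum_mul, ← Finset.mul_sum, Finset.sum_comm]
    refine add_le_add_left ?_ _
    rw [mul_assoc]
    refine mul_le_mul_of_nonneg_left ?_ hC
    have hgeo : ∑ m ∈ Finset.range (M + 1), (2 / 7 : ℝ) ^ m ≤ 7 / 5 := by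
      rw [geom_sum_eq (by norm_num), div_le_iff_of_neg (by norm_num)]
      have : (0 : ℝ) ≤ (2 / 7) ^ (M + 1) := by positivity
      linarith
    calc _ ≤ ∑ m ∈ Finset.range (M + 1), (2 / 7) ^ m * (3 * A) := by
          refine Finset.sum_le_sum fun m _ => ?_
          rw [← Finset.mul_sum]
          exact mul_le_mul_of_nonneg_left (hXsum m) (by positivity)
      _ ≤ 7 / 5 * (3 * A) := by
          rw [← Finset.sum_mul]
          gcongr
      _ = _ := by ring
  have ht : Filter.Tendsto (fun M : ℕ => C * (7 / 5 * 3) * A + R * (1 / 7) ^ M) Filter.atTop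
      (nhds (C * (7 / 5 * 3) * A + R * 0)) :=
    ((tendsto_pow_atTop_nhds_zero_of_lt_one (by norm_num) (by norm_num)).const_mul R).const_add _
  rw [mul_zero, add_zero] at ht
  exact ge_of_tendsto' ht hM

end CornerAverages

section Kernel

variable {d : ℕ} {k : (Fin d → ℝ) → ℝ}

lemma exists_isTestKernel (hk : ContDiff ℝ 1 k) (hs : HasCompactSupport k) (h0 : ∫ x, k x = 0) :
    ∃ L B, IsTestKernel L B k := by
  obtain ⟨A, hA⟩ := hs.exists_bound_of_continuous hk.continuous
  obtain ⟨K, hK⟩ := ContDiff.lipschitzWith_of_hasCompactSupport hs hk one_ne_zero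
  obtain ⟨R, hR⟩ := hs.isCompact.isBounded.exists_norm_le
  refine ⟨A ^ 2 + K ^ 2, d * R ^ 2, hk.continuous, fun x => ?_, fun x y => ?_, fun x hx => ?_, h0⟩
  · have h := pow_le_pow_left₀ (norm_nonneg _) (hA x) 2
    rw [Real.norm_eq_abs, sq_abs] at h
    nlinarith [sq_nonneg (K : ℝ)]
  · have h := hK.dist_le_mul x y
    rw [Real.dist_eq, dist_eq_norm] at h
    have h1 := pow_le_pow_left₀ (abs_nonneg _) h 2
    rw [sq_abs, mul_pow] at h1
    have h2 : ‖x - y‖ ^ 2 ≤ ∑ i, (x - y) i ^ 2 := by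
      rw [← Real.sq_sqrt (sum_sq_nonneg (x - y))]
      refine pow_le_pow_left₀ (norm_nonneg _)
        ((pi_norm_le_iff_of_nonneg (Real.sqrt_nonneg _)).mpr fun i => Real.abs_le_sqrt ?_) 2
      exact Finset.single_le_sum (f := fun i => (x - y) i ^ 2) (fun _ _ => sq_nonneg _)
        (Finset.mem_univ i)
    calc _ ≤ _ := h1
      _ ≤ (K : ℝ) ^ 2 * ∑ i, (x - y) i ^ 2 := by gcongr
      _ ≤ _ := by
        have := sum_sq_nonneg (x - y)
        gcongr
        nlinarith [sq_nonneg A]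
  · by_contra hne
    have h := hR x (subset_tsupport _ hne)
    have h3 : ∑ i, x i ^ 2 ≤ ∑ _i : Fin d, R ^ 2 := Finset.sum_le_sum fun i _ => by
      rw [← sq_abs]
      exact pow_le_pow_left₀ (abs_nonneg _) ((norm_le_pi_norm x i).trans h) 2
    simp only [Finset.sum_const, Finset.card_univ, Fintype.card_fin, nsmul_eq_mul] at h3
    linarith

lemma contDiff_psiHat (ψ : SchwartzMap ℝ ℝ) : ContDiff ℝ 1 (psiHat fun x => ψ x) := by
  have h : psiHat (fun x => ψ x) = FourierTransform.fourier fun x => (ψ x : ℂ) := by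
    ext ξ
    rw [Real.fourier_real_eq_integral_exp_smul, psiHat]
    refine integral_congr_ae (.of_forall fun x => ?_)
    simp only [smul_eq_mul]
    congr 2
    push_cast
    ring
  rw [h]
  refine Real.contDiff_fourier (N := 1) fun n _ => ?_
  simpa using ψ.integrable_pow_mul volume n

variable {ψ : SchwartzMap ℝ ℝ} {p ε : ℝ}

lemma contDiff_omegaFn (ψ : SchwartzMap ℝ ℝ) (hp : 1 < p) (d : ℕ) (ε : ℝ) :
    ContDiff ℝ 1 (omegaFn (fun x => ψ x) p d 1 ε) := by
  unfold omegaFn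
  have h1 : ContDiff ℝ 1 fun ξ => (psiHat (fun x => ψ x) ξ).re :=
    Complex.reCLM.contDiff.comp (contDiff_psiHat ψ)
  have h2 : ContDiff ℝ 1 fun t : ℝ => |t| ^ p := contDiff_norm_rpow hp
  refine contDiff_const.mul (h1.comp (contDiff_const.mul (contDiff_const.sub
    (ContDiff.sum fun i _ => h2.comp ?_))))
  fun_prop

lemma hasCompactSupport_omegaFn (hψ : HasCompactSupport (psiHat fun x => ψ x)) (hp : 1 < p)
    (hε : 0 < ε) : HasCompactSupport (omegaFn (fun x => ψ x) p d 1 ε) := by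
  obtain ⟨R, hR⟩ := hψ.isCompact.isBounded.exists_norm_le
  refine HasCompactSupport.intro (isCompact_closedBall 0 (max 1 (1 + ε * R))) fun s hs => ?_
  rw [omegaFn]
  by_contra hne
  apply hs
  have h1 : psiHat (fun x => ψ x) (ε⁻¹ * (1 - ∑ i, |1⁻¹ * s i| ^ p)) ≠ 0 := fun h =>
    hne (by rw [h, Complex.zero_re, mul_zero])
  have h2 := (neg_le_abs _).trans (hR _ (subset_tsupport _ h1))
  rw [mem_closedBall_zero_iff, pi_norm_le_iff_of_nonneg (by positivity)]
  intro i
  rw [Real.norm_eq_abs]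
  by_cases h3 : |s i| ≤ 1
  · exact h3.trans (le_max_left _ _)
  · refine le_trans ?_ (le_max_right _ _)
    have h4 : |s i| ≤ |s i| ^ p := Real.self_le_rpow_of_one_le (not_le.mp h3).le hp.le
    have h5 : |s i| ^ p ≤ ∑ i, |s i| ^ p :=
      Finset.single_le_sum (f := fun i => |s i| ^ p) (fun _ _ => by positivity) (Finset.mem_univ i)
    simp only [inv_one, one_mul] at h2
    rw [← mul_neg, inv_mul_le_iff₀ hε] at h2
    linarith

lemma omegaFn_eq_dilate (lam : ℝ) (s : Fin d → ℝ) :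
    omegaFn (fun x => ψ x) p d lam ε s = dilate (omegaFn (fun x => ψ x) p d 1 ε) lam s := by
  simp [omegaFn, dilate, mul_assoc]

/-- The unit-scale kernel of the error form. -/
noncomputable def errorKernel (ψ : ℝ → ℝ) (p : ℝ) (d : ℕ) (ε : ℝ) (s : Fin d → ℝ) : ℝ :=
  omegaFn ψ p d 1 ε s - c1 ψ p d ε * omegaFn ψ p d 1 1 s

lemma exists_isTestKernel_errorKernel (hp : 1 < p) (hε : 0 < ε)
    (hψ0 : ∀ ξ, 0 ≤ (psiHat (fun x => ψ x) ξ).re)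
    (hψs : HasCompactSupport (psiHat fun x => ψ x)) (hψ1 : 0 < (psiHat (fun x => ψ x) 1).re) :
    ∃ L B, IsTestKernel L B (errorKernel (fun x => ψ x) p d ε) := by
  have c := contDiff_omegaFn ψ hp d
  have s := fun {δ : ℝ} (hδ : 0 < δ) => hasCompactSupport_omegaFn (d := d) hψs hp hδ
  have i := fun {δ : ℝ} (hδ : 0 < δ) =>
    (c δ).continuous.integrable_of_hasCompactSupport (μ := volume) (s hδ)
  have hpos : 0 < ∫ x : Fin d → ℝ, omegaFn (fun x => ψ x) p d 1 1 x := by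
    refine (c 1).continuous.integral_pos_of_hasCompactSupport_nonneg_nonzero (s one_pos)
      (x := 0) (fun x => ?_) ?_
    · rw [Pi.zero_apply, omegaFn]
      exact mul_nonneg (by positivity) (hψ0 _)
    · have : (0 : ℝ) ^ p = 0 := Real.zero_rpow (by linarith)
      simp [omegaFn, this, hψ1.ne']
  refine exists_isTestKernel ((c ε).sub (contDiff_const.mul (c 1)))
    ((s hε).sub ((s one_pos).mul_left)) ?_
  simp only [errorKernel]
  rw [integral_sub (i hε) ((i one_pos).const_mul _), integral_const_mul, c1,
    div_mul_cancel₀ _ hpos.ne', sub_self]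

end Kernel

section Corners

variable {d : ℕ} {N : ℝ} {f : (Fin d → ℝ) × (Fin d → ℝ) → ℝ} {k : (Fin d → ℝ) → ℝ}

lemma integrable_dilate (hk : Integrable k) {r : ℝ} (hr : 0 < r) : Integrable (dilate k r) := by
  unfold dilate
  exact (hk.comp_smul (inv_ne_zero hr.ne')).const_mul _

/-- Measurable functions with values in `[-1, 1]` supported in the square of the cube
`[0, N] ^ d`. -/
structure IsCubeFunction (N : ℝ) (f : (Fin d → ℝ) × (Fin d → ℝ) → ℝ) : Prop where
  pos : 0 < N
  measurable : Measurable f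
  mem_Icc : ∀ z, f z ∈ Set.Icc (-1 : ℝ) 1
  mem_cube : ∀ z, f z ≠ 0 → z ∈ Set.Icc (0 : Fin d → ℝ) (fun _ => N) ×ˢ
    Set.Icc (0 : Fin d → ℝ) (fun _ => N)

namespace IsCubeFunction

lemma abs_le_one (hf : IsCubeFunction N f) (z) : |f z| ≤ 1 :=
  abs_le.mpr (hf.mem_Icc z)

lemma integrable (hf : IsCubeFunction N f) : Integrable f := by
  refine (integrableOn_iff_integrable_of_support_subset hf.mem_cube).mp ?_
  refine IntegrableOn.of_bound (C := 1) ?_ hf.measurable.aestronglyMeasurable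
    (.of_forall hf.abs_le_one)
  exact (isCompact_Icc.prod isCompact_Icc).measure_lt_top

lemma integral_abs_le (hf : IsCubeFunction N f) : ∫ z, |f z| ≤ N ^ (2 * d) := by
  have h1 : ∫ z in Set.Icc (0 : Fin d → ℝ) (fun _ => N) ×ˢ Set.Icc (0 : Fin d → ℝ) (fun _ => N),
      |f z| = ∫ z, |f z| :=
    setIntegral_eq_integral_of_forall_compl_eq_zero fun z hz => by
      by_contra h
      exact hz (hf.mem_cube z (abs_ne_zero.mp h))
  have h2 := norm_setIntegral_le_of_norm_le_const (f := fun z => |f z|) (C := 1)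
    (isCompact_Icc.prod isCompact_Icc).measure_lt_top
    (s := Set.Icc (0 : Fin d → ℝ) (fun _ => N) ×ˢ Set.Icc (0 : Fin d → ℝ) (fun _ => N))
    (μ := volume) fun z _ => by
      rw [Real.norm_eq_abs, abs_abs]
      exact hf.abs_le_one z
  rw [h1] at h2
  refine ((le_abs_self _).trans h2).trans (le_of_eq ?_)
  rw [Measure.real, Measure.volume_eq_prod, Measure.prod_prod, ENNReal.toReal_mul,
    Real.volume_Icc_pi_toReal (a := 0) fun _ => hf.pos.le]
  simp only [Pi.zero_apply, sub_zero, Finset.prod_const, Finset.card_univ, Fintype.card_fin]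
  ring

lemma weightedKernel_fst (hf : IsCubeFunction N f) :
    WeightedKernel ((Set.Icc (0 : Fin d → ℝ) fun _ => 2 * N).indicator 1)
      fun z y => f (z - y, y) := by
  refine ⟨measurable_one.indicator measurableSet_Icc,
    fun z => Set.indicator_nonneg (fun _ _ => zero_le_one) z,
    fun z => Set.indicator_le' (fun _ _ => le_rfl) (fun _ _ => zero_le_one) z,
    (integrable_indicator_iff measurableSet_Icc).mpr
      (integrableOn_const isCompact_Icc.measure_lt_top.ne), ?_, fun z y => ?_⟩
  · exact hf.measurable.comp (by fun_prop)
  · by_cases h : f (z - y, y) = 0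
    · rw [h, abs_zero]
      exact mul_nonneg (Set.indicator_nonneg (fun _ _ => zero_le_one) z)
        (Set.indicator_nonneg (fun _ _ => zero_le_one) y)
    · obtain ⟨⟨h1, h2⟩, h3, h4⟩ := hf.mem_cube _ h
      have hN := hf.pos
      have hz : z ∈ Set.Icc (0 : Fin d → ℝ) fun _ => 2 * N := by
        refine ⟨fun i => ?_, fun i => ?_⟩ <;>
        · have h1 := h1 i
          have h2 := h2 i
          have h3 := h3 i
          have h4 := h4 i
          simp only [Pi.zero_apply, Pi.sub_apply] at *
          linarith
      have hy : y ∈ Set.Icc (0 : Fin d → ℝ) fun _ => 2 * N :=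
        ⟨h3, fun i => (h4 i).trans (by linarith)⟩
      rw [Set.indicator_of_mem hz, Set.indicator_of_mem hy]
      simpa using hf.abs_le_one _

lemma swap (hf : IsCubeFunction N f) : IsCubeFunction N fun z => f z.swap :=
  ⟨hf.1, hf.2.comp measurable_swap, fun z => hf.3 z.swap, fun z hz => (hf.4 z.swap hz).symm⟩

lemma weightedKernel_snd (hf : IsCubeFunction N f) :
    WeightedKernel ((Set.Icc (0 : Fin d → ℝ) fun _ => 2 * N).indicator 1)
      fun z x => f (x, z - x) :=
  hf.swap.weightedKernel_fst

lemma integral_abs_shear_fst_le (hf : IsCubeFunction N f) :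
    ∫ t : (Fin d → ℝ) × (Fin d → ℝ), |f (t.1 - t.2, t.2)| ≤ N ^ (2 * d) := by
  refine le_trans (le_of_eq ?_) hf.integral_abs_le
  refine (integral_prod_symm _ hf.weightedKernel_fst.integrable.abs).trans
    (Eq.trans ?_ (integral_prod_symm _ hf.integrable.abs).symm)
  refine integral_congr_ae (.of_forall fun y => ?_)
  exact integral_sub_right_eq_self (fun x => |f (x, y)|) y

lemma integral_abs_shear_snd_le (hf : IsCubeFunction N f) :
    ∫ t : (Fin d → ℝ) × (Fin d → ℝ), |f (t.2, t.1 - t.2)| ≤ N ^ (2 * d) :=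
  hf.swap.integral_abs_shear_fst_le

lemma integral_sq_le (hf : IsCubeFunction N f) : ∫ z, f z ^ 2 ≤ N ^ (2 * d) := by
  refine (integral_mono_of_nonneg (.of_forall fun z => sq_nonneg _) hf.integrable.abs
    (.of_forall fun z => ?_)).trans hf.integral_abs_le
  simp only
  rw [← sq_abs]
  exact pow_le_of_le_one (abs_nonneg _) (hf.abs_le_one z) two_ne_zero

lemma integrable_sq (hf : IsCubeFunction N f) : Integrable fun z => f z ^ 2 := by
  refine hf.integrable.abs.mono' (hf.measurable.pow_const 2).aestronglyMeasurable
    (.of_forall fun z => ?_)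
  rw [Real.norm_of_nonneg (sq_nonneg _), ← sq_abs]
  exact pow_le_of_le_one (abs_nonneg _) (hf.abs_le_one z) two_ne_zero

lemma integrable_corner_mul (hf : IsCubeFunction N f) (hk : Integrable k)
    (u : (Fin d → ℝ) × (Fin d → ℝ)) :
    Integrable fun s => f (u.1 + u.2 + s - u.2, u.2) * f (u.1, u.1 + u.2 + s - u.1) * k s := by
  have hm := hf.measurable
  refine hk.bdd_mul (c := 1) (Measurable.aestronglyMeasurable (by fun_prop))
    (.of_forall fun s => ?_)
  rw [norm_mul]
  exact mul_le_one₀ (hf.abs_le_one _) (norm_nonneg _) (hf.abs_le_one _)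

lemma integrable_mul_cornerAvg (hf : IsCubeFunction N f) (hk : Integrable k) (hkm : Measurable k)
    {r : ℝ} (hr : 0 < r) : Integrable fun u => f u *
      cornerAvg (fun z y => f (z - y, y)) (fun z x => f (x, z - x)) k r u := by
  refine hf.integrable.mul_bdd (c := ∫ s, ‖dilate k r s‖)
    (hf.weightedKernel_fst.measurable_cornerAvg hf.weightedKernel_snd hkm r).aestronglyMeasurable
    (.of_forall fun u => ?_)
  refine norm_integral_le_of_norm_le (integrable_dilate hk hr).norm (.of_forall fun s => ?_)
  rw [norm_mul, norm_mul]
  exact mul_le_of_le_one_left (norm_nonneg _)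
    (mul_le_one₀ (hf.abs_le_one _) (norm_nonneg _) (hf.abs_le_one _))

lemma Mform_eq (hf : IsCubeFunction N f) {ψ : SchwartzMap ℝ ℝ} {p : ℝ} (hp : 1 < p)
    (hψ : HasCompactSupport (psiHat fun x => ψ x)) {lam δ : ℝ} (hlam : 0 < lam) (hδ : 0 < δ) :
    Mform (fun x => ψ x) p d lam δ f = ∫ u, f u *
      cornerAvg (fun z y => f (z - y, y)) (fun z x => f (x, z - x))
        (omegaFn (fun x => ψ x) p d 1 δ) lam u := by
  have hc := (contDiff_omegaFn ψ hp d δ).continuous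
  refine Eq.trans ?_ (integral_prod _ (hf.integrable_mul_cornerAvg
    (hc.integrable_of_hasCompactSupport (hasCompactSupport_omegaFn hψ hp hδ))
    hc.measurable hlam)).symm
  rw [Mform]
  refine integral_congr_ae (.of_forall fun x => integral_congr_ae (.of_forall fun y => ?_))
  simp only
  rw [cornerAvg, ← integral_const_mul]
  refine integral_congr_ae (.of_forall fun s => ?_)
  simp only
  rw [omegaFn_eq_dilate, show x + y + s - y = x + s by abel, add_assoc, add_sub_cancel_left]
  ring

lemma Eform_eq (hf : IsCubeFunction N f) {ψ : SchwartzMap ℝ ℝ} {p : ℝ} (hp : 1 < p)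
    (hψ : HasCompactSupport (psiHat fun x => ψ x)) {lam ε : ℝ} (hlam : 0 < lam) (hε : 0 < ε) :
    Eform (fun x => ψ x) p d lam ε f = ∫ u, f u *
      cornerAvg (fun z y => f (z - y, y)) (fun z x => f (x, z - x))
        (errorKernel (fun x => ψ x) p d ε) lam u := by
  have hc := fun δ => (contDiff_omegaFn ψ hp d δ).continuous
  have hi := fun {δ : ℝ} (hδ : 0 < δ) => (hc δ).integrable_of_hasCompactSupport (μ := volume)
    (hasCompactSupport_omegaFn hψ hp hδ)
  rw [Eform, hf.Mform_eq hp hψ hlam hε, hf.Mform_eq hp hψ hlam one_pos, ← integral_const_mul]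
  refine (integral_sub (hf.integrable_mul_cornerAvg (hi hε) (hc ε).measurable hlam)
    ((hf.integrable_mul_cornerAvg (hi one_pos) (hc 1).measurable hlam).const_mul _)).symm.trans ?_
  refine integral_congr_ae (.of_forall fun u => ?_)
  simp only
  rw [mul_left_comm, ← mul_sub, cornerAvg, cornerAvg, cornerAvg, ← integral_const_mul,
    ← integral_sub (hf.integrable_corner_mul (integrable_dilate (hi hε) hlam) u)
      ((hf.integrable_corner_mul (integrable_dilate (hi one_pos) hlam) u).const_mul _)]
  congr 1
  refine integral_congr_ae (.of_forall fun s => ?_)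
  simp only [dilate, errorKernel]
  ring

end IsCubeFunction

end Corners

theorem Eform_square_function_bound (p : ℝ) (hp : 1 < p) (d : ℕ) (hd : 1 ≤ d)
    (ε : ℝ) (hε0 : 0 < ε) (hε1 : ε < 1)
    (ψ : SchwartzMap ℝ ℝ) (hψ01 : ∀ x, ψ x ∈ Set.Icc (0 : ℝ) 1) (hψ0 : ψ 0 = 1)
    (hψhat_re : ∀ ξ, 0 ≤ (psiHat (fun x => ψ x) ξ).re)
    (hψhat_im : ∀ ξ, (psiHat (fun x => ψ x) ξ).im = 0)
    (hψhat_supp : HasCompactSupport (psiHat (fun x => ψ x)))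
    (hψhat1 : 0 < (psiHat (fun x => ψ x) 1).re) :
    ∃ C : ℝ, ∀ J : ℕ, 1 ≤ J → ∀ lam : ℕ → ℝ,
      (∀ j, j < J → 0 < lam j) →
      (∀ j, j + 1 < J → lam j < lam (j + 1)) →
      (∀ j, j + 1 < J → 2 * lam j ≤ lam (j + 1)) →
      ∀ N : ℝ, 0 < N →
        ∀ f : (Fin d → ℝ) × (Fin d → ℝ) → ℝ, Measurable f →
          (∀ z, f z ∈ Set.Icc (-1 : ℝ) 1) →
          (∀ z, f z ≠ 0 →
            z ∈ Set.Icc (0 : Fin d → ℝ) (fun _ => N) ×ˢ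
                Set.Icc (0 : Fin d → ℝ) (fun _ => N)) →
          ∑ j ∈ Finset.range J, (Eform (fun x => ψ x) p d (lam j) ε f) ^ 2 ≤
            C * N ^ (4 * d) := by
  obtain ⟨L, B, hk⟩ :=
    exists_isTestKernel_errorKernel (d := d) hp hε0 hψhat_re hψhat_supp hψhat1
  obtain ⟨C, -, h⟩ := WeightedKernel.exists_sum_integral_sq_cornerAvg_le hk
  refine ⟨C, fun J hJ lam hpos _ hlac N hN f hfm hf1 hfs => ?_⟩
  have hf : IsCubeFunction N f := ⟨hN, hfm, hf1, hfs⟩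
  obtain ⟨hint, hsum⟩ := h _ _ _ hf.weightedKernel_fst hf.weightedKernel_snd (N ^ (2 * d))
    hf.integral_abs_shear_fst_le hf.integral_abs_shear_snd_le J hJ lam hpos hlac
  calc _ ≤ ∑ j ∈ Finset.range J, N ^ (2 * d) * ∫ u,
        cornerAvg (fun z y => f (z - y, y)) (fun z x => f (x, z - x))
          (errorKernel (fun x => ψ x) p d ε) (lam j) u ^ 2 := by
        refine Finset.sum_le_sum fun j hj => ?_
        have hj := Finset.mem_range.mp hj
        rw [hf.Eform_eq hp hψhat_supp (hpos j hj) hε0]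
        refine (sq_integral_mul_le_s11 (hf.integrable_mul_cornerAvg hk.integrable hk.measurable
          (hpos j hj)) hf.integrable_sq (hint j hj)).trans ?_
        exact mul_le_mul_of_nonneg_right hf.integral_sq_le (integral_nonneg fun _ => sq_nonneg _)
    _ ≤ N ^ (2 * d) * (C * N ^ (2 * d)) := by
        rw [← Finset.mul_sum]
        exact mul_le_mul_of_nonneg_left hsum (by positivity)
    _ = C * N ^ (4 * d) := by ring
end
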